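/- For every positive integer w, the ℚ-vector space MPV(w,4) spanned by all multiple polylogarithm values of weight w at fourth roots of unity has dimension at most 2^w, i.e., d(w,4) ≤ 2^w. -/

import Mathlib

open Filter Topology

/-- `mpvPartial l m` is the finite iterated sum
`∑_{m > k₁ > k₂ > ⋯ > kₙ > 0} ∏ⱼ ζⱼ^{kⱼ} / kⱼ^{sⱼ}`, where `l = [(s₁,ζ₁),…,(sₙ,ζₙ)]`,
i.e. the partial sum (in the outermost variable `k₁`) of the multiple
polylogarithm series; the inner sums are finite. -/
noncomputable def mpvPartial : List (ℕ × ℂ) → ℕ → ℂ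
  | [], _ => 1
  | (s, z) :: t, m => ∑ k ∈ Finset.Ico 1 m, z ^ k / (k : ℂ) ^ s * mpvPartial t k

/-- The multiple polylogarithm value
`Li_{s₁,…,sₙ}(ζ₁,…,ζₙ) = ∑_{k₁>⋯>kₙ>0} ζ₁^{k₁}⋯ζₙ^{kₙ} / (k₁^{s₁}⋯kₙ^{sₙ})`,
encoded by the list `l = [(s₁,ζ₁),…,(sₙ,ζₙ)]`: the limit of the sequence of
partial sums in the outermost summation variable. -/
noncomputable def Li (l : List (ℕ × ℂ)) : ℂ :=
  limUnder atTop (mpvPartial l)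

/-- The set of all multiple polylogarithm values of weight `w` and level `N`:
values `Li_{s₁,…,sₙ}(ζ₁,…,ζₙ)` with all `sⱼ ≥ 1`, all `ζⱼ` being `N`-th roots of
unity, total weight `s₁+⋯+sₙ = w`, and `(s₁,ζ₁) ≠ (1,1)`. -/
def MPVset (w N : ℕ) : Set ℂ :=
  {x | ∃ l : List (ℕ × ℂ),
    (∀ q ∈ l, 0 < q.1 ∧ q.2 ^ N = 1) ∧
    (l.map Prod.fst).sum = w ∧
    l.head? ≠ some (1, 1) ∧
    x = Li l}

/-- `MPV w N` is the `ℚ`-vector subspace of `ℂ` spanned by all multiple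
polylogarithm values of weight `w` and level `N`. -/
noncomputable def MPV (w N : ℕ) : Submodule ℚ ℂ :=
  Submodule.span ℚ (MPVset w N)

namespace MPL

open Set MeasureTheory intervalIntegral

/-- The gauge `t^{1/2}(1-t)^{-1/4}` controlling iterated integrals on `(0,1)`. -/
noncomputable def gauge (t : ℝ) : ℝ := t ^ (1 / 2 : ℝ) * (1 - t) ^ (-(1 / 4) : ℝ)

lemma gauge_zero : gauge 0 = 0 := by simp [gauge]

lemma gauge_nonneg {t : ℝ} (h0 : 0 ≤ t) (h1 : t ≤ 1) : 0 ≤ gauge t :=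
  mul_nonneg (Real.rpow_nonneg h0 _) (Real.rpow_nonneg (by linarith) _)

lemma continuousOn_gauge : ContinuousOn gauge (Ico 0 1) := by
  refine ContinuousOn.mul (Continuous.continuousOn ?_) ?_
  · exact Real.continuous_rpow_const (by norm_num)
  · refine ContinuousOn.rpow_const (by fun_prop) ?_
    intro x hx
    left
    have := hx.2
    linarith

lemma hasDerivAt_gauge {t : ℝ} (ht : t ∈ Ioo (0 : ℝ) 1) :
    HasDerivAt gauge (gauge t * ((2 - t) / (4 * t * (1 - t)))) t := by
  obtain ⟨h0, h1⟩ := ht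
  have h1' : 0 < 1 - t := by linarith
  have hA : HasDerivAt (fun t : ℝ => t ^ (1 / 2 : ℝ)) _ t :=
    Real.hasDerivAt_rpow_const (Or.inl h0.ne')
  have hB : HasDerivAt (fun t : ℝ => (1 - t) ^ (-(1 / 4) : ℝ)) _ t :=
    ((hasDerivAt_id t).const_sub 1).rpow_const (Or.inl h1'.ne')
  refine (hA.mul hB).congr_deriv ?_
  simp only [gauge, id]
  rw [Real.rpow_sub_one h0.ne', Real.rpow_sub_one h1'.ne']
  field_simp
  ring

lemma le_gauge {t : ℝ} (h0 : 0 ≤ t) (h1 : t < 1) : t ≤ gauge t := by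
  have h1' : 0 < 1 - t := by linarith
  have hA : t ≤ t ^ (1 / 2 : ℝ) := by
    rcases h0.eq_or_lt with rfl | h0
    · simp
    · conv_lhs => rw [← Real.rpow_one t]
      exact Real.rpow_le_rpow_of_exponent_ge h0 h1.le (by norm_num)
  have hB : 1 ≤ (1 - t) ^ (-(1 / 4) : ℝ) :=
    Real.one_le_rpow_of_pos_of_le_one_of_nonpos h1' (by linarith) (by norm_num)
  calc t ≤ t ^ (1 / 2 : ℝ) := hA
    _ ≤ _ := le_mul_of_one_le_right (Real.rpow_nonneg h0 _) hB

/-- An integrand dominated by the gauge rate is integrable away from `1`. -/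
lemma integrable_of_rate {g : ℝ → ℂ} {C t : ℝ} (hC : 0 ≤ C) (hg : ContinuousOn g (Ioo 0 1))
    (hb : ∀ s ∈ Ioo (0 : ℝ) 1, ‖g s‖ ≤ C * (gauge s / (s * (1 - s)))) (h0 : 0 ≤ t) (h1 : t < 1) :
    IntervalIntegrable g volume 0 t ∧ ‖∫ s in (0 : ℝ)..t, g s‖ ≤ 4 * C * gauge t := by
  have hsub : Icc 0 t ⊆ Ico (0 : ℝ) 1 := fun x hx => ⟨hx.1, hx.2.trans_lt h1⟩
  have hsub' : Ioo 0 t ⊆ Ioo (0 : ℝ) 1 := fun x hx => ⟨hx.1, hx.2.trans h1⟩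
  have hder : ∀ x ∈ Ioo 0 t, HasDerivAt (fun s => 4 * C * gauge s)
      (4 * C * (gauge x * ((2 - x) / (4 * x * (1 - x))))) x :=
    fun x hx => (hasDerivAt_gauge (hsub' hx)).const_mul _
  have hcont : ContinuousOn (fun s => 4 * C * gauge s) (Icc 0 t) :=
    (continuousOn_gauge.mono hsub).const_smul (4 * C)
  have hpos : ∀ x ∈ Ioo 0 t, 0 ≤ 4 * C * (gauge x * ((2 - x) / (4 * x * (1 - x)))) := by
    intro x hx
    have hx1 : x < 1 := hx.2.trans h1
    have := hx.1
    have h2 := gauge_nonneg hx.1.le hx1.le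
    have h3 : 0 < 1 - x := by linarith
    have h4 : 0 < 2 - x := by linarith
    positivity
  have hint := integrableOn_deriv_of_nonneg hcont hder hpos
  have hint' : IntervalIntegrable (fun x => 4 * C * (gauge x * ((2 - x) / (4 * x * (1 - x)))))
      volume 0 t := (intervalIntegrable_iff_integrableOn_Ioc_of_le h0).2 hint
  have hle : ∀ x ∈ Ioo 0 t, ‖g x‖ ≤ 4 * C * (gauge x * ((2 - x) / (4 * x * (1 - x)))) := by
    intro x hx
    refine (hb x (hsub' hx)).trans ?_
    have hx0 := hx.1
    have hx1 : 0 < 1 - x := by linarith [hx.2]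
    have h2 := gauge_nonneg hx.1.le (hx.2.trans h1).le
    have : 4 * C * (gauge x * ((2 - x) / (4 * x * (1 - x))))
        - C * (gauge x / (x * (1 - x))) = C * (gauge x / x) := by
      field_simp; ring
    have : 0 ≤ C * (gauge x / x) := by positivity
    linarith
  have hae : ∀ᵐ x ∂volume, x ∈ Ioc 0 t →
      ‖g x‖ ≤ 4 * C * (gauge x * ((2 - x) / (4 * x * (1 - x)))) := by
    have : ∀ᵐ x ∂(volume : Measure ℝ), x ≠ t := by
      simp [ae_iff]
    filter_upwards [this] with x hx hx'
    exact hle x ⟨hx'.1, lt_of_le_of_ne hx'.2 hx⟩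
  have hmeas : AEStronglyMeasurable g (volume.restrict (Ioc 0 t)) := by
    rw [← restrict_Ioo_eq_restrict_Ioc]
    exact (hg.mono hsub').aestronglyMeasurable measurableSet_Ioo
  constructor
  · rw [intervalIntegrable_iff_integrableOn_Ioc_of_le h0]
    exact Integrable.mono' hint hmeas ((ae_restrict_iff' measurableSet_Ioc).2 hae)
  · refine (norm_integral_le_of_norm_le h0 hae hint').trans_eq ?_
    rw [integral_eq_sub_of_hasDerivAt_of_le h0 hcont hder hint']
    simp [gauge_zero]

lemma integrableOn_gauge_div : IntegrableOn (fun s => gauge s / s) (Ioo 0 1) := by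
  have hcont : ContinuousOn (fun s : ℝ => 2 * √s - 2 * √(1 - s)) (Icc 0 1) := by fun_prop
  have hder : ∀ x ∈ Ioo (0 : ℝ) 1, HasDerivAt (fun s : ℝ => 2 * √s - 2 * √(1 - s))
      (1 / √x + 1 / √(1 - x)) x := by
    intro x hx
    have h1 : 0 < 1 - x := by linarith [hx.2]
    have := ((hasDerivAt_id x).sqrt hx.1.ne').const_mul 2
    have h2 := (((hasDerivAt_id x).const_sub 1).sqrt h1.ne').const_mul 2
    refine (this.sub h2).congr_deriv ?_
    simp only [id]
    field_simp
    ring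
  have hint := integrableOn_deriv_of_nonneg hcont hder (fun x hx => by positivity)
  have hint' := hint.mono_set Ioo_subset_Ioc_self
  refine Integrable.mono' hint' ?_ ?_
  · refine ContinuousOn.aestronglyMeasurable ?_ measurableSet_Ioo
    exact (continuousOn_gauge.mono Ioo_subset_Ico_self).div continuousOn_id
      (fun x hx => hx.1.ne')
  · refine (ae_restrict_iff' measurableSet_Ioo).2 (Eventually.of_forall fun x hx => ?_)
    have h0 := hx.1
    have h1 : 0 < 1 - x := by linarith [hx.2]
    rw [Real.norm_of_nonneg (div_nonneg (gauge_nonneg hx.1.le hx.2.le) hx.1.le)]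
    have hA : gauge x / x = 1 / √x * (1 - x) ^ (-(1 / 4) : ℝ) := by
      rw [gauge, Real.sqrt_eq_rpow, mul_comm, mul_div_assoc, mul_comm]
      congr 1
      rw [one_div (x ^ _), ← Real.rpow_neg h0.le]
      have := Real.rpow_sub_one h0.ne' (1 / 2)
      rw [← this]; norm_num
    have hB : (1 - x) ^ (-(1 / 4) : ℝ) ≤ 1 / √(1 - x) := by
      rw [Real.sqrt_eq_rpow, one_div (_ ^ _), ← Real.rpow_neg h1.le]
      exact Real.rpow_le_rpow_of_exponent_ge h1 (by linarith) (by norm_num)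
    have hs : 0 < √x := Real.sqrt_pos.2 h0
    have hs1 : 0 < √(1 - x) := Real.sqrt_pos.2 h1
    have e1 : √x ^ 2 = x := Real.sq_sqrt h0.le
    have e2 : √(1 - x) ^ 2 = 1 - x := Real.sq_sqrt h1.le
    rw [hA]
    calc 1 / √x * (1 - x) ^ (-(1 / 4) : ℝ) ≤ 1 / √x * (1 / √(1 - x)) := by gcongr
      _ ≤ 1 / √x + 1 / √(1 - x) := by
        have : 1 / √x + 1 / √(1 - x) - 1 / √x * (1 / √(1 - x))
            = (√x + √(1 - x) - 1) / (√x * √(1 - x)) := by field_simp; ring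
        have h3 : 0 ≤ (√x + √(1 - x) - 1) / (√x * √(1 - x)) := by
          apply div_nonneg _ (by positivity)
          nlinarith [mul_pos hs hs1]
        linarith

/-- An integrand dominated by the gauge rate, nonsingular at `1`, is integrable up to `1`. -/
lemma integrableOn_of_rate_one {g : ℝ → ℂ} {C : ℝ} (hg : ContinuousOn g (Ioo 0 1))
    (hb : ∀ s ∈ Ioo (0 : ℝ) 1, ‖g s‖ ≤ C * (gauge s / s)) : IntegrableOn g (Icc 0 1) := by
  rw [integrableOn_Icc_iff_integrableOn_Ioo]
  exact Integrable.mono' (integrableOn_gauge_div.const_mul C)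
    (hg.aestronglyMeasurable measurableSet_Ioo)
    ((ae_restrict_iff' measurableSet_Ioo).2 (Eventually.of_forall hb))

/-- Iterated integrals based at `0`; the head of the list is the outermost form. -/
noncomputable def It : List (ℝ → ℂ) → ℝ → ℂ
  | [], _ => 1
  | f :: l, t => ∫ s in (0 : ℝ)..t, f s * It l s

/-- Admissibility at the lower endpoint, with a uniform constant. -/
def Adm (K : ℝ) : List (ℝ → ℂ) → Prop
  | [] => True
  | f :: l => ContinuousOn f (Ioo 0 1) ∧ (∀ s ∈ Ioo (0 : ℝ) 1, ‖f s‖ ≤ K / (s * (1 - s))) ∧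
      (l = [] → ∀ s ∈ Ioo (0 : ℝ) 1, ‖f s‖ ≤ K / (1 - s)) ∧ Adm K l

lemma It_zero_cons (f : ℝ → ℂ) (l : List (ℝ → ℂ)) : It (f :: l) 0 = 0 := by simp [It]

lemma rate_ge {s : ℝ} (hs : s ∈ Ioo (0 : ℝ) 1) : 1 / (1 - s) ≤ gauge s / (s * (1 - s)) := by
  have h0 := hs.1
  have h1 : 0 < 1 - s := by linarith [hs.2]
  rw [div_le_div_iff₀ h1 (by positivity)]
  nlinarith [le_gauge hs.1.le hs.2]

lemma rate_bound {K C : ℝ} (hK : 0 ≤ K) {f g : ℝ → ℂ} {s : ℝ} (hs : s ∈ Ioo (0 : ℝ) 1)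
    (hf : ‖f s‖ ≤ K / (s * (1 - s))) (hg : ‖g s‖ ≤ C * gauge s) :
    ‖f s * g s‖ ≤ K * C * (gauge s / (s * (1 - s))) := by
  have h0 := hs.1
  have h1 : 0 < 1 - s := by linarith [hs.2]
  rw [norm_mul]
  calc ‖f s‖ * ‖g s‖ ≤ K / (s * (1 - s)) * (C * gauge s) := by gcongr
    _ = _ := by ring

lemma integrand_rate {K : ℝ} (hK : 0 ≤ K) {f : ℝ → ℂ} {l : List (ℝ → ℂ)} (h : Adm K (f :: l))
    (hl : l ≠ [] → ∀ s ∈ Ico (0 : ℝ) 1, ‖It l s‖ ≤ (4 * K) ^ l.length * gauge s) :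
    ∀ s ∈ Ioo (0 : ℝ) 1, ‖f s * It l s‖ ≤ K * (4 * K) ^ l.length * (gauge s / (s * (1 - s))) := by
  intro s hs
  by_cases hn : l = []
  · subst hn
    have h1 : 0 < 1 - s := by linarith [hs.2]
    simp only [It, mul_one, List.length_nil, pow_zero]
    calc ‖f s‖ ≤ K / (1 - s) := h.2.2.1 rfl s hs
      _ = K * (1 / (1 - s)) := by ring
      _ ≤ K * (gauge s / (s * (1 - s))) := mul_le_mul_of_nonneg_left (rate_ge hs) hK
      _ = _ := by ring
  · exact rate_bound hK hs (h.2.1 s hs) (hl hn s ⟨hs.1.le, hs.2⟩)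

lemma It_basic {K : ℝ} (hK : 0 ≤ K) : ∀ l : List (ℝ → ℂ), Adm K l →
    ContinuousOn (It l) (Ico 0 1) ∧
      (l ≠ [] → ∀ s ∈ Ico (0 : ℝ) 1, ‖It l s‖ ≤ (4 * K) ^ l.length * gauge s)
  | [], _ => ⟨continuousOn_const, fun h => absurd rfl h⟩
  | f :: l, h => by
    obtain ⟨hc, hb⟩ := It_basic hK l h.2.2.2
    have hr := integrand_rate hK h hb
    have hcont : ContinuousOn (fun s => f s * It l s) (Ioo 0 1) :=
      h.1.mul (hc.mono Ioo_subset_Ico_self)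
    have hC : 0 ≤ K * (4 * K) ^ l.length := by positivity
    refine ⟨?_, fun _ s hs => ?_⟩
    · intro t ht
      obtain ⟨u, hu, hu1⟩ := exists_between ht.2
      have hi := (integrable_of_rate hC hcont hr (ht.1.trans hu.le) hu1).1
      have h2 := continuousOn_primitive_interval' hi (left_mem_uIcc)
      rw [uIcc_of_le (ht.1.trans hu.le)] at h2
      have h3 := h2 t ⟨ht.1, hu.le⟩
      refine (h3.mono_of_mem_nhdsWithin ?_)
      filter_upwards [self_mem_nhdsWithin, mem_nhdsWithin_of_mem_nhds (Iio_mem_nhds hu)]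
        with x hx hx'
      exact ⟨hx.1, le_of_lt hx'⟩
    · refine ((integrable_of_rate hC hcont hr hs.1 hs.2).2).trans_eq ?_
      simp only [List.length_cons]
      ring

section
variable {K : ℝ} {f : ℝ → ℂ} {l : List (ℝ → ℂ)}

lemma It_bound (hK : 0 ≤ K) (h : Adm K l) (hn : l ≠ []) {s : ℝ} (hs : s ∈ Ico (0 : ℝ) 1) :
    ‖It l s‖ ≤ (4 * K) ^ l.length * gauge s := (It_basic hK l h).2 hn s hs

lemma It_continuousOn (hK : 0 ≤ K) (h : Adm K l) : ContinuousOn (It l) (Ico 0 1) :=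
  (It_basic hK l h).1

lemma integrand_continuousOn (hK : 0 ≤ K) (h : Adm K (f :: l)) :
    ContinuousOn (fun s => f s * It l s) (Ioo 0 1) :=
  h.1.mul ((It_continuousOn hK h.2.2.2).mono Ioo_subset_Ico_self)

lemma integrand_bound (hK : 0 ≤ K) (h : Adm K (f :: l)) {s : ℝ} (hs : s ∈ Ioo (0 : ℝ) 1) :
    ‖f s * It l s‖ ≤ K * (4 * K) ^ l.length * (gauge s / (s * (1 - s))) :=
  integrand_rate hK h (It_basic hK l h.2.2.2).2 s hs

lemma It_integrable (hK : 0 ≤ K) (h : Adm K (f :: l)) {t : ℝ} (ht : t ∈ Ico (0 : ℝ) 1) :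
    IntervalIntegrable (fun s => f s * It l s) volume 0 t :=
  (integrable_of_rate (by positivity : 0 ≤ K * (4 * K) ^ l.length)
    (integrand_continuousOn hK h) (fun _ hs => integrand_bound hK h hs) ht.1 ht.2).1

lemma It_hasDerivAt (hK : 0 ≤ K) (h : Adm K (f :: l)) {t : ℝ} (ht : t ∈ Ioo (0 : ℝ) 1) :
    HasDerivAt (It (f :: l)) (f t * It l t) t := by
  have hc := integrand_continuousOn hK h
  refine integral_hasDerivAt_right (It_integrable hK h ⟨ht.1.le, ht.2⟩) ?_
    (hc.continuousAt (Ioo_mem_nhds ht.1 ht.2))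
  exact ContinuousOn.stronglyMeasurableAtFilter isOpen_Ioo hc t ht

/-- Nonsingularity of the head form at `1`. -/
lemma integrand_bound_one (hK : 0 ≤ K) (h : Adm K (f :: l))
    (h1 : ∀ s ∈ Ioo (0 : ℝ) 1, ‖f s‖ ≤ K / s) {s : ℝ} (hs : s ∈ Ioo (0 : ℝ) 1) :
    ‖f s * It l s‖ ≤ 2 * K * (4 * K) ^ l.length * (gauge s / s) := by
  have h0 := hs.1
  have h1' : 0 < 1 - s := by linarith [hs.2]
  have hg := le_gauge hs.1.le hs.2
  by_cases hn : l = []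
  · subst hn
    simp only [It, mul_one, List.length_nil, pow_zero]
    have hA := h1 s hs
    have hB := h.2.2.1 rfl s hs
    have hC : ‖f s‖ ≤ 2 * K := by
      by_cases hh : s ≤ 1 / 2
      · refine hB.trans ?_
        rw [div_le_iff₀ h1']; nlinarith
      · refine hA.trans ?_
        rw [div_le_iff₀ h0]; nlinarith
    have : 1 ≤ gauge s / s := by rwa [le_div_iff₀ h0, one_mul]
    nlinarith
  · rw [norm_mul]
    have := It_bound hK h.2.2.2 hn ⟨h0.le, hs.2⟩
    calc ‖f s‖ * ‖It l s‖ ≤ K / s * ((4 * K) ^ l.length * gauge s) := by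
          gcongr; exact h1 s hs
      _ = 1 * (K * (4 * K) ^ l.length * (gauge s / s)) := by ring
      _ ≤ 2 * (K * (4 * K) ^ l.length * (gauge s / s)) := by
          have h3 : 0 ≤ gauge s / s := div_nonneg (h0.le.trans hg) h0.le
          have h4 : 0 ≤ K * (4 * K) ^ l.length * (gauge s / s) := by positivity
          linarith
      _ = _ := by ring

lemma It_integrableOn_one (hK : 0 ≤ K) (h : Adm K (f :: l))
    (h1 : ∀ s ∈ Ioo (0 : ℝ) 1, ‖f s‖ ≤ K / s) :
    IntegrableOn (fun s => f s * It l s) (Icc 0 1) :=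
  integrableOn_of_rate_one (integrand_continuousOn hK h)
    (fun _ hs => integrand_bound_one hK h h1 hs)

lemma It_integrable_one (hK : 0 ≤ K) (h : Adm K (f :: l))
    (h1 : ∀ s ∈ Ioo (0 : ℝ) 1, ‖f s‖ ≤ K / s) {t : ℝ} (ht : t ∈ Icc (0 : ℝ) 1) :
    IntervalIntegrable (fun s => f s * It l s) volume 0 t := by
  rw [intervalIntegrable_iff_integrableOn_Icc_of_le ht.1]
  exact (It_integrableOn_one hK h h1).mono_set (Icc_subset_Icc_right ht.2)

lemma It_continuousOn_one (hK : 0 ≤ K) (h : Adm K (f :: l))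
    (h1 : ∀ s ∈ Ioo (0 : ℝ) 1, ‖f s‖ ≤ K / s) : ContinuousOn (It (f :: l)) (Icc 0 1) := by
  have := It_integrableOn_one hK h h1
  rw [← uIcc_of_le zero_le_one] at this
  have := continuousOn_primitive_interval this
  rwa [uIcc_of_le zero_le_one] at this

end

lemma integral_congr_Ioo {f g : ℝ → ℂ} (h : EqOn f g (Ioo 0 1)) {t : ℝ} (ht : t ∈ Icc (0 : ℝ) 1) :
    ∫ s in (0 : ℝ)..t, f s = ∫ s in (0 : ℝ)..t, g s := by
  rw [integral_of_le ht.1, integral_of_le ht.1, integral_Ioc_eq_integral_Ioo,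
    integral_Ioc_eq_integral_Ioo]
  exact setIntegral_congr_fun measurableSet_Ioo
    (fun s hs => h ⟨hs.1, hs.2.trans_le ht.2⟩)

lemma It_congr {l l' : List (ℝ → ℂ)} (h : List.Forall₂ (fun f g => EqOn f g (Ioo 0 1)) l l') :
    ∀ t ∈ Icc (0 : ℝ) 1, It l t = It l' t := by
  induction h with
  | nil => intro t _; rfl
  | cons hf _ ih =>
    intro t ht
    exact integral_congr_Ioo (fun s hs => by
      rw [hf hs, ih s ⟨hs.1.le, hs.2.le⟩]) ht

lemma It_map_congr {α : Type} {φ ψ : α → ℝ → ℂ} (l : List α)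
    (h : ∀ a ∈ l, EqOn (φ a) (ψ a) (Ioo 0 1)) {t : ℝ} (ht : t ∈ Icc (0 : ℝ) 1) :
    It (l.map φ) t = It (l.map ψ) t := by
  refine It_congr ?_ t ht
  rw [List.forall₂_map_left_iff, List.forall₂_map_right_iff]
  exact List.forall₂_same.2 h

/-- Labels of the singular points `0, 1, -1, i, -i`. -/
inductive Pt
  | z | o | n | i | m
  deriving DecidableEq

instance : Fintype Pt := ⟨{Pt.z, Pt.o, Pt.n, Pt.i, Pt.m}, by intro x; cases x <;> decide⟩

lemma Pt.sum_univ {M : Type} [AddCommMonoid M] (f : Pt → M) :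
    ∑ a, f a = f .z + f .o + f .n + f .i + f .m := by
  have : (Finset.univ : Finset Pt) = {Pt.z, Pt.o, Pt.n, Pt.i, Pt.m} := rfl
  rw [this, Finset.sum_insert (by decide), Finset.sum_insert (by decide),
    Finset.sum_insert (by decide), Finset.sum_insert (by decide), Finset.sum_singleton]
  simp only [add_assoc]

/-- The singular point with a given label. -/
noncomputable def Pt.val : Pt → ℂ
  | .z => 0
  | .o => 1
  | .n => -1
  | .i => Complex.I
  | .m => -Complex.I

/-- The form `1/(t-a)`. -/
noncomputable def raw (a : Pt) (t : ℝ) : ℂ := 1 / ((t : ℂ) - a.val)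

lemma one_le_norm_sub_I (x : ℝ) : 1 ≤ ‖(x : ℂ) - Complex.I‖ := by
  have := Complex.abs_im_le_norm ((x : ℂ) - Complex.I)
  simpa using this

lemma one_le_norm_add_I (x : ℝ) : 1 ≤ ‖(x : ℂ) + Complex.I‖ := by
  have := Complex.abs_im_le_norm ((x : ℂ) + Complex.I)
  simpa using this

lemma val_ne {a : Pt} {t : ℝ} (ht : t ∈ Ioo (0 : ℝ) 1) : (t : ℂ) - a.val ≠ 0 := by
  have h0 := ht.1
  have h1 := ht.2
  intro h
  cases a
  · simp only [Pt.val, sub_zero, Complex.ofReal_eq_zero] at h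
    linarith
  · have := congrArg Complex.re h
    simp [Pt.val] at this
    linarith
  · have := congrArg Complex.re h
    simp [Pt.val] at this
    linarith
  · have := one_le_norm_sub_I t
    simp only [Pt.val] at h
    rw [h] at this
    simp at this
    linarith
  · have := one_le_norm_add_I t
    simp only [Pt.val, sub_neg_eq_add] at h
    rw [h] at this
    simp at this
    linarith

lemma raw_continuousOn (a : Pt) : ContinuousOn (raw a) (Ioo 0 1) := by
  unfold raw
  exact ContinuousOn.div continuousOn_const (by fun_prop) (fun t ht => val_ne ht)

lemma norm_raw_le {a : Pt} {t : ℝ} (ht : t ∈ Ioo (0 : ℝ) 1) :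
    (a ≠ .z → ‖raw a t‖ ≤ 1 / (1 - t)) ∧ (a ≠ .o → ‖raw a t‖ ≤ 1 / t) := by
  have h0 := ht.1
  have h1 : 0 < 1 - t := by linarith [ht.2]
  have key : ∀ x : ℝ, 0 < x → x ≤ ‖(t : ℂ) - a.val‖ → ‖raw a t‖ ≤ 1 / x := by
    intro x hx hle
    rw [raw, norm_div, norm_one]
    exact one_div_le_one_div_of_le hx hle
  cases a
  · refine ⟨fun h => absurd rfl h, fun _ => key t h0 ?_⟩
    simp [Pt.val, abs_of_pos h0]
  · refine ⟨fun _ => key _ h1 ?_, fun h => absurd rfl h⟩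
    have := Complex.abs_re_le_norm ((t : ℂ) - 1)
    simp only [Complex.sub_re, Complex.ofReal_re, Complex.one_re] at this
    rw [abs_sub_comm, abs_of_pos h1] at this
    exact this
  · have := Complex.abs_re_le_norm ((t : ℂ) - (-1))
    simp only [Complex.sub_re, Complex.ofReal_re, Complex.one_re, Complex.neg_re] at this
    rw [abs_of_pos (by linarith)] at this
    exact ⟨fun _ => key _ h1 (le_trans (by linarith) this),
      fun _ => key _ h0 (le_trans (by linarith) this)⟩
  · have := one_le_norm_sub_I t
    exact ⟨fun _ => key _ h1 (le_trans (by linarith) this),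
      fun _ => key _ h0 (le_trans (by linarith [ht.2]) this)⟩
  · have := one_le_norm_add_I t
    rw [← sub_neg_eq_add] at this
    exact ⟨fun _ => key _ h1 (le_trans (by linarith) this),
      fun _ => key _ h0 (le_trans (by linarith [ht.2]) this)⟩

lemma norm_raw_le' {a : Pt} {t : ℝ} (ht : t ∈ Ioo (0 : ℝ) 1) :
    ‖raw a t‖ ≤ 1 / (t * (1 - t)) := by
  have h0 := ht.1
  have h1 : 0 < 1 - t := by linarith [ht.2]
  by_cases ha : a = .z
  · subst ha
    refine ((norm_raw_le ht).2 (by decide)).trans ?_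
    exact one_div_le_one_div_of_le (by positivity) (by nlinarith)
  · refine ((norm_raw_le ht).1 ha).trans ?_
    exact one_div_le_one_div_of_le (by positivity) (by nlinarith [ht.2])

lemma adm_raw : ∀ {l : List Pt}, l.getLast? ≠ some .z → Adm 1 (l.map raw)
  | [], _ => trivial
  | [a], h => ⟨raw_continuousOn a, fun _ hs => norm_raw_le' hs,
      fun _ _ hs => (norm_raw_le hs).1 (by simpa using h), trivial⟩
  | a :: b :: l, h => ⟨raw_continuousOn a, fun _ hs => norm_raw_le' hs, fun h => by simp at h,
      adm_raw (l := b :: l) (by simpa [List.getLast?_cons_cons] using h)⟩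

/-- Integration against a form maps a group of functions to a group of functions as soon as it
does so on generators. -/
lemma closure_integral {T T' : Set (ℝ → ℂ)} {b : ℝ → ℂ} {I : Set ℝ}
    (h : ∀ g ∈ T, (∀ t ∈ I, IntervalIntegrable (fun s => b s * g s) volume 0 t) ∧
      ∃ g' ∈ AddSubgroup.closure T', ∀ t ∈ I, ∫ s in (0 : ℝ)..t, b s * g s = g' t)
    {g : ℝ → ℂ} (hg : g ∈ AddSubgroup.closure T) :
    (∀ t ∈ I, IntervalIntegrable (fun s => b s * g s) volume 0 t) ∧
      ∃ g' ∈ AddSubgroup.closure T', ∀ t ∈ I, ∫ s in (0 : ℝ)..t, b s * g s = g' t := by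
  induction hg using AddSubgroup.closure_induction with
  | mem x hx => exact h x hx
  | zero =>
    refine ⟨fun t _ => by simp, 0, zero_mem _, fun t _ => by simp⟩
  | add x y _ _ hx hy =>
    obtain ⟨hx1, gx, hgx, hx2⟩ := hx
    obtain ⟨hy1, gy, hgy, hy2⟩ := hy
    have e : (fun s => b s * (x + y) s) = fun s => b s * x s + b s * y s := by
      funext s; simp [mul_add]
    refine ⟨fun t ht => by rw [e]; exact (hx1 t ht).add (hy1 t ht), gx + gy, add_mem hgx hgy,
      fun t ht => ?_⟩
    rw [e, intervalIntegral.integral_add (hx1 t ht) (hy1 t ht), hx2 t ht, hy2 t ht]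
    rfl
  | neg x _ hx =>
    obtain ⟨hx1, gx, hgx, hx2⟩ := hx
    have e : (fun s => b s * (-x) s) = fun s => -(b s * x s) := by
      funext s; simp
    refine ⟨fun t ht => by rw [e]; exact (hx1 t ht).neg, -gx, neg_mem hgx, fun t ht => ?_⟩
    rw [e, intervalIntegral.integral_neg, hx2 t ht]
    rfl

/-- Iterated integrals of raw words as functions of the upper endpoint. -/
def funGen (S : Set Pt) (n : ℕ) : Set (ℝ → ℂ) :=
  {g | ∃ l : List Pt, l.length = n ∧ (∀ a ∈ l, a ∈ S) ∧ l.getLast? ≠ some .z ∧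
    g = It (l.map raw)}

/-- The values at `1` of admissible raw words of length `n` with letters in `S`. -/
def valGen (S : Set Pt) (n : ℕ) : Set ℂ :=
  {x | ∃ l : List Pt, l.length = n ∧ (∀ a ∈ l, a ∈ S) ∧ l.getLast? ≠ some .z ∧
    l.head? ≠ some .o ∧ x = It (l.map raw) 1}

/-- The group generated by `valGen`. -/
def Nval (S : Set Pt) (n : ℕ) : AddSubgroup ℂ := AddSubgroup.closure (valGen S n)

lemma Nval_mono {S S' : Set Pt} (h : S ⊆ S') (n : ℕ) : Nval S n ≤ Nval S' n := by
  refine AddSubgroup.closure_mono ?_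
  rintro x ⟨l, h1, h2, h3⟩
  exact ⟨l, h1, fun a ha => h (h2 a ha), h3⟩

lemma mem_Nval {S : Set Pt} {l : List Pt} (h2 : ∀ a ∈ l, a ∈ S) (h3 : l.getLast? ≠ some .z)
    (h4 : l.head? ≠ some .o) : It (l.map raw) 1 ∈ Nval S l.length :=
  AddSubgroup.subset_closure ⟨l, rfl, h2, h3, h4, rfl⟩

/-- An integral combination of the raw forms. -/
noncomputable def slot (c : Pt → ℤ) (t : ℝ) : ℂ := ∑ a, (c a : ℂ) * raw a t

lemma raw_integrable {l : List Pt} {a : Pt} (h : (a :: l).getLast? ≠ some .z) {t : ℝ}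
    (ht : t ∈ Icc (0 : ℝ) 1) (hI : t < 1 ∨ a ≠ .o) :
    IntervalIntegrable (fun s => raw a s * It (l.map raw) s) volume 0 t := by
  have hA : Adm 1 (raw a :: l.map raw) := adm_raw (l := a :: l) h
  rcases hI with h1 | h1
  · exact It_integrable zero_le_one hA ⟨ht.1, h1⟩
  · exact It_integrable_one zero_le_one hA (fun s hs => (norm_raw_le hs).2 h1) ht

lemma getLast_cons_ne {l : List Pt} {a : Pt} (hl : l.getLast? ≠ some .z)
    (ha : l = [] → a ≠ .z) : (a :: l).getLast? ≠ some .z := by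
  cases l with
  | nil => simpa using ha rfl
  | cons b l => simpa [List.getLast?_cons_cons] using hl

lemma integral_slot {S : Set Pt} {n : ℕ} {c : Pt → ℤ} (hS : ∀ a ∉ S, c a = 0)
    (hz : n = 0 → c .z = 0) {I : Set ℝ} (hI : I ⊆ Icc 0 1) {g : ℝ → ℂ}
    (hg : g ∈ AddSubgroup.closure (funGen S n)) (T' : Set (ℝ → ℂ))
    (hT : ∀ l : List Pt, l.length = n + 1 → (∀ a ∈ l, a ∈ S) → l.getLast? ≠ some .z →
      (∀ a, l.head? = some a → c a ≠ 0) → It (l.map raw) ∈ T')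
    (h1 : ∀ t ∈ I, t < 1 ∨ c .o = 0) :
    ∃ g' ∈ AddSubgroup.closure T',
      ∀ t ∈ I, ∫ s in (0 : ℝ)..t, slot c s * g s = g' t := by
  have key : ∀ a : Pt, c a ≠ 0 →
      (∀ t ∈ I, IntervalIntegrable (fun s => raw a s * g s) volume 0 t) ∧
      ∃ g' ∈ AddSubgroup.closure T', ∀ t ∈ I, ∫ s in (0 : ℝ)..t, raw a s * g s = g' t := by
    intro a ha
    refine closure_integral ?_ hg
    rintro _ ⟨l, hl, hlS, hlz, rfl⟩
    have haz : l = [] → a ≠ .z := by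
      rintro rfl rfl
      exact ha (hz hl.symm)
    have hlast := getLast_cons_ne hlz haz
    refine ⟨fun t ht => raw_integrable hlast (hI ht) ?_, It ((a :: l).map raw),
      AddSubgroup.subset_closure (hT _ (by simp [hl]) ?_ hlast ?_), fun t _ => rfl⟩
    · rcases h1 t ht with h | h
      · exact Or.inl h
      · right
        rintro rfl
        exact ha h
    · intro x hx
      rcases List.mem_cons.1 hx with rfl | hx
      · by_contra hS'
        exact ha (hS _ hS')
      · exact hlS x hx
    · intro x hx
      simp only [List.head?_cons, Option.some.injEq] at hx
      subst hx
      exact ha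
  choose! hint G hG hGe using key
  refine ⟨∑ a ∈ Finset.univ.filter (fun a => c a ≠ 0), c a • G a,
    sum_mem fun a ha => zsmul_mem (hG a (Finset.mem_filter.1 ha).2) _, fun t ht => ?_⟩
  have e : ∀ s, slot c s * g s =
      ∑ a ∈ Finset.univ.filter (fun a => c a ≠ 0), (c a : ℂ) * (raw a s * g s) := by
    intro s
    rw [slot, Finset.sum_mul, Finset.sum_filter]
    refine Finset.sum_congr rfl fun a _ => ?_
    split_ifs with h
    · ring
    · simp [not_not.1 h]
  simp only [e]
  rw [intervalIntegral.integral_finsetSum]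
  · rw [Finset.sum_apply]
    refine Finset.sum_congr rfl fun a ha => ?_
    rw [intervalIntegral.integral_const_mul, hGe a (Finset.mem_filter.1 ha).2 t ht]
    simp
  · intro a ha
    exact (hint a (Finset.mem_filter.1 ha).2 t ht).const_mul _

lemma slots_fun {S : Set Pt} : ∀ {L : List (Pt → ℤ)}, (∀ c ∈ L, ∀ a ∉ S, c a = 0) →
    (∀ c, L.getLast? = some c → c .z = 0) →
    ∃ g ∈ AddSubgroup.closure (funGen S L.length), EqOn (It (L.map slot)) g (Ico 0 1)
  | [], _, _ => ⟨It [], AddSubgroup.subset_closure ⟨[], by simp⟩, fun _ _ => rfl⟩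
  | c :: L, hS, hz => by
    have hz' : ∀ c, L.getLast? = some c → c .z = 0 := by
      intro c' hc'
      refine hz c' ?_
      cases L with
      | nil => simp at hc'
      | cons b L => rwa [List.getLast?_cons_cons]
    obtain ⟨g, hg, hgE⟩ := slots_fun (fun c hc => hS c (List.mem_cons_of_mem _ hc)) hz'
    obtain ⟨g', hg', hE⟩ := integral_slot (c := c) (I := Ico 0 1) (hS c List.mem_cons_self)
      (fun h => hz c (by rw [List.length_eq_zero_iff.1 h]; rfl)) Ico_subset_Icc_self hg
      (funGen S (L.length + 1)) (fun l h1 h2 h3 _ => ⟨l, h1, h2, h3, rfl⟩)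
      (fun t ht => Or.inl ht.2)
    refine ⟨g', hg', fun t ht => ?_⟩
    rw [← hE t ht]
    exact integral_congr_Ioo (fun s hs => by rw [hgE (Ioo_subset_Ico_self hs)])
      (Ico_subset_Icc_self ht)

/-- Multilinear expansion: a word in integral combinations of raw forms evaluates into the group
generated by raw words. -/
lemma slots_mem {S : Set Pt} {L : List (Pt → ℤ)} (hS : ∀ c ∈ L, ∀ a ∉ S, c a = 0)
    (hz : ∀ c, L.getLast? = some c → c .z = 0) (ho : ∀ c, L.head? = some c → c .o = 0) :
    It (L.map slot) 1 ∈ Nval S L.length := by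
  cases L with
  | nil => exact AddSubgroup.subset_closure ⟨[], by simp [It]⟩
  | cons c L =>
    have hz' : ∀ c, L.getLast? = some c → c .z = 0 := by
      intro c' hc'
      refine hz c' ?_
      cases L with
      | nil => simp at hc'
      | cons b L => rwa [List.getLast?_cons_cons]
    obtain ⟨g, hg, hgE⟩ := slots_fun (fun c hc => hS c (List.mem_cons_of_mem _ hc)) hz'
    have hco := ho c rfl
    obtain ⟨g', hg', hE⟩ := integral_slot (c := c) (I := {1}) (hS c List.mem_cons_self)
      (fun h => hz c (by rw [List.length_eq_zero_iff.1 h]; rfl))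
      (by rintro _ rfl; simp) hg
      {g | ∃ l : List Pt, l.length = L.length + 1 ∧ (∀ a ∈ l, a ∈ S) ∧ l.getLast? ≠ some .z ∧
        l.head? ≠ some .o ∧ g = It (l.map raw)}
      (fun l h1 h2 h3 h4 => ⟨l, h1, h2, h3, fun h => h4 _ h hco, rfl⟩)
      (fun t _ => Or.inr hco)
    have e : It ((c :: L).map slot) 1 = g' 1 := by
      rw [← hE 1 rfl]
      exact integral_congr_Ioo (fun s hs => by rw [hgE (Ioo_subset_Ico_self hs)]) (by simp)
    rw [e]
    have hmap : AddSubgroup.closure {g | ∃ l : List Pt, l.length = L.length + 1 ∧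
        (∀ a ∈ l, a ∈ S) ∧ l.getLast? ≠ some .z ∧ l.head? ≠ some .o ∧ g = It (l.map raw)} ≤
        (Nval S (L.length + 1)).comap
        (Pi.evalAddMonoidHom (fun _ : ℝ => ℂ) 1) := (AddSubgroup.closure_le _).2 (by
      rintro _ ⟨l, h1, h2, h3, h4, rfl⟩
      exact AddSubgroup.subset_closure ⟨l, h1, h2, h3, h4, rfl⟩)
    exact hmap hg'

lemma It_smul (k : ℂ) (f : ℝ → ℂ) (v : List (ℝ → ℂ)) : ∀ (u : List (ℝ → ℂ)) (t : ℝ),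
    It (u ++ (fun s => k * f s) :: v) t = k * It (u ++ f :: v) t
  | [], t => by
    simp only [It, List.nil_append, mul_assoc, intervalIntegral.integral_const_mul]
  | g :: u, t => by
    simp only [It, List.cons_append, It_smul k f v u, mul_left_comm,
      intervalIntegral.integral_const_mul]

/-- The forms `1/(t-i)` and `1/(t+i)`, nonsingular on the real line. -/
def Sreg : Set Pt := {.i, .m}

lemma Sreg_last {l : List Pt} (h : ∀ a ∈ l, a ∈ Sreg) : l.getLast? ≠ some .z := by
  intro hz
  have := h _ (List.mem_of_getLast? hz)
  simp [Sreg] at this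

lemma Sreg_head {l : List Pt} (h : ∀ a ∈ l, a ∈ Sreg) : l.head? ≠ some .o := by
  intro hz
  have := h _ (List.mem_of_head? hz)
  simp [Sreg] at this

lemma reg_cons {a : Pt} {l : List Pt} (h : ∀ x ∈ a :: l, x ∈ Sreg) :
    Adm 1 (raw a :: l.map raw) ∧ ∀ s ∈ Ioo (0 : ℝ) 1, ‖raw a s‖ ≤ 1 / s := by
  refine ⟨adm_raw (l := a :: l) (Sreg_last h), fun s hs => (norm_raw_le hs).2 ?_⟩
  have := Sreg_head h
  simpa using this

lemma integral_reg {a : Pt} (ha : a ∈ Sreg) {n : ℕ} {g : ℝ → ℂ}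
    (hg : g ∈ AddSubgroup.closure (funGen Sreg n)) :
    (∀ t ∈ Icc (0 : ℝ) 1, IntervalIntegrable (fun s => raw a s * g s) volume 0 t) ∧
      ∃ g' ∈ AddSubgroup.closure (funGen Sreg (n + 1)),
        ∀ t ∈ Icc (0 : ℝ) 1, ∫ s in (0 : ℝ)..t, raw a s * g s = g' t := by
  refine closure_integral ?_ hg
  rintro _ ⟨l, hl, hlS, hlz, rfl⟩
  have h : ∀ x ∈ a :: l, x ∈ Sreg := by
    intro x hx
    rcases List.mem_cons.1 hx with rfl | hx
    exacts [ha, hlS x hx]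
  obtain ⟨h1, h2⟩ := reg_cons h
  exact ⟨fun t ht => It_integrable_one zero_le_one h1 h2 ht, It ((a :: l).map raw),
    AddSubgroup.subset_closure ⟨a :: l, by simp [hl], h, Sreg_last h, rfl⟩, fun t _ => rfl⟩

/-- Shuffle product. -/
lemma shuffle_reg : ∀ (k : ℕ) (u v : List Pt), u.length + v.length = k → (∀ a ∈ u, a ∈ Sreg) →
    (∀ a ∈ v, a ∈ Sreg) → ∃ g ∈ AddSubgroup.closure (funGen Sreg k),
      ∀ t ∈ Icc (0 : ℝ) 1, It (u.map raw) t * It (v.map raw) t = g t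
  | k, [], v, hk, _, hv => ⟨It (v.map raw),
      AddSubgroup.subset_closure ⟨v, by simpa using hk, hv, Sreg_last hv, rfl⟩,
      fun t _ => by simp [It]⟩
  | k, a :: u, [], hk, hu, _ => ⟨It ((a :: u).map raw),
      AddSubgroup.subset_closure ⟨a :: u, by simpa using hk, hu, Sreg_last hu, rfl⟩,
      fun t _ => by simp [It]⟩
  | 0, a :: u, b :: v, hk, hu, hv => by simp at hk
  | k + 1, a :: u, b :: v, hk, hu, hv => by
    have hu' : ∀ x ∈ u, x ∈ Sreg := fun x hx => hu x (List.mem_cons_of_mem _ hx)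
    have hv' : ∀ x ∈ v, x ∈ Sreg := fun x hx => hv x (List.mem_cons_of_mem _ hx)
    obtain ⟨g1, hg1, e1⟩ := shuffle_reg k u (b :: v) (by simp at hk ⊢; omega) hu' hv
    obtain ⟨g2, hg2, e2⟩ := shuffle_reg k (a :: u) v (by simp at hk ⊢; omega) hu hv'
    obtain ⟨i1, G1, hG1, E1⟩ := integral_reg (hu a List.mem_cons_self) hg1
    obtain ⟨i2, G2, hG2, E2⟩ := integral_reg (hv b List.mem_cons_self) hg2
    refine ⟨G1 + G2, add_mem hG1 hG2, fun t ht => ?_⟩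
    obtain ⟨au, au'⟩ := reg_cons hu
    obtain ⟨av, av'⟩ := reg_cons hv
    have hsub : Icc 0 t ⊆ Icc (0 : ℝ) 1 := Icc_subset_Icc_right ht.2
    have hc := ((It_continuousOn_one zero_le_one au au').mul
      (It_continuousOn_one zero_le_one av av')).mono hsub
    have := integral_eq_sub_of_hasDerivAt_of_le
      (f' := fun s => raw a s * g1 s + raw b s * g2 s) ht.1 hc ?_ ((i1 t ht).add (i2 t ht))
    · rw [intervalIntegral.integral_add (i1 t ht) (i2 t ht), E1 t ht, E2 t ht] at this
      simp only [Pi.mul_apply, It_zero_cons, mul_zero, sub_zero] at this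
      simpa using this.symm
    · intro x hx
      have hx' : x ∈ Ioo (0 : ℝ) 1 := ⟨hx.1, hx.2.trans_le ht.2⟩
      refine ((It_hasDerivAt zero_le_one au hx').mul
        (It_hasDerivAt zero_le_one av hx')).congr_deriv ?_
      rw [← e1 x (Ioo_subset_Icc_self hx'), ← e2 x (Ioo_subset_Icc_self hx')]
      simp only [List.map_cons]
      ring

/-- The rational span of words in the two regular letters. -/
noncomputable def V (n : ℕ) : Submodule ℚ ℂ := Submodule.span ℚ (valGen Sreg n)

lemma Nval_reg_le (n : ℕ) : Nval Sreg n ≤ (V n).toAddSubgroup :=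
  (AddSubgroup.closure_le _).2 fun _ hx => Submodule.subset_span hx

lemma V_mul {k l : ℕ} {x y : ℂ} (hx : x ∈ V k) (hy : y ∈ V l) : x * y ∈ V (k + l) := by
  have h1 : V k * V l ≤ V (k + l) := by
    rw [V, V, Submodule.span_mul_span, Submodule.span_le]
    rintro _ ⟨_, ⟨u, rfl, hu, _, _, rfl⟩, _, ⟨v, rfl, hv, _, _, rfl⟩, rfl⟩
    obtain ⟨g, hg, e⟩ := shuffle_reg _ u v rfl hu hv
    have hmap : AddSubgroup.closure (funGen Sreg (u.length + v.length)) ≤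
        (V (u.length + v.length)).toAddSubgroup.comap
        (Pi.evalAddMonoidHom (fun _ : ℝ => ℂ) 1) := (AddSubgroup.closure_le _).2 (by
      rintro _ ⟨l, h1, h2, h3, rfl⟩
      exact Submodule.subset_span ⟨l, h1, h2, h3, Sreg_head h2, rfl⟩)
    have := hmap hg
    change g 1 ∈ V _ at this
    rw [← e 1 (by simp)] at this
    exact this
  exact h1 (Submodule.mul_mem_mul hx hy)

lemma adm_of {α : Type} {φ : α → ℝ → ℂ} {K : ℝ} : ∀ {l : List α},
    (∀ a ∈ l, ContinuousOn (φ a) (Ioo 0 1) ∧ ∀ s ∈ Ioo (0 : ℝ) 1, ‖φ a s‖ ≤ K / (s * (1 - s))) →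
    (∀ a, l.getLast? = some a → ∀ s ∈ Ioo (0 : ℝ) 1, ‖φ a s‖ ≤ K / (1 - s)) → Adm K (l.map φ)
  | [], _, _ => trivial
  | [a], h, h' => ⟨(h a (by simp)).1, (h a (by simp)).2, fun _ => h' a (by simp), trivial⟩
  | a :: b :: l, h, h' => ⟨(h a (by simp)).1, (h a (by simp)).2, fun h => by simp at h,
      adm_of (l := b :: l) (fun x hx => h x (List.mem_cons_of_mem _ hx))
        (fun x hx => h' x (by rwa [List.getLast?_cons_cons]))⟩

lemma Adm.suffix {K : ℝ} : ∀ {u v : List (ℝ → ℂ)}, Adm K (u ++ v) → Adm K v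
  | [], _, h => h
  | _ :: _, _, h => Adm.suffix h.2.2.2

/-- The pullback of a form under `t ↦ t ^ 2`. -/
noncomputable def sq (f : ℝ → ℂ) (y : ℝ) : ℂ := 2 * y * f (y ^ 2)

lemma image_sq {y : ℝ} (hy : 0 ≤ y) : (fun x : ℝ => x ^ 2) '' Ioo 0 y = Ioo 0 (y ^ 2) := by
  ext x
  constructor
  · rintro ⟨s, hs, rfl⟩
    exact ⟨pow_pos hs.1 2, by
      have := hs.1
      have := hs.2
      simp only
      nlinarith⟩
  · intro hx
    refine ⟨√x, ⟨Real.sqrt_pos.2 hx.1, ?_⟩, Real.sq_sqrt hx.1.le⟩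
    rw [Real.sqrt_lt' (lt_of_le_of_ne hy ?_)]
    · exact hx.2
    · rintro rfl
      have := hx.1
      have := hx.2
      norm_num at this
      linarith

lemma It_sq : ∀ (l : List (ℝ → ℂ)) {y : ℝ}, 0 ≤ y → It l (y ^ 2) = It (l.map sq) y
  | [], _, _ => rfl
  | f :: l, y, hy => by
    simp only [It, List.map_cons]
    rw [integral_of_le (by positivity), integral_of_le hy, integral_Ioc_eq_integral_Ioo,
      integral_Ioc_eq_integral_Ioo, ← image_sq hy,
      integral_image_eq_integral_abs_deriv_smul measurableSet_Ioo (f' := fun x => 2 * x)]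
    · refine setIntegral_congr_fun measurableSet_Ioo fun x hx => ?_
      have hx0 : (0 : ℝ) ≤ x := hx.1.le
      rw [← It_sq l hx0, abs_of_nonneg (by positivity), sq, Complex.real_smul]
      push_cast
      ring
    · intro x _
      simpa using (hasDerivAt_pow 2 x).hasDerivWithinAt
    · intro x hx x' hx' h
      exact (pow_left_inj₀ hx.1.le hx'.1.le two_ne_zero).1 h

/-- The involution exchanging `0` and `1`. -/
noncomputable def invo (t : ℝ) : ℝ := (1 - t) / (1 + t)

/-- The pullback (up to sign) of a form under `invo`. -/
noncomputable def pull (f : ℝ → ℂ) (s : ℝ) : ℂ := f (invo s) * (2 / (1 + (s : ℂ)) ^ 2)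

lemma invo_mem {t : ℝ} (ht : t ∈ Ioo (0 : ℝ) 1) : invo t ∈ Ioo (0 : ℝ) 1 := by
  have h0 := ht.1
  have h1 := ht.2
  have : 0 < 1 + t := by linarith
  refine ⟨div_pos (by linarith) this, ?_⟩
  rw [invo, div_lt_one this]
  linarith

lemma invo_invo {t : ℝ} (ht : t ∈ Ioo (0 : ℝ) 1) : invo (invo t) = t := by
  have h0 := ht.1
  have : 1 + t ≠ 0 := by linarith
  unfold invo
  have h2 : 1 + (1 - t) / (1 + t) ≠ 0 := by
    rw [one_add_div this]
    have : (1 + t + (1 - t)) = 2 := by ring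
    rw [this]
    positivity
  field_simp
  ring

lemma hasDerivAt_invo {t : ℝ} (ht : t ∈ Ioo (0 : ℝ) 1) :
    HasDerivAt invo (-(2 / (1 + t) ^ 2)) t := by
  have h0 := ht.1
  have : 1 + t ≠ 0 := by linarith
  refine (((hasDerivAt_id t).const_sub 1).div ((hasDerivAt_id t).const_add 1) this).congr_deriv ?_
  simp only [id]
  field_simp
  ring

lemma gauge_invo {t : ℝ} (ht : t ∈ Ioo (0 : ℝ) 1) :
    gauge t * gauge (invo t) ≤ t ^ (1 / 4 : ℝ) * (1 - t) ^ (1 / 4 : ℝ) := by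
  have h0 := ht.1
  have h1 : 0 < 1 - t := by linarith [ht.2]
  have hi := invo_mem ht
  have hA : (invo t) ^ (1 / 2 : ℝ) ≤ (1 - t) ^ (1 / 2 : ℝ) := by
    refine Real.rpow_le_rpow hi.1.le ?_ (by norm_num)
    exact div_le_self h1.le (by linarith)
  have hB : (1 - invo t) ^ (-(1 / 4) : ℝ) ≤ t ^ (-(1 / 4) : ℝ) := by
    refine Real.rpow_le_rpow_of_nonpos h0 ?_ (by norm_num)
    rw [invo, le_sub_comm, div_le_iff₀ (by linarith)]
    nlinarith
  have e1 : t ^ (1 / 2 : ℝ) * t ^ (-(1 / 4) : ℝ) = t ^ (1 / 4 : ℝ) := by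
    rw [← Real.rpow_add h0]; norm_num
  have e2 : (1 - t) ^ (-(1 / 4) : ℝ) * (1 - t) ^ (1 / 2 : ℝ) = (1 - t) ^ (1 / 4 : ℝ) := by
    rw [← Real.rpow_add h1]; norm_num
  calc gauge t * gauge (invo t)
      = t ^ (1 / 2 : ℝ) * (1 - t) ^ (-(1 / 4) : ℝ) *
        ((invo t) ^ (1 / 2 : ℝ) * (1 - invo t) ^ (-(1 / 4) : ℝ)) := rfl
    _ ≤ t ^ (1 / 2 : ℝ) * (1 - t) ^ (-(1 / 4) : ℝ) *
        ((1 - t) ^ (1 / 2 : ℝ) * t ^ (-(1 / 4) : ℝ)) := by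
        gcongr
        exact Real.rpow_nonneg (by linarith [hi.2]) _
    _ = _ := by rw [← e1, ← e2]; ring

/-- Sum of the products of complementary iterated integrals over all splittings of a word. -/
noncomputable def splitSum : List (ℝ → ℂ) → List (ℝ → ℂ) → ℝ → ℂ
  | u, [], t => It (u.map pull) (invo t)
  | u, f :: v, t => It (u.map pull) (invo t) * It (f :: v) t + splitSum (f :: u) v t

/-- The derivative of `It (u.map pull) (invo t)`. -/
noncomputable def splitDer : List (ℝ → ℂ) → ℝ → ℂ
  | [], _ => 0
  | g :: u, t => -(g t * It (u.map pull) (invo t))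

lemma hasDerivAt_It_invo {K : ℝ} (hK : 0 ≤ K) {u : List (ℝ → ℂ)} (hu : Adm K (u.map pull))
    {t : ℝ} (ht : t ∈ Ioo (0 : ℝ) 1) :
    HasDerivAt (fun t => It (u.map pull) (invo t)) (splitDer u t) t := by
  cases u with
  | nil => exact hasDerivAt_const _ _
  | cons g u =>
    have h := (It_hasDerivAt hK hu (invo_mem ht)).scomp t (hasDerivAt_invo ht)
    refine h.congr_deriv ?_
    simp only [splitDer, pull, invo_invo ht, Complex.real_smul]
    have h0 := ht.1
    have h2 : (1 + (t : ℂ)) ≠ 0 := by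
      intro h
      have := congrArg Complex.re h
      simp at this
      linarith
    have h3 : 1 + ((invo t : ℝ) : ℂ) = 2 / (1 + t) := by
      rw [invo]
      push_cast
      field_simp
      ring
    rw [h3]
    push_cast
    field_simp

lemma hasDerivAt_splitSum {K : ℝ} (hK : 0 ≤ K) : ∀ (v u : List (ℝ → ℂ)),
    Adm K ((v.reverse ++ u).map pull) → Adm K v → ∀ {t : ℝ}, t ∈ Ioo (0 : ℝ) 1 →
    HasDerivAt (splitSum u v) (splitDer u t * It v t) t
  | [], u, hu, _, t, ht => by
    refine (hasDerivAt_It_invo hK (by simpa using hu) ht).congr_deriv ?_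
    simp [It]
  | f :: v, u, hu, hv, t, ht => by
    have hu' : Adm K (u.map pull) := by
      rw [List.map_append] at hu
      exact hu.suffix
    have hr : Adm K ((v.reverse ++ f :: u).map pull) := by simpa using hu
    refine (((hasDerivAt_It_invo hK hu' ht).mul (It_hasDerivAt hK hv ht)).add
      (hasDerivAt_splitSum hK v (f :: u) hr hv.2.2.2 ht)).congr_deriv ?_
    simp only [splitDer]
    ring

lemma splitSum_sub_tendsto {K : ℝ} (hK : 0 ≤ K) {F : Filter ℝ} (hF : ∀ᶠ t in F, t ∈ Ioo (0 : ℝ) 1)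
    (hF0 : Tendsto (fun t : ℝ => t ^ (1 / 4 : ℝ) * (1 - t) ^ (1 / 4 : ℝ)) F (𝓝 0)) :
    ∀ (v u : List (ℝ → ℂ)), u ≠ [] → Adm K ((v.reverse ++ u).map pull) → Adm K v →
    Tendsto (fun t => splitSum u v t - It ((v.reverse ++ u).map pull) (invo t)) F (𝓝 0)
  | [], u, _, _, _ => by
    simp only [splitSum, List.reverse_nil, List.nil_append, sub_self]
    exact tendsto_const_nhds
  | f :: v, u, hne, hu, hv => by
    have hu' : Adm K (u.map pull) := by
      rw [List.map_append] at hu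
      exact hu.suffix
    have hr : Adm K ((v.reverse ++ f :: u).map pull) := by simpa using hu
    have h1 := splitSum_sub_tendsto hK hF hF0 v (f :: u) (by simp) hr hv.2.2.2
    have h2 : Tendsto (fun t => It (u.map pull) (invo t) * It (f :: v) t) F (𝓝 0) := by
      refine squeeze_zero_norm' (a := fun t => (4 * K) ^ (u.map pull).length *
        (4 * K) ^ (f :: v).length * (t ^ (1 / 4 : ℝ) * (1 - t) ^ (1 / 4 : ℝ))) ?_ ?_
      · filter_upwards [hF] with t ht
        have hi := invo_mem ht
        rw [norm_mul]
        calc _ ≤ (4 * K) ^ (u.map pull).length * gauge (invo t) *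
              ((4 * K) ^ (f :: v).length * gauge t) := by
              gcongr
              · have := gauge_nonneg hi.1.le hi.2.le
                positivity
              · exact It_bound hK hu' (by simpa using hne) ⟨hi.1.le, hi.2⟩
              · exact It_bound hK hv (by simp) ⟨ht.1.le, ht.2⟩
          _ = (4 * K) ^ (u.map pull).length * (4 * K) ^ (f :: v).length *
              (gauge t * gauge (invo t)) := by ring
          _ ≤ _ := mul_le_mul_of_nonneg_left (gauge_invo ht) (by positivity)
      · simpa using hF0.const_mul _
    have h3 := h2.add h1
    rw [add_zero] at h3
    refine h3.congr fun t => ?_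
    simp only [splitSum, List.reverse_cons, List.append_assoc, List.singleton_append]
    ring

lemma tendsto_invo_zero : Tendsto invo (𝓝[Ioo 0 1] 0) (𝓝[Icc 0 1] 1) := by
  refine tendsto_nhdsWithin_iff.2 ⟨?_, ?_⟩
  · have : ContinuousAt invo 0 := by
      unfold invo
      exact ContinuousAt.div (by fun_prop) (by fun_prop) (by norm_num)
    have h : Tendsto invo (𝓝 0) (𝓝 (invo 0)) := this
    simp only [invo, sub_zero, add_zero, div_one] at h
    exact h.mono_left nhdsWithin_le_nhds
  · filter_upwards [self_mem_nhdsWithin] with t ht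
    exact Ioo_subset_Icc_self (invo_mem ht)

lemma tendsto_invo_one : Tendsto invo (𝓝[Ioo 0 1] 1) (𝓝[Icc 0 1] 0) := by
  refine tendsto_nhdsWithin_iff.2 ⟨?_, ?_⟩
  · have : ContinuousAt invo 1 := by
      unfold invo
      exact ContinuousAt.div (by fun_prop) (by fun_prop) (by norm_num)
    have h : Tendsto invo (𝓝 1) (𝓝 (invo 1)) := this
    simp only [invo, sub_self, zero_div] at h
    exact h.mono_left nhdsWithin_le_nhds
  · filter_upwards [self_mem_nhdsWithin] with t ht
    exact Ioo_subset_Icc_self (invo_mem ht)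

/-- Reversal of iterated integrals under the involution `t ↦ (1 - t) / (1 + t)`. -/
theorem It_reverse {K : ℝ} (hK : 0 ≤ K) {l : List (ℝ → ℂ)} (hl : Adm K l)
    (hl1 : ∀ f, l.head? = some f → ∀ s ∈ Ioo (0 : ℝ) 1, ‖f s‖ ≤ K / s)
    (hr : Adm K (l.map pull).reverse)
    (hr1 : ∀ f, l.getLast? = some f → ∀ s ∈ Ioo (0 : ℝ) 1, ‖pull f s‖ ≤ K / s) :
    It l 1 = It (l.map pull).reverse 1 := by
  rcases l with _ | ⟨f, v⟩
  · rfl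
  set R := (List.map pull (f :: v)).reverse with hR
  have hR' : R = ((v.reverse ++ [f]).map pull) := by simp [hR]
  have hRr : Adm K ((v.reverse ++ [f]).map pull) := hR' ▸ hr
  have hcl : ContinuousOn (It (f :: v)) (Icc 0 1) := It_continuousOn_one hK hl (hl1 f rfl)
  obtain ⟨g, R', hgR, hg1⟩ : ∃ g R', R = g :: R' ∧ ∀ s ∈ Ioo (0 : ℝ) 1, ‖g s‖ ≤ K / s := by
    obtain ⟨a, ha⟩ : ∃ a, (f :: v).getLast? = some a :=
      ⟨_, List.getLast?_eq_some_getLast (List.cons_ne_nil _ _)⟩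
    have : R.head? = some (pull a) := by
      rw [hR, List.head?_reverse, List.getLast?_map, ha]
      rfl
    cases hRe : R with
    | nil => simp [hRe] at this
    | cons g R' =>
      simp only [hRe, List.head?_cons, Option.some.injEq] at this
      exact ⟨g, R', rfl, this ▸ hr1 a ha⟩
  have hcr : ContinuousOn (It R) (Icc 0 1) := by
    rw [hgR] at hr ⊢
    exact It_continuousOn_one hK hr hg1
  have hR0 : It R 0 = 0 := by rw [hgR, It_zero_cons]
  have hE : ∀ t, splitSum [] (f :: v) t = It (f :: v) t + splitSum [f] v t := by
    intro t
    simp [splitSum, It]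
  have hrpow : Continuous (fun t : ℝ => t ^ (1 / 4 : ℝ) * (1 - t) ^ (1 / 4 : ℝ)) := by
    refine (Real.continuous_rpow_const (by norm_num)).mul ?_
    exact (Real.continuous_rpow_const (by norm_num)).comp (by fun_prop)
  have hlim : ∀ x y : ℝ, x ∈ Icc (0 : ℝ) 1 → Tendsto invo (𝓝[Ioo 0 1] x) (𝓝[Icc 0 1] y) →
      y ∈ Icc (0 : ℝ) 1 → x ^ (1 / 4 : ℝ) * (1 - x) ^ (1 / 4 : ℝ) = 0 →
      Tendsto (splitSum [] (f :: v)) (𝓝[Ioo 0 1] x) (𝓝 (It (f :: v) x + It R y)) := by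
    intro x y hx hxy hy h0
    have hT : Tendsto (fun t : ℝ => t ^ (1 / 4 : ℝ) * (1 - t) ^ (1 / 4 : ℝ)) (𝓝[Ioo 0 1] x)
        (𝓝 0) := by
      rw [← h0]
      exact (hrpow.tendsto x).mono_left nhdsWithin_le_nhds
    have h1 := splitSum_sub_tendsto hK self_mem_nhdsWithin hT v [f] (by simp) hRr hl.2.2.2
    have h2 : Tendsto (It (f :: v)) (𝓝[Ioo 0 1] x) (𝓝 (It (f :: v) x)) :=
      (hcl x hx).mono_left (nhdsWithin_mono _ Ioo_subset_Icc_self)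
    have h3 : Tendsto (fun t => It R (invo t)) (𝓝[Ioo 0 1] x) (𝓝 (It R y)) :=
      (hcr y hy).tendsto.comp hxy
    have h4 := (h2.add h3).add h1
    rw [add_zero] at h4
    refine h4.congr fun t => ?_
    rw [hE, hR']
    ring
  have hconst : ∀ t ∈ Ioo (0 : ℝ) 1, splitSum [] (f :: v) t = splitSum [] (f :: v) (1 / 2) := by
    have hd : ∀ t ∈ Ioo (0 : ℝ) 1, HasDerivAt (splitSum [] (f :: v)) 0 t := by
      intro t ht
      refine (hasDerivAt_splitSum hK (f :: v) [] (by simpa using hRr) hl ht).congr_deriv ?_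
      simp [splitDer]
    intro t ht
    have := (convex_Ioo (0 : ℝ) 1).is_const_of_fderivWithin_eq_zero (𝕜 := ℝ)
      (f := splitSum [] (f :: v))
      (fun x hx => (hd x hx).differentiableAt.differentiableWithinAt) (fun x hx => by
        rw [fderivWithin_of_isOpen isOpen_Ioo hx, (hd x hx).hasFDerivAt.fderiv]
        ext
        simp) ht (y := 1 / 2) (by norm_num)
    exact this
  have hne0 : (𝓝[Ioo (0 : ℝ) 1] 0).NeBot := by
    rw [← mem_closure_iff_nhdsWithin_neBot, closure_Ioo zero_ne_one]
    simp
  have hne1 : (𝓝[Ioo (0 : ℝ) 1] 1).NeBot := by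
    rw [← mem_closure_iff_nhdsWithin_neBot, closure_Ioo zero_ne_one]
    simp
  have hc : ∀ x, Tendsto (splitSum [] (f :: v)) (𝓝[Ioo (0 : ℝ) 1] x)
      (𝓝 (splitSum [] (f :: v) (1 / 2))) := by
    intro x
    refine (tendsto_const_nhds).congr' ?_
    filter_upwards [self_mem_nhdsWithin] with t ht
    exact (hconst t ht).symm
  have l0 := tendsto_nhds_unique (hc 0)
    (hlim 0 1 (by simp) tendsto_invo_zero (by simp) (by norm_num))
  have l1 := tendsto_nhds_unique (hc 1)
    (hlim 1 0 (by simp) tendsto_invo_one (by simp) (by norm_num))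
  rw [It_zero_cons, zero_add] at l0
  rw [hR0, add_zero] at l1
  rw [← l1, l0]

/-- The `ℓ¹`-norm of a coefficient vector. -/
def cnorm (c : Pt → ℤ) : ℝ := ∑ a, |(c a : ℝ)|

lemma slot_continuousOn (c : Pt → ℤ) : ContinuousOn (slot c) (Ioo 0 1) := by
  unfold slot
  exact continuousOn_finsetSum _ fun a _ => continuousOn_const.mul (raw_continuousOn a)

lemma slot_bound {c : Pt → ℤ} {t M : ℝ} (h : ∀ a, c a ≠ 0 → ‖raw a t‖ ≤ 1 / M) :
    ‖slot c t‖ ≤ cnorm c / M := by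
  rw [cnorm, Finset.sum_div, slot]
  refine norm_sum_le_of_le _ fun a _ => ?_
  rw [norm_mul, Complex.norm_intCast]
  by_cases ha : c a = 0
  · simp [ha]
  · calc |(c a : ℝ)| * ‖raw a t‖ ≤ |(c a : ℝ)| * (1 / M) := by gcongr; exact h a ha
      _ = _ := by ring

lemma slot_le {c : Pt → ℤ} {t : ℝ} (ht : t ∈ Ioo (0 : ℝ) 1) :
    ‖slot c t‖ ≤ cnorm c / (t * (1 - t)) := slot_bound fun _ _ => norm_raw_le' ht

lemma slot_le_zero {c : Pt → ℤ} {t : ℝ} (ht : t ∈ Ioo (0 : ℝ) 1) (hc : c .z = 0) :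
    ‖slot c t‖ ≤ cnorm c / (1 - t) :=
  slot_bound fun _ ha => (norm_raw_le ht).1 fun h => ha (h ▸ hc)

lemma slot_le_one {c : Pt → ℤ} {t : ℝ} (ht : t ∈ Ioo (0 : ℝ) 1) (hc : c .o = 0) :
    ‖slot c t‖ ≤ cnorm c / t :=
  slot_bound fun _ ha => (norm_raw_le ht).2 fun h => ha (h ▸ hc)

/-- The coefficients of the pullback of the raw forms at `0, 1, -1` under `t ↦ t ^ 2`. -/
def sqc : Pt → Pt → ℤ
  | .z, .z => 2
  | .o, .o => 1
  | .o, .n => 1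
  | .n, .i => 1
  | .n, .m => 1
  | _, _ => 0

lemma add_I_ne (t : ℝ) : (t : ℂ) + Complex.I ≠ 0 := by
  intro h
  have := one_le_norm_add_I t
  rw [h] at this
  simp at this
  linarith

lemma sub_I_ne (t : ℝ) : (t : ℂ) - Complex.I ≠ 0 := by
  intro h
  have := one_le_norm_sub_I t
  rw [h] at this
  simp at this
  linarith

lemma ofReal_ne {t : ℝ} (ht : t ∈ Ioo (0 : ℝ) 1) : (t : ℂ) ≠ 0 := by
  have := ht.1
  exact_mod_cast this.ne'

lemma ofReal_sub_one_ne {t : ℝ} (ht : t ∈ Ioo (0 : ℝ) 1) : (t : ℂ) - 1 ≠ 0 :=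
  val_ne (a := .o) ht

lemma ofReal_add_one_ne {t : ℝ} (ht : t ∈ Ioo (0 : ℝ) 1) : (t : ℂ) + 1 ≠ 0 := by
  have := val_ne (a := .n) ht
  simpa [Pt.val] using this

lemma sq_raw {a : Pt} (ha : a ∈ ({.z, .o, .n} : Set Pt)) :
    EqOn (sq (raw a)) (slot (sqc a)) (Ioo 0 1) := by
  intro t ht
  have h0 := ofReal_ne ht
  have h1 := ofReal_sub_one_ne ht
  have h2 := ofReal_add_one_ne ht
  have h3 := add_I_ne t
  have h4 := sub_I_ne t
  rcases ha with rfl | rfl | rfl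
  · simp [sq, raw, slot, Pt.sum_univ, sqc, Pt.val]
    field_simp
  · have h5 : (t : ℂ) ^ 2 - 1 ≠ 0 := by
      have : (t : ℂ) ^ 2 - 1 = (t - 1) * (t + 1) := by ring
      rw [this]
      exact mul_ne_zero h1 h2
    simp [sq, raw, slot, Pt.sum_univ, sqc, Pt.val]
    field_simp
    ring
  · have h6 : (t : ℂ) ^ 2 + 1 = (t - Complex.I) * (t + Complex.I) := by
      ring_nf
      simp [Complex.I_sq]
      ring
    simp [sq, raw, slot, Pt.sum_univ, sqc, Pt.val]
    rw [h6]
    field_simp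
    ring

/-- The coefficients of the pullback of the raw forms at `1, -1` under `invo`. -/
def pullc : Pt → Pt → ℤ
  | .o, .z => -1
  | .o, .n => 1
  | .n, .n => 1
  | _, _ => 0

lemma one_add_invo {t : ℝ} (ht : t ∈ Ioo (0 : ℝ) 1) : ((invo t : ℝ) : ℂ) = 2 / (t + 1) - 1 := by
  have h2 := ofReal_add_one_ne ht
  rw [invo]
  push_cast
  rw [add_comm (1 : ℂ)]
  field_simp
  ring

lemma pull_raw {a : Pt} (ha : a ∈ ({.o, .n} : Set Pt)) :
    EqOn (pull (raw a)) (slot (pullc a)) (Ioo 0 1) := by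
  intro t ht
  have h0 := ofReal_ne ht
  have h2 := ofReal_add_one_ne ht
  rcases ha with rfl | rfl
  · simp only [pull, raw, slot, Pt.sum_univ, pullc, Pt.val, one_add_invo ht]
    have : 2 / ((t : ℂ) + 1) - 1 - 1 = -2 * t / (t + 1) := by field_simp; ring
    rw [this, add_comm (1 : ℂ)]
    simp
    field_simp
    ring
  · simp only [pull, raw, slot, Pt.sum_univ, pullc, Pt.val, one_add_invo ht]
    rw [add_comm (1 : ℂ)]
    simp
    field_simp

/-- The values that are rational combinations of regular words up to twice an integral one. -/
noncomputable def Pn (n : ℕ) : AddSubgroup ℂ :=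
  (V n).toAddSubgroup ⊔ (Nval univ n).map (AddMonoidHom.mulLeft (2 : ℂ))

lemma V_le_Pn {n : ℕ} {x : ℂ} (h : x ∈ V n) : x ∈ Pn n :=
  AddSubgroup.mem_sup_left (show x ∈ (V n).toAddSubgroup from h)

lemma two_mul_mem_Pn {n : ℕ} {x : ℂ} (h : x ∈ Nval univ n) : 2 * x ∈ Pn n :=
  AddSubgroup.mem_sup_right ⟨x, h, rfl⟩

/-- Words in `0, 1, -1` containing the letter `0`, or in `-1` only. -/
lemma sq_mem_Pn {l : List Pt} (hl : ∀ a ∈ l, a ∈ ({.z, .o, .n} : Set Pt))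
    (hz : l.getLast? ≠ some .z) (ho : l.head? ≠ some .o) (h : .z ∈ l ∨ .o ∉ l) :
    It (l.map raw) 1 ∈ Pn l.length := by
  have e : It (l.map raw) 1 = It ((l.map sqc).map slot) 1 := by
    have := It_sq (l.map raw) zero_le_one
    rw [one_pow] at this
    rw [this, List.map_map, List.map_map]
    exact It_map_congr l (fun a ha => sq_raw (hl a ha)) (by simp)
  have hlast : ∀ c, (l.map sqc).getLast? = some c → c .z = 0 := by
    intro c hc
    rw [List.getLast?_map] at hc
    obtain ⟨a, ha, rfl⟩ := Option.map_eq_some_iff.1 hc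
    cases a <;> first | rfl | exact absurd ha hz
  have hhead : ∀ c, (l.map sqc).head? = some c → c .o = 0 := by
    intro c hc
    rw [List.head?_map] at hc
    obtain ⟨a, ha, rfl⟩ := Option.map_eq_some_iff.1 hc
    cases a <;> first | rfl | exact absurd ha ho
  rw [e]
  by_cases hzl : Pt.z ∈ l
  · obtain ⟨u, v, rfl⟩ := List.append_of_mem hzl
    set e0 : Pt → ℤ := fun a => if a = .z then 1 else 0 with he0
    have e2 : slot (sqc .z) = fun s => 2 * slot e0 s := by
      funext s
      simp [slot, Pt.sum_univ, sqc, he0]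
    have e3 : ((u ++ Pt.z :: v).map sqc).map slot =
        (u.map sqc).map slot ++ (fun s => 2 * slot e0 s) :: (v.map sqc).map slot := by
      simp only [List.map_append, List.map_cons, e2]
    rw [e3, It_smul]
    have e4 : (u.map sqc).map slot ++ slot e0 :: (v.map sqc).map slot =
        (u.map sqc ++ e0 :: v.map sqc).map slot := by simp
    have e5 : (u ++ Pt.z :: v).length = (u.map sqc ++ e0 :: v.map sqc).length := by simp
    rw [e4, e5]
    refine two_mul_mem_Pn (slots_mem (by simp) ?_ ?_)
    · intro c hc
      cases v with
      | nil => simp at hz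
      | cons b v =>
        refine hlast c ?_
        simpa [List.getLast?_append] using hc
    · intro c hc
      cases u with
      | nil =>
        simp at hc
        subst hc
        simp [he0]
      | cons b u =>
        refine hhead c ?_
        simpa using hc
  · have hol : Pt.o ∉ l := h.resolve_left hzl
    refine V_le_Pn (Nval_reg_le _ ?_)
    have := slots_mem (S := Sreg) (L := l.map sqc) ?_ hlast hhead
    · simpa using this
    · intro c hc a ha
      obtain ⟨b, hb, rfl⟩ := List.mem_map.1 hc
      have hb' : b = .n := by
        rcases hl b hb with rfl | rfl | rfl
        · exact absurd hb hzl
        · exact absurd hb hol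
        · rfl
      subst hb'
      cases a
      · rfl
      · rfl
      · rfl
      · exact absurd (Or.inl rfl) ha
      · exact absurd (Or.inr rfl) ha

lemma Nval_zn_le (n : ℕ) : Nval {.z, .n} n ≤ Pn n := by
  refine (AddSubgroup.closure_le _).2 ?_
  rintro _ ⟨l, rfl, h1, h2, h3, rfl⟩
  refine sq_mem_Pn (fun a ha => ?_) h2 h3 (Or.inr fun h => ?_)
  · rcases h1 a ha with rfl | rfl <;> simp
  · have := h1 _ h
    simp at this

lemma Nval_zon_le (n : ℕ) : Nval {.z, .o, .n} n ≤ Pn n := by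
  refine (AddSubgroup.closure_le _).2 ?_
  rintro _ ⟨l, rfl, h1, h2, h3, rfl⟩
  by_cases hzl : Pt.z ∈ l
  · exact sq_mem_Pn h1 h2 h3 (Or.inl hzl)
  · have hon : ∀ a ∈ l, a ∈ ({.o, .n} : Set Pt) := by
      intro a ha
      rcases h1 a ha with rfl | rfl | rfl
      · exact absurd ha hzl
      · simp
      · simp
    have hb : ∀ a ∈ l, cnorm (pullc a) ≤ 2 := by
      intro a ha
      rcases hon a ha with rfl | rfl <;> norm_num [cnorm, Pt.sum_univ, pullc]
    have hpos : ∀ {a : Pt} (_ : a ∈ l) {s M : ℝ}, 0 ≤ M →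
        ‖slot (pullc a) s‖ ≤ cnorm (pullc a) / M → ‖slot (pullc a) s‖ ≤ 2 / M :=
      fun ha _ _ hM h => h.trans (div_le_div_of_nonneg_right (hb _ ha) hM)
    have hpull : It (l.map raw) 1 = It ((l.map raw).map pull).reverse 1 := by
      refine It_reverse (K := 2) zero_le_two ?_ ?_ ?_ ?_
      · refine adm_of (fun a ha => ⟨raw_continuousOn a, fun s hs => ?_⟩) fun a ha s hs => ?_
        · have := hs.1
          have : 0 < 1 - s := by linarith [hs.2]
          exact (norm_raw_le' hs).trans (by gcongr; norm_num)
        · have : 0 < 1 - s := by linarith [hs.2]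
          exact ((norm_raw_le hs).1 (by rintro rfl; exact h2 ha)).trans (by gcongr; norm_num)
      · intro f hf s hs
        rw [List.head?_map] at hf
        obtain ⟨a, ha, rfl⟩ := Option.map_eq_some_iff.1 hf
        have := hs.1
        exact ((norm_raw_le hs).2 (by rintro rfl; exact h3 ha)).trans (by gcongr; norm_num)
      · rw [List.map_map, ← List.map_reverse]
        refine adm_of (fun a ha => ?_) (fun a ha s hs => ?_)
        · have ha' : a ∈ l := by simpa using ha
          refine ⟨(slot_continuousOn (pullc a)).congr (pull_raw (hon a ha')), fun s hs => ?_⟩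
          have h0 := hs.1
          have h1 : 0 < 1 - s := by linarith [hs.2]
          rw [Function.comp_apply, pull_raw (hon a ha') hs]
          exact hpos ha' (by positivity) (slot_le hs)
        · have ha' : a ∈ l := by simpa using List.mem_of_getLast? ha
          have h1 : 0 < 1 - s := by linarith [hs.2]
          rw [Function.comp_apply, pull_raw (hon a ha') hs]
          refine hpos ha' h1.le (slot_le_zero hs ?_)
          rw [List.getLast?_reverse] at ha
          rcases hon a ha' with rfl | rfl
          · exact absurd ha h3
          · rfl
      · intro f hf s hs
        rw [List.getLast?_map] at hf
        obtain ⟨a, ha, rfl⟩ := Option.map_eq_some_iff.1 hf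
        have ha' : a ∈ l := List.mem_of_getLast? ha
        rw [pull_raw (hon a ha') hs]
        refine hpos ha' hs.1.le (slot_le_one hs ?_)
        rcases hon a ha' with rfl | rfl <;> rfl
    have e : It (l.map raw) 1 = It ((l.reverse.map pullc).map slot) 1 := by
      rw [hpull, List.map_map, ← List.map_reverse, List.map_map]
      exact It_map_congr _ (fun a ha => pull_raw (hon a (by simpa using ha))) (by simp)
    rw [e]
    have := slots_mem (S := {.z, .n}) (L := l.reverse.map pullc) ?_ ?_ ?_
    · have h := Nval_zn_le _ this
      simpa using h
    · intro c hc a ha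
      obtain ⟨b, hb, rfl⟩ := List.mem_map.1 hc
      have hb' := hon b (by simpa using hb)
      rcases hb' with rfl | rfl <;> cases a <;> first | rfl | exact absurd (by simp) ha
    · intro c hc
      rw [List.getLast?_map] at hc
      obtain ⟨a, ha, rfl⟩ := Option.map_eq_some_iff.1 hc
      rw [List.getLast?_reverse] at ha
      have ha' := hon a (List.mem_of_head? ha)
      rcases ha' with rfl | rfl
      · exact absurd ha h3
      · rfl
    · intro c hc
      rw [List.head?_map] at hc
      obtain ⟨a, ha, rfl⟩ := Option.map_eq_some_iff.1 hc
      rw [List.head?_reverse] at ha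
      have ha' := hon a (List.mem_of_getLast? ha)
      rcases ha' with rfl | rfl <;> rfl

/-- Labels of the base forms `1/t`, `1/(t-i) - 1/(t+i)` and `1/(t-i)`. -/
inductive Bf
  | nu | lam | pp
  deriving DecidableEq

/-- The coefficients of the base forms. -/
def bfc : Bf → Pt → ℤ
  | .nu, .z => 1
  | .lam, .i => 1
  | .lam, .m => -1
  | .pp, .i => 1
  | _, _ => 0

/-- The base forms. -/
noncomputable def bf (b : Bf) : ℝ → ℂ := slot (bfc b)

lemma cnorm_bfc_le (b : Bf) : cnorm (bfc b) ≤ 2 := by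
  cases b <;> norm_num [cnorm, Pt.sum_univ, bfc]

lemma bf_le {b : Bf} {t : ℝ} (ht : t ∈ Ioo (0 : ℝ) 1) : ‖bf b t‖ ≤ 2 / (t * (1 - t)) := by
  have h0 := ht.1
  have h1 : 0 < 1 - t := by linarith [ht.2]
  exact (slot_le ht).trans (by gcongr; exact cnorm_bfc_le b)

lemma bf_le_one {b : Bf} {t : ℝ} (ht : t ∈ Ioo (0 : ℝ) 1) : ‖bf b t‖ ≤ 2 / t := by
  have h0 := ht.1
  exact (slot_le_one ht (by cases b <;> rfl)).trans (by gcongr; exact cnorm_bfc_le b)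

lemma adm_bf {u : List Bf} (h : u.getLast? ≠ some .nu) : Adm 2 (u.map bf) := by
  refine adm_of (fun b _ => ⟨slot_continuousOn _, fun s hs => bf_le hs⟩) fun b hb s hs => ?_
  have h1 : 0 < 1 - s := by linarith [hs.2]
  refine (slot_le_zero hs ?_).trans (by gcongr; exact cnorm_bfc_le b)
  cases b
  · exact absurd hb h
  · rfl
  · rfl

/-- Evaluation of a formal sum of terms `n • b(r) • x`. -/
noncomputable def ev {X : Type} (T : List (ℤ × Bf × X)) (r : ℝ) (φ : X → ℂ) : ℂ :=
  (T.map fun x => (x.1 : ℂ) * bf x.2.1 r * φ x.2.2).sum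

section ev
variable {X Y : Type}

@[simp] lemma ev_nil (r : ℝ) (φ : X → ℂ) : ev [] r φ = 0 := rfl

@[simp] lemma ev_cons (x : ℤ × Bf × X) (T : List (ℤ × Bf × X)) (r : ℝ) (φ : X → ℂ) :
    ev (x :: T) r φ = x.1 * bf x.2.1 r * φ x.2.2 + ev T r φ := by simp [ev]

lemma ev_append (T T' : List (ℤ × Bf × X)) (r : ℝ) (φ : X → ℂ) :
    ev (T ++ T') r φ = ev T r φ + ev T' r φ := by simp [ev]

/-- Relabelling of a formal sum. -/
def tmap (g : X → Y) (T : List (ℤ × Bf × X)) : List (ℤ × Bf × Y) :=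
  T.map fun x => (x.1, x.2.1, g x.2.2)

lemma ev_tmap (g : X → Y) (T : List (ℤ × Bf × X)) (r : ℝ) (φ : Y → ℂ) :
    ev (tmap g T) r φ = ev T r fun x => φ (g x) := by
  simp [ev, tmap, Function.comp_def]

lemma mem_tmap {g : X → Y} {T : List (ℤ × Bf × X)} {y : ℤ × Bf × Y} (h : y ∈ tmap g T) :
    ∃ x ∈ T, y = (x.1, x.2.1, g x.2.2) := by
  obtain ⟨x, hx, rfl⟩ := List.mem_map.1 h
  exact ⟨x, hx, rfl⟩

lemma ev_mul_left (T : List (ℤ × Bf × X)) (r : ℝ) (c : ℂ) (φ : X → ℂ) :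
    (ev T r fun x => c * φ x) = c * ev T r φ := by
  induction T with
  | nil => simp
  | cons x T ih => rw [ev_cons, ev_cons, ih]; ring

lemma ev_mul_right (T : List (ℤ × Bf × X)) (r : ℝ) (c : ℂ) (φ : X → ℂ) :
    (ev T r fun x => φ x * c) = ev T r φ * c := by
  simp only [mul_comm _ c, ev_mul_left]

lemma ev_hasDerivAt {T : List (ℤ × Bf × X)} {r t : ℝ} {φ : X → ℝ → ℂ} {φ' : X → ℂ}
    (h : ∀ x ∈ T, HasDerivAt (φ x.2.2) (φ' x.2.2) t) :
    HasDerivAt (fun t => ev T r fun x => φ x t) (ev T r φ') t := by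
  induction T with
  | nil => exact hasDerivAt_const _ _
  | cons x T ih =>
    simp only [ev_cons]
    exact ((h x List.mem_cons_self).const_mul _).add
      (ih fun y hy => h y (List.mem_cons_of_mem _ hy))

lemma ev_tendsto {T : List (ℤ × Bf × X)} {r : ℝ} {φ : X → ℝ → ℂ} {φ' : X → ℂ} {F : Filter ℝ}
    (h : ∀ x ∈ T, Tendsto (φ x.2.2) F (𝓝 (φ' x.2.2))) :
    Tendsto (fun t => ev T r fun x => φ x t) F (𝓝 (ev T r φ')) := by
  induction T with
  | nil => exact tendsto_const_nhds
  | cons x T ih =>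
    simp only [ev_cons]
    exact ((h x List.mem_cons_self).const_mul _).add
      (ih fun y hy => h y (List.mem_cons_of_mem _ hy))

lemma ev_congr {T : List (ℤ × Bf × X)} {r : ℝ} {φ ψ : X → ℂ}
    (h : ∀ x ∈ T, φ x.2.2 = ψ x.2.2) : ev T r φ = ev T r ψ := by
  unfold ev
  congr 1
  exact List.map_congr_left fun x hx => by rw [h x hx]

lemma ev_integral {T : List (ℤ × Bf × X)} {r t : ℝ} {φ : X → ℝ → ℂ}
    (h : ∀ x ∈ T, IntervalIntegrable (φ x.2.2) volume 0 t) :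
    IntervalIntegrable (fun s => ev T r fun x => φ x s) volume 0 t ∧
    (∫ s in (0 : ℝ)..t, ev T r fun x => φ x s) = ev T r fun x => ∫ s in (0 : ℝ)..t, φ x s := by
  induction T with
  | nil => simp
  | cons x T ih =>
    obtain ⟨h1, h2⟩ := ih fun y hy => h y (List.mem_cons_of_mem _ hy)
    have h3 := (h x List.mem_cons_self).const_mul (x.1 * bf x.2.1 r)
    simp only [ev_cons]
    refine ⟨h3.add h1, ?_⟩
    rw [intervalIntegral.integral_add h3 h1, h2, intervalIntegral.integral_const_mul]

lemma ev_bound (T : List (ℤ × Bf × X)) {M : ℝ} (hM : 0 ≤ M) :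
    ∃ C, 0 ≤ C ∧ ∀ r, (∀ b, ‖bf b r‖ ≤ M) → ∀ (φ : X → ℂ) (B : ℝ),
      0 ≤ B → (∀ x ∈ T, ‖φ x.2.2‖ ≤ B) → ‖ev T r φ‖ ≤ C * B := by
  induction T with
  | nil => exact ⟨0, le_rfl, by simp⟩
  | cons x T ih =>
    obtain ⟨C, hC, ih⟩ := ih
    refine ⟨|(x.1 : ℝ)| * M + C, by positivity, fun r hr φ B hB h => ?_⟩
    rw [ev_cons, add_mul]
    refine norm_add_le_of_le ?_ (ih r hr φ B hB fun y hy => h y (List.mem_cons_of_mem _ hy))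
    rw [norm_mul, norm_mul, Complex.norm_intCast]
    gcongr
    · exact hr _
    · exact h x List.mem_cons_self

end ev

/-- A one-parameter family of forms `om j r`, closed under the commutation of the differentials in
the two variables, with coefficients among the base forms. -/
structure Fam (ι : Type) where
  om : ι → ℝ → ℝ → ℂ
  eta : ι → ℝ → ℝ → ℂ
  deta : ι → ℝ → ℝ → ℂ
  g0 : ι → Prop
  g1 : ι → Prop
  cl : ι → ι → List (ℤ × Bf × ι)
  hd : ι → ι → List (ℤ × Bf × ι)
  en : ι → List (ℤ × Bf × Unit)
  wt : ι → ℕ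
  K : ℝ
  K_nonneg : 0 ≤ K
  om_cont : ∀ j, ∀ r ∈ Icc (0 : ℝ) 1, ContinuousOn (om j r) (Ioo 0 1)
  om_le : ∀ j, ∀ r ∈ Icc (0 : ℝ) 1, ∀ t ∈ Ioo (0 : ℝ) 1, ‖om j r t‖ ≤ K / (t * (1 - t))
  om_le_zero : ∀ j, g0 j → ∀ r ∈ Icc (0 : ℝ) 1, ∀ t ∈ Ioo (0 : ℝ) 1, ‖om j r t‖ ≤ K / (1 - t)
  om_le_one : ∀ j, g1 j → ∀ r ∈ Icc (0 : ℝ) 1, ∀ t ∈ Ioo (0 : ℝ) 1, ‖om j r t‖ ≤ K / t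
  om_cont' : ∀ j, ∀ t ∈ Ioo (0 : ℝ) 1, ContinuousOn (fun r => om j r t) (Icc 0 1)
  om_deriv : ∀ j, ∀ r ∈ Ioo (0 : ℝ) 1, ∀ t ∈ Ioo (0 : ℝ) 1,
    HasDerivAt (fun r => om j r t) (deta j r t) r
  eta_deriv : ∀ j, ∀ r ∈ Ioo (0 : ℝ) 1, ∀ t ∈ Ioo (0 : ℝ) 1, HasDerivAt (eta j r) (deta j r t) t
  eta_cont : ∀ j, ∀ r ∈ Ioo (0 : ℝ) 1, ContinuousOn (eta j r) (Icc 0 1)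
  deta_cont : ∀ j, ∀ r ∈ Ioo (0 : ℝ) 1, ContinuousOn (deta j r) (Ioo 0 1)
  eta_zero : ∀ j, ∀ r, eta j r 0 = 0
  eta_le : ∀ j, ∀ r ∈ Ioo (0 : ℝ) 1, ∀ t ∈ Ioo (0 : ℝ) 1, ‖eta j r t‖ ≤ K * t
  deta_le : ∀ j, ∀ r ∈ Ioo (0 : ℝ) 1, ∀ t ∈ Ioo (0 : ℝ) 1, ‖deta j r t‖ ≤ K
  eta_end : ∀ j, ∀ r ∈ Ioo (0 : ℝ) 1, ∀ t ∈ Ioo (0 : ℝ) 1,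
    ‖eta j r t - ev (en j) r fun _ => 1‖ ≤ K * (1 - t)
  cl_eq : ∀ j i, ∀ r ∈ Ioo (0 : ℝ) 1, ∀ t ∈ Ioo (0 : ℝ) 1,
    om j r t * eta i r t - eta j r t * om i r t = ev (cl j i) r fun k => om k r t
  hd_eq : ∀ j i, ∀ r ∈ Ioo (0 : ℝ) 1, ∀ t ∈ Ioo (0 : ℝ) 1,
    (ev (en j) r fun _ => 1) * om i r t + (om j r t * eta i r t - eta j r t * om i r t)
      = ev (hd j i) r fun k => om k r t
  cl_g0 : ∀ j i, g0 i → ∀ x ∈ cl j i, g0 x.2.2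
  hd_g0 : ∀ j i, g0 i → ∀ x ∈ hd j i, g0 x.2.2
  hd_g1 : ∀ j i, g1 j → ∀ x ∈ hd j i, g1 x.2.2
  en_ne : ∀ j, ∀ x ∈ en j, x.2.1 ≠ .nu
  cl_nu : ∀ j i, ∀ x ∈ cl j i, x.2.1 = .nu → ∀ t ∈ Ioo (0 : ℝ) 1, om x.2.2 0 t = 0
  hd_nu : ∀ j i, ∀ x ∈ hd j i, x.2.1 = .nu → ∀ t ∈ Ioo (0 : ℝ) 1, om x.2.2 0 t = 0
  cl_wt : ∀ j i, ∀ x ∈ cl j i, 2 ∣ x.1 ∨ wt j + wt i ≤ [x.2.1].count .lam + wt x.2.2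
  hd_wt : ∀ j i, ∀ x ∈ hd j i, 2 ∣ x.1 ∨ wt j + wt i ≤ [x.2.1].count .lam + wt x.2.2
  en_wt : ∀ j, ∀ x ∈ en j, 2 ∣ x.1 ∨ wt j ≤ [x.2.1].count .lam

namespace Fam
variable {ι : Type} (Φ : Fam ι)

/-- The iterated integral of a word of forms of the family. -/
noncomputable def W (w : List ι) (r t : ℝ) : ℂ := It (w.map fun j => Φ.om j r) t

/-- The last form is nonsingular at `0`. -/
def G0 (w : List ι) : Prop := ∀ j, w.getLast? = some j → Φ.g0 j

/-- The first form is nonsingular at `1`. -/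
def G1 (w : List ι) : Prop := ∀ j, w.head? = some j → Φ.g1 j

/-- The terms produced by commuting adjacent forms. -/
def Kl : List ι → List (ℤ × Bf × List ι)
  | j :: i :: w => tmap (j :: ·) (Kl (i :: w)) ++ tmap (· :: w) (Φ.cl j i)
  | [_] => []
  | [] => []

/-- The terms of the derivative at upper endpoint `1`. -/
def Dl : List ι → List (ℤ × Bf × List ι)
  | j :: i :: w => tmap (j :: ·) (Φ.Kl (i :: w)) ++ tmap (· :: w) (Φ.hd j i)
  | [j] => tmap (fun _ => []) (Φ.en j)
  | [] => []

/-- The derivative in the parameter of `W`. -/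
noncomputable def G : List ι → ℝ → ℝ → ℂ
  | [], _, _ => 0
  | j :: w, r, t => Φ.eta j r t * Φ.W w r t + ev (Φ.Kl (j :: w)) r fun v => Φ.W v r t

variable {Φ}

lemma G0.tail {j : ι} {w : List ι} (h : Φ.G0 (j :: w)) : Φ.G0 w := by
  intro i hi
  cases w with
  | nil => simp at hi
  | cons k w => exact h i (by rwa [List.getLast?_cons_cons])

lemma G0.cons {j : ι} {w : List ι} (h : Φ.G0 w) (hw : w = [] → Φ.g0 j) : Φ.G0 (j :: w) := by
  intro i hi
  cases w with
  | nil =>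
    simp at hi
    exact hi ▸ hw rfl
  | cons k w => exact h i (by rwa [List.getLast?_cons_cons] at hi)

lemma adm {w : List ι} (h : Φ.G0 w) {r : ℝ} (hr : r ∈ Icc (0 : ℝ) 1) :
    Adm Φ.K (w.map fun j => Φ.om j r) :=
  adm_of (fun j _ => ⟨Φ.om_cont j r hr, Φ.om_le j r hr⟩)
    fun j hj => Φ.om_le_zero j (h j hj) r hr

lemma Kl_spec : ∀ {w : List ι}, ∀ x ∈ Φ.Kl w, x.2.2.length + 1 = w.length ∧ x.2.2 ≠ [] ∧
    (Φ.G0 w → Φ.G0 x.2.2) ∧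
    (x.2.1 = .nu → ∃ k ∈ x.2.2, ∀ t ∈ Ioo (0 : ℝ) 1, Φ.om k 0 t = 0) ∧
    (2 ∣ x.1 ∨ (w.map Φ.wt).sum ≤ [x.2.1].count .lam + (x.2.2.map Φ.wt).sum)
  | [], x, hx => by simp [Kl] at hx
  | [j], x, hx => by simp [Kl] at hx
  | j :: i :: w, x, hx => by
    rw [Kl, List.mem_append] at hx
    rcases hx with hx | hx
    · obtain ⟨y, hy, rfl⟩ := mem_tmap hx
      obtain ⟨h1, h2, h3, h4, h5⟩ := Kl_spec y hy
      refine ⟨by simpa using h1, by simp, fun h => (h3 h.tail).cons fun h => absurd h h2,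
        fun h => ?_, ?_⟩
      · obtain ⟨k, hk, hk'⟩ := h4 h
        exact ⟨k, List.mem_cons_of_mem _ hk, hk'⟩
      · refine h5.imp_right fun h => ?_
        simp only [List.map_cons, List.sum_cons] at h ⊢
        omega
    · obtain ⟨y, hy, rfl⟩ := mem_tmap hx
      refine ⟨by simp, by simp, fun h => h.tail.tail.cons ?_, fun h =>
        ⟨_, List.mem_cons_self, Φ.cl_nu j i y hy h⟩, ?_⟩
      · rintro rfl
        exact Φ.cl_g0 j i (h i rfl) y hy
      · refine (Φ.cl_wt j i y hy).imp_right fun h => ?_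
        simp only [List.map_cons, List.sum_cons] at h ⊢
        omega

lemma Dl_spec {w : List ι} (h0 : Φ.G0 w) (h1 : Φ.G1 w) : ∀ x ∈ Φ.Dl w,
    x.2.2.length + 1 = w.length ∧ Φ.G0 x.2.2 ∧ Φ.G1 x.2.2 ∧
    (x.2.1 = .nu → ∃ k ∈ x.2.2, ∀ t ∈ Ioo (0 : ℝ) 1, Φ.om k 0 t = 0) ∧
    (2 ∣ x.1 ∨ (w.map Φ.wt).sum ≤ [x.2.1].count .lam + (x.2.2.map Φ.wt).sum) := by
  intro x hx
  rcases w with _ | ⟨j, _ | ⟨i, w⟩⟩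
  · simp [Dl] at hx
  · rw [Dl] at hx
    obtain ⟨y, hy, rfl⟩ := mem_tmap hx
    refine ⟨by simp, by simp [G0], by simp [G1], fun h => absurd h (Φ.en_ne j y hy), ?_⟩
    simpa using Φ.en_wt j y hy
  · rw [Dl, List.mem_append] at hx
    rcases hx with hx | hx
    · obtain ⟨y, hy, rfl⟩ := mem_tmap hx
      obtain ⟨h1', h2, h3, h4, h5⟩ := Kl_spec y hy
      refine ⟨by simpa using h1', (h3 h0.tail).cons fun h => absurd h h2, ?_, fun h => ?_, ?_⟩
      · intro k hk
        exact h1 k (by simpa using hk)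
      · obtain ⟨k, hk, hk'⟩ := h4 h
        exact ⟨k, List.mem_cons_of_mem _ hk, hk'⟩
      · refine h5.imp_right fun h => ?_
        simp only [List.map_cons, List.sum_cons] at h ⊢
        omega
    · obtain ⟨y, hy, rfl⟩ := mem_tmap hx
      refine ⟨by simp, h0.tail.tail.cons ?_, ?_, fun h =>
        ⟨_, List.mem_cons_self, Φ.hd_nu j i y hy h⟩, ?_⟩
      · rintro rfl
        exact Φ.hd_g0 j i (h0 i rfl) y hy
      · intro k hk
        simp only [List.head?_cons, Option.some.injEq] at hk
        subst hk
        exact Φ.hd_g1 j i (h1 j rfl) y hy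
      · refine (Φ.hd_wt j i y hy).imp_right fun h => ?_
        simp only [List.map_cons, List.sum_cons] at h ⊢
        omega

section deriv
variable {j : ι} {w : List ι} {r : ℝ}

lemma W_hasDerivAt (h : Φ.G0 (j :: w)) (hr : r ∈ Icc (0 : ℝ) 1) {t : ℝ} (ht : t ∈ Ioo (0 : ℝ) 1) :
    HasDerivAt (Φ.W (j :: w) r) (Φ.om j r t * Φ.W w r t) t :=
  It_hasDerivAt Φ.K_nonneg (adm h hr) ht

lemma W_continuousOn (h : Φ.G0 w) (hr : r ∈ Icc (0 : ℝ) 1) :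
    ContinuousOn (Φ.W w r) (Ico 0 1) := It_continuousOn Φ.K_nonneg (adm h hr)

lemma W_continuousOn_one (h : Φ.G0 w) (h1 : Φ.G1 w) (hr : r ∈ Icc (0 : ℝ) 1) :
    ContinuousOn (Φ.W w r) (Icc 0 1) := by
  cases w with
  | nil => exact continuousOn_const
  | cons j w =>
    exact It_continuousOn_one Φ.K_nonneg (adm h hr) (Φ.om_le_one j (h1 j rfl) r hr)

lemma W_bound (h : Φ.G0 w) (hw : w ≠ []) (hr : r ∈ Icc (0 : ℝ) 1) {t : ℝ}
    (ht : t ∈ Ico (0 : ℝ) 1) : ‖Φ.W w r t‖ ≤ (4 * Φ.K) ^ w.length * gauge t := by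
  have := It_bound Φ.K_nonneg (adm h hr) (by simpa using hw) ht
  simpa [W] using this

lemma W_zero (hw : w ≠ []) : Φ.W w r 0 = 0 := by
  cases w with
  | nil => exact absurd rfl hw
  | cons j w => exact It_zero_cons _ _

lemma G_hasDerivAt (h : Φ.G0 (j :: w)) (hr : r ∈ Ioo (0 : ℝ) 1) {t : ℝ} (ht : t ∈ Ioo (0 : ℝ) 1) :
    HasDerivAt (Φ.G (j :: w) r) (Φ.deta j r t * Φ.W w r t + Φ.om j r t * Φ.G w r t) t := by
  have hr' := Ioo_subset_Icc_self hr
  rcases w with _ | ⟨i, w⟩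
  · refine (Φ.eta_deriv j r hr t ht).congr_deriv ?_ |>.congr_of_eventuallyEq ?_
    · simp [G, W, It]
    · exact Eventually.of_forall fun s => by simp [G, Kl, W, It]
  · have e : Φ.G (j :: i :: w) r = fun t => Φ.eta j r t * Φ.W (i :: w) r t +
        ((ev (Φ.Kl (i :: w)) r fun v => Φ.W (j :: v) r t) +
          ev (Φ.cl j i) r fun k => Φ.W (k :: w) r t) := by
      funext s
      rw [G, Kl, ev_append, ev_tmap, ev_tmap]
    rw [e]
    have d1 := ev_hasDerivAt (T := Φ.Kl (i :: w)) (r := r) (t := t)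
      (φ := fun v => Φ.W (j :: v) r) (φ' := fun v => Φ.om j r t * Φ.W v r t)
      (fun x hx => by
        obtain ⟨_, h2, h3, _⟩ := Kl_spec x hx
        exact W_hasDerivAt ((h3 h.tail).cons fun h => absurd h h2) hr' ht)
    have d2 := ev_hasDerivAt (T := Φ.cl j i) (r := r) (t := t)
      (φ := fun k => Φ.W (k :: w) r) (φ' := fun k => Φ.om k r t * Φ.W w r t)
      (fun x hx => by
        refine W_hasDerivAt (h.tail.tail.cons ?_) hr' ht
        rintro rfl
        exact Φ.cl_g0 j i (h i rfl) x hx)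
    refine (((Φ.eta_deriv j r hr t ht).mul (W_hasDerivAt h.tail hr' ht)).add
      (d1.add d2)).congr_deriv ?_
    rw [ev_mul_left, ev_mul_right, ← Φ.cl_eq j i r hr t ht, G]
    ring

lemma G_continuousOn (h : Φ.G0 w) (hr : r ∈ Ioo (0 : ℝ) 1) :
    ContinuousOn (Φ.G w r) (Ico 0 1) := by
  have hr' := Ioo_subset_Icc_self hr
  cases w with
  | nil => exact continuousOn_const
  | cons j w =>
    unfold G
    refine (((Φ.eta_cont j r hr).mono Ico_subset_Icc_self).mul (W_continuousOn h.tail hr')).add ?_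
    intro t ht
    refine ev_tendsto fun x hx => ?_
    obtain ⟨_, _, h3, _⟩ := Kl_spec x hx
    exact W_continuousOn (h3 h) hr' t ht

lemma G_zero : Φ.G w r 0 = 0 := by
  cases w with
  | nil => rfl
  | cons j w =>
    rw [G, Φ.eta_zero, zero_mul, zero_add]
    rw [ev_congr (ψ := fun _ => 0 * 1), ev_mul_left, zero_mul]
    intro x hx
    obtain ⟨_, h2, _⟩ := Kl_spec x hx
    rw [W_zero h2, zero_mul]

lemma bf_bounded {a b : ℝ} (ha : 0 < a) (hb : b < 1) : ∃ M, 0 ≤ M ∧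
    ∀ r ∈ Icc a b, ∀ β, ‖bf β r‖ ≤ M := by
  refine ⟨2 / (a * (1 - b)), ?_, fun r hr β => ?_⟩
  · have : 0 < 1 - b := by linarith
    positivity
  · have h1 : 0 < 1 - b := by linarith
    have h2 := hr.1
    have h3 := hr.2
    refine (bf_le ⟨by linarith, by linarith⟩).trans ?_
    have h4 : 0 < r := by linarith
    gcongr

lemma G_bound (h : Φ.G0 w) {a b : ℝ} (ha : 0 < a) (hb : b < 1) : ∃ C, 0 ≤ C ∧
    ∀ r ∈ Icc a b, ∀ t ∈ Ioo (0 : ℝ) 1, ‖Φ.G w r t‖ ≤ C * gauge t := by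
  cases w with
  | nil => exact ⟨0, le_rfl, by simp [G]⟩
  | cons j w =>
    obtain ⟨M, hM, hMb⟩ := bf_bounded ha hb
    obtain ⟨C, hC, hCb⟩ := ev_bound (Φ.Kl (j :: w)) hM
    have hK := Φ.K_nonneg
    refine ⟨Φ.K * (4 * Φ.K) ^ w.length + C * (4 * Φ.K) ^ w.length, by positivity,
      fun r hr t ht => ?_⟩
    have hr0 : r ∈ Ioo (0 : ℝ) 1 := ⟨ha.trans_le hr.1, hr.2.trans_lt hb⟩
    have hr' := Ioo_subset_Icc_self hr0
    have hg := gauge_nonneg ht.1.le ht.2.le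
    rw [G, add_mul]
    refine norm_add_le_of_le ?_ ?_
    · rw [norm_mul]
      have hη := Φ.eta_le j r hr0 t ht
      have ht0 := ht.1.le
      by_cases hw : w = []
      · subst hw
        simp only [W, It, List.map_nil, norm_one, mul_one, List.length_nil, pow_zero]
        exact hη.trans (mul_le_mul_of_nonneg_left (le_gauge ht.1.le ht.2) hK)
      · calc _ ≤ Φ.K * t * ((4 * Φ.K) ^ w.length * gauge t) := by
              gcongr
              exact W_bound h.tail hw hr' ⟨ht.1.le, ht.2⟩
          _ ≤ Φ.K * 1 * ((4 * Φ.K) ^ w.length * gauge t) := by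
              gcongr
              exact ht.2.le
          _ = _ := by ring
    · rw [mul_assoc]
      refine hCb r (hMb r hr) _ _ (by positivity) fun x hx => ?_
      obtain ⟨h1, h2, h3, _⟩ := Kl_spec x hx
      have h1' : x.2.2.length = w.length := by simpa using h1
      rw [← h1']
      exact W_bound (h3 h) h2 hr' ⟨ht.1.le, ht.2⟩

end deriv

end Fam

lemma ae_mem_Ioo {t : ℝ} (ht : t ∈ Icc (0 : ℝ) 1) :
    ∀ᵐ s ∂(volume : Measure ℝ), s ∈ uIoc 0 t → s ∈ Ioo (0 : ℝ) 1 := by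
  have : ∀ᵐ s ∂(volume : Measure ℝ), s ≠ 1 := by simp [ae_iff]
  filter_upwards [this] with s hs hst
  rw [uIoc_of_le ht.1] at hst
  exact ⟨hst.1, lt_of_le_of_ne (hst.2.trans ht.2) hs⟩

lemma measurable_uIoc {f : ℝ → ℂ} (hf : ContinuousOn f (Ioo 0 1)) {t : ℝ}
    (ht : t ∈ Icc (0 : ℝ) 1) : AEStronglyMeasurable f (volume.restrict (uIoc 0 t)) := by
  rw [uIoc_of_le ht.1, ← restrict_Ioo_eq_restrict_Ioc]
  exact (hf.mono fun s hs => ⟨hs.1, hs.2.trans_le ht.2⟩).aestronglyMeasurable measurableSet_Ioo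

lemma rate_integrable {C t : ℝ} (hC : 0 ≤ C) (ht : t ∈ Ico (0 : ℝ) 1) :
    IntervalIntegrable (fun s => C * (gauge s / (s * (1 - s)))) volume 0 t := by
  have hc : ContinuousOn (fun s => C * (gauge s / (s * (1 - s)))) (Ioo 0 1) := by
    refine continuousOn_const.mul ((continuousOn_gauge.mono Ioo_subset_Ico_self).div
      (by fun_prop) fun s hs => ?_)
    have h0 := hs.1
    have h1 : 0 < 1 - s := by linarith [hs.2]
    positivity
  have := (integrable_of_rate hC (g := fun s => ((C * (gauge s / (s * (1 - s))) : ℝ) : ℂ))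
    (Complex.continuous_ofReal.comp_continuousOn hc) (fun s hs => ?_) ht.1 ht.2).1
  · rw [intervalIntegrable_iff] at this ⊢
    exact this.re
  · have h0 := hs.1
    have h1 : 0 < 1 - s := by linarith [hs.2]
    have := gauge_nonneg hs.1.le hs.2.le
    rw [Complex.norm_real, Real.norm_of_nonneg (by positivity)]

lemma rate_integrable_one (C : ℝ) {t : ℝ} (ht : t ∈ Icc (0 : ℝ) 1) :
    IntervalIntegrable (fun s => C * (gauge s / s)) volume 0 t := by
  rw [intervalIntegrable_iff_integrableOn_Ioo_of_le ht.1]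
  exact (integrableOn_gauge_div.mono_set (Ioo_subset_Ioo_right ht.2)).const_mul C

lemma one_sub_mul_gauge_tendsto : Tendsto (fun t => (1 - t) * gauge t) (𝓝[<] 1) (𝓝 0) := by
  have h1 : Tendsto (fun t : ℝ => (1 - t) ^ (3 / 4 : ℝ)) (𝓝[<] 1) (𝓝 0) := by
    have : Continuous (fun t : ℝ => (1 - t) ^ (3 / 4 : ℝ)) :=
      (continuous_const.sub continuous_id).rpow_const fun x => Or.inr (by norm_num)
    have := this.tendsto 1
    simp only [sub_self] at this
    rw [Real.zero_rpow (by norm_num)] at this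
    exact this.mono_left nhdsWithin_le_nhds
  refine tendsto_of_tendsto_of_tendsto_of_le_of_le' tendsto_const_nhds h1 ?_ ?_
  all_goals
    filter_upwards [Ioo_mem_nhdsLT (zero_lt_one' ℝ)] with t ht
    have h2 : 0 < 1 - t := by linarith [ht.2]
  · exact mul_nonneg h2.le (gauge_nonneg ht.1.le ht.2.le)
  · have h3 : (1 - t) * (1 - t) ^ (-(1 / 4) : ℝ) = (1 - t) ^ (3 / 4 : ℝ) := by
      rw [← Real.rpow_one_add' h2.le (by norm_num)]
      norm_num
    rw [gauge, mul_left_comm, h3]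
    refine mul_le_of_le_one_left (Real.rpow_nonneg h2.le _) ?_
    exact Real.rpow_le_one ht.1.le ht.2.le (by norm_num)

namespace Fam
variable {ι : Type} {Φ : Fam ι} {j : ι} {w : List ι} {r t : ℝ}

/-- The derivative in the parameter of the outermost integrand. -/
noncomputable def dint (Φ : Fam ι) (j : ι) (w : List ι) (r s : ℝ) : ℂ :=
  Φ.deta j r s * Φ.W w r s + Φ.om j r s * Φ.G w r s

lemma dint_bound (h : Φ.G0 (j :: w)) {a b : ℝ} (ha : 0 < a) (hb : b < 1) : ∃ C, 0 ≤ C ∧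
    ∀ r ∈ Icc a b, ∀ s ∈ Ioo (0 : ℝ) 1,
      ‖Φ.dint j w r s‖ ≤ C * (gauge s / (s * (1 - s))) ∧
      (Φ.g1 j → ‖Φ.dint j w r s‖ ≤ C * (gauge s / s)) := by
  obtain ⟨C, hC, hCb⟩ := G_bound h.tail ha hb
  have hK := Φ.K_nonneg
  refine ⟨Φ.K * (4 * Φ.K) ^ w.length + Φ.K * C, by positivity, fun r hr s hs => ?_⟩
  have hr0 : r ∈ Ioo (0 : ℝ) 1 := ⟨ha.trans_le hr.1, hr.2.trans_lt hb⟩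
  have hr' := Ioo_subset_Icc_self hr0
  have h0 := hs.1
  have h1 : 0 < 1 - s := by linarith [hs.2]
  have hg := gauge_nonneg hs.1.le hs.2.le
  have hle : gauge s / s ≤ gauge s / (s * (1 - s)) := by
    gcongr
    nlinarith
  have hW : ‖Φ.W w r s‖ ≤ (4 * Φ.K) ^ w.length * (gauge s / s) := by
    by_cases hw : w = []
    · subst hw
      have : 1 ≤ gauge s / s := by rw [le_div_iff₀ h0, one_mul]; exact le_gauge h0.le hs.2
      simpa [W, It] using this
    · refine (W_bound h.tail hw hr' ⟨hs.1.le, hs.2⟩).trans ?_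
      gcongr
      rw [le_div_iff₀ h0]
      exact mul_le_of_le_one_right hg hs.2.le
  have hA : ‖Φ.deta j r s * Φ.W w r s‖ ≤ Φ.K * (4 * Φ.K) ^ w.length * (gauge s / s) := by
    rw [norm_mul, mul_assoc]
    gcongr
    exact Φ.deta_le j r hr0 s hs
  refine ⟨?_, fun hj => ?_⟩
  · rw [add_mul]
    refine norm_add_le_of_le (hA.trans (by gcongr)) ?_
    exact rate_bound hK hs (Φ.om_le j r hr' s hs) (hCb r hr s hs)
  · rw [add_mul]
    refine norm_add_le_of_le hA ?_
    rw [norm_mul]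
    calc _ ≤ Φ.K / s * (C * gauge s) := by
          gcongr
          · exact Φ.om_le_one j hj r hr' s hs
          · exact hCb r hr s hs
      _ = _ := by ring

lemma dint_continuousOn (h : Φ.G0 (j :: w)) (hr : r ∈ Ioo (0 : ℝ) 1) :
    ContinuousOn (Φ.dint j w r) (Ioo 0 1) := by
  have hr' := Ioo_subset_Icc_self hr
  exact ((Φ.deta_cont j r hr).mul ((W_continuousOn h.tail hr').mono Ioo_subset_Ico_self)).add
    ((Φ.om_cont j r hr').mul ((G_continuousOn h.tail hr).mono Ioo_subset_Ico_self))

lemma int_continuousOn (h : Φ.G0 (j :: w)) (hr : r ∈ Icc (0 : ℝ) 1) :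
    ContinuousOn (fun s => Φ.om j r s * Φ.W w r s) (Ioo 0 1) :=
  integrand_continuousOn Φ.K_nonneg (adm h hr)

lemma int_integrable (h : Φ.G0 (j :: w)) (hr : r ∈ Icc (0 : ℝ) 1) (ht : t ∈ Icc (0 : ℝ) 1)
    (h1 : t < 1 ∨ Φ.g1 j) : IntervalIntegrable (fun s => Φ.om j r s * Φ.W w r s) volume 0 t := by
  rcases h1 with h1 | h1
  · exact It_integrable Φ.K_nonneg (adm h hr) ⟨ht.1, h1⟩
  · exact It_integrable_one Φ.K_nonneg (adm h hr) (Φ.om_le_one j h1 r hr) ht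

/-- Differentiation under the outermost integral sign. -/
lemma W_hasDerivAt_param_aux (h : Φ.G0 (j :: w)) (hr : r ∈ Ioo (0 : ℝ) 1) (ht : t ∈ Icc (0 : ℝ) 1)
    (h1 : t < 1 ∨ Φ.g1 j)
    (ih : ∀ r ∈ Ioo (0 : ℝ) 1, ∀ s ∈ Ioo (0 : ℝ) 1,
      HasDerivAt (fun r => Φ.W w r s) (Φ.G w r s) r) :
    IntervalIntegrable (Φ.dint j w r) volume 0 t ∧
      HasDerivAt (fun r => Φ.W (j :: w) r t) (∫ s in (0 : ℝ)..t, Φ.dint j w r s) r := by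
  obtain ⟨a, ha, har⟩ := exists_between hr.1
  obtain ⟨b, hrb, hb⟩ := exists_between hr.2
  obtain ⟨C, hC, hCb⟩ := dint_bound h ha hb
  have hab : ∀ x ∈ Icc a b, x ∈ Ioo (0 : ℝ) 1 := fun x hx => ⟨ha.trans_le hx.1, hx.2.trans_lt hb⟩
  have hn : Icc a b ∈ 𝓝 r := Icc_mem_nhds har hrb
  obtain ⟨bound, hbi, hbb⟩ : ∃ bound : ℝ → ℝ, IntervalIntegrable bound volume 0 t ∧
      ∀ x ∈ Icc a b, ∀ s ∈ Ioo (0 : ℝ) 1, ‖Φ.dint j w x s‖ ≤ bound s := by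
    rcases h1 with h1 | h1
    · exact ⟨_, rate_integrable hC ⟨ht.1, h1⟩, fun x hx s hs => (hCb x hx s hs).1⟩
    · exact ⟨_, rate_integrable_one C ht, fun x hx s hs => (hCb x hx s hs).2 h1⟩
  refine intervalIntegral.hasDerivAt_integral_of_dominated_loc_of_deriv_le (bound := bound)
    (F := fun r s => Φ.om j r s * Φ.W w r s) (F' := Φ.dint j w) hn ?_
    (int_integrable h (Ioo_subset_Icc_self hr) ht h1) (measurable_uIoc (dint_continuousOn h hr) ht)
    ?_ hbi ?_
  · filter_upwards [hn] with x hx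
    exact measurable_uIoc (int_continuousOn h (Ioo_subset_Icc_self (hab x hx))) ht
  · filter_upwards [ae_mem_Ioo ht] with s hs hst x hx
    exact hbb x hx s (hs hst)
  · filter_upwards [ae_mem_Ioo ht] with s hs hst x hx
    exact (Φ.om_deriv j x (hab x hx) s (hs hst)).mul (ih x (hab x hx) s (hs hst))

lemma integral_dint (h : Φ.G0 (j :: w)) (hr : r ∈ Ioo (0 : ℝ) 1) (ht : t ∈ Ico (0 : ℝ) 1)
    (hi : IntervalIntegrable (Φ.dint j w r) volume 0 t) :
    ∫ s in (0 : ℝ)..t, Φ.dint j w r s = Φ.G (j :: w) r t := by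
  rw [integral_eq_sub_of_hasDerivAt_of_le ht.1
    ((G_continuousOn h hr).mono fun s hs => ⟨hs.1, hs.2.trans_lt ht.2⟩)
    (f' := Φ.dint j w r)
    (fun s hs => G_hasDerivAt h hr ⟨hs.1, hs.2.trans ht.2⟩) hi, G_zero, sub_zero]

lemma W_hasDerivAt_param : ∀ {w : List ι}, Φ.G0 w → ∀ r ∈ Ioo (0 : ℝ) 1, ∀ t ∈ Ioo (0 : ℝ) 1,
    HasDerivAt (fun r => Φ.W w r t) (Φ.G w r t) r
  | [], _, r, _, t, _ => hasDerivAt_const _ _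
  | j :: w, h, r, hr, t, ht => by
    obtain ⟨hi, hd⟩ := W_hasDerivAt_param_aux h hr (Ioo_subset_Icc_self ht) (Or.inl ht.2)
      (W_hasDerivAt_param h.tail)
    rwa [integral_dint h hr ⟨ht.1.le, ht.2⟩ hi] at hd

lemma ev_W {T : List (ℤ × Bf × ι)} (h : ∀ x ∈ T, Φ.G0 (x.2.2 :: w)) (hr : r ∈ Icc (0 : ℝ) 1)
    (ht : t ∈ Ico (0 : ℝ) 1) :
    IntervalIntegrable (fun s => (ev T r fun k => Φ.om k r s) * Φ.W w r s) volume 0 t ∧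
    (ev T r fun k => Φ.W (k :: w) r t) =
      ∫ s in (0 : ℝ)..t, (ev T r fun k => Φ.om k r s) * Φ.W w r s := by
  have := ev_integral (T := T) (r := r) (t := t) (φ := fun k s => Φ.om k r s * Φ.W w r s)
    fun x hx => int_integrable (h x hx) hr (Ico_subset_Icc_self ht) (Or.inl ht.2)
  simp only [ev_mul_right] at this
  exact ⟨this.1, this.2.symm⟩

lemma hd_eq_cl {i : ι} (h : Φ.G0 (j :: i :: w)) (hr : r ∈ Ioo (0 : ℝ) 1) (ht : t ∈ Ico (0 : ℝ) 1) :
    (ev (Φ.hd j i) r fun k => Φ.W (k :: w) r t) =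
      (ev (Φ.en j) r fun _ => 1) * Φ.W (i :: w) r t +
        ev (Φ.cl j i) r fun k => Φ.W (k :: w) r t := by
  have hr' := Ioo_subset_Icc_self hr
  have hi : ∀ {T : List (ℤ × Bf × ι)}, (Φ.g0 i → ∀ x ∈ T, Φ.g0 x.2.2) →
      ∀ x ∈ T, Φ.G0 (x.2.2 :: w) := by
    intro T hT x hx
    refine h.tail.tail.cons ?_
    rintro rfl
    exact hT (h i rfl) x hx
  obtain ⟨_, e1⟩ := ev_W (hi (Φ.hd_g0 j i)) hr' ht
  obtain ⟨i2, e2⟩ := ev_W (hi (Φ.cl_g0 j i)) hr' ht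
  have i3 := (int_integrable h.tail hr' (Ico_subset_Icc_self ht) (Or.inl ht.2)).const_mul
    (ev (Φ.en j) r fun _ => 1)
  have e3 : Φ.W (i :: w) r t = ∫ s in (0 : ℝ)..t, Φ.om i r s * Φ.W w r s := rfl
  rw [e1, e2, e3, ← intervalIntegral.integral_const_mul, ← intervalIntegral.integral_add i3 i2]
  refine integral_congr_Ioo (fun s hs => ?_) (Ico_subset_Icc_self ht)
  simp only [← Φ.hd_eq j i r hr s hs, ← Φ.cl_eq j i r hr s hs]
  ring

lemma W_tendsto (h0 : Φ.G0 w) (h1 : Φ.G1 w) (hr : r ∈ Icc (0 : ℝ) 1) :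
    Tendsto (Φ.W w r) (𝓝[<] 1) (𝓝 (Φ.W w r 1)) := by
  have := W_continuousOn_one h0 h1 hr 1 (by simp)
  refine this.mono_left ?_
  rw [← nhdsWithin_Ioo_eq_nhdsLT (zero_lt_one' ℝ)]
  exact nhdsWithin_mono _ Ioo_subset_Icc_self

lemma G_tendsto (h0 : Φ.G0 (j :: w)) (h1 : Φ.G1 (j :: w)) (hr : r ∈ Ioo (0 : ℝ) 1) :
    Tendsto (Φ.G (j :: w) r) (𝓝[<] 1) (𝓝 (ev (Φ.Dl (j :: w)) r fun v => Φ.W v r 1)) := by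
  have hr' := Ioo_subset_Icc_self hr
  have hIoo : Ioo (0 : ℝ) 1 ∈ 𝓝[<] 1 := Ioo_mem_nhdsLT zero_lt_one
  have hK := Φ.K_nonneg
  have key : Tendsto (fun t => (Φ.eta j r t - ev (Φ.en j) r fun _ => 1) * Φ.W w r t)
      (𝓝[<] 1) (𝓝 0) := by
    refine squeeze_zero_norm' (a := fun t => Φ.K * ((1 - t) *
      max 1 ((4 * Φ.K) ^ w.length * gauge t))) ?_ ?_
    · filter_upwards [hIoo] with t ht
      have h2 : 0 < 1 - t := by linarith [ht.2]
      rw [norm_mul, ← mul_assoc]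
      gcongr
      · exact Φ.eta_end j r hr t ht
      · by_cases hw : w = []
        · subst hw
          simp [W, It]
        · exact le_max_of_le_right (W_bound h0.tail hw hr' ⟨ht.1.le, ht.2⟩)
    · have e1 : Tendsto (fun t : ℝ => 1 - t) (𝓝[<] 1) (𝓝 0) := by
        have : Continuous fun t : ℝ => 1 - t := by fun_prop
        have := this.tendsto 1
        rw [sub_self] at this
        exact this.mono_left nhdsWithin_le_nhds
      have e2 := one_sub_mul_gauge_tendsto.const_mul ((4 * Φ.K) ^ w.length)
      have e3 := (e1.max e2).const_mul Φ.K
      simp only [mul_zero, max_self] at e3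
      refine e3.congr' ?_
      filter_upwards [hIoo] with t ht
      have h2 : 0 ≤ 1 - t := by linarith [ht.2]
      rw [mul_max_of_nonneg _ _ h2, mul_one, mul_left_comm]
  rcases w with _ | ⟨i, w⟩
  · have e : ev (Φ.Dl [j]) r (fun v => Φ.W v r 1) = 0 + ev (Φ.en j) r fun _ => 1 := by
      rw [Dl, ev_tmap, zero_add]
      rfl
    rw [e]
    refine (key.add_const _).congr fun t => ?_
    simp [W, It, G, Kl]
  · have e : ev (Φ.Dl (j :: i :: w)) r (fun v => Φ.W v r 1) =
        0 + ((ev (Φ.Kl (i :: w)) r fun v => Φ.W (j :: v) r 1) +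
          ev (Φ.hd j i) r fun k => Φ.W (k :: w) r 1) := by
      rw [Dl, ev_append, ev_tmap, ev_tmap, zero_add]
    rw [e]
    have t1 : Tendsto (fun t => ev (Φ.Kl (i :: w)) r fun v => Φ.W (j :: v) r t) (𝓝[<] 1)
        (𝓝 (ev (Φ.Kl (i :: w)) r fun v => Φ.W (j :: v) r 1)) := ev_tendsto fun x hx => by
      obtain ⟨_, h2, h3, _⟩ := Kl_spec x hx
      refine W_tendsto ((h3 h0.tail).cons fun h => absurd h h2) (fun k hk => ?_) hr'
      exact h1 k (by simpa using hk)
    have t2 : Tendsto (fun t => ev (Φ.hd j i) r fun k => Φ.W (k :: w) r t) (𝓝[<] 1)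
        (𝓝 (ev (Φ.hd j i) r fun k => Φ.W (k :: w) r 1)) := ev_tendsto fun x hx => by
      refine W_tendsto (h0.tail.tail.cons ?_) (fun k hk => ?_) hr'
      · rintro rfl
        exact Φ.hd_g0 j i (h0 i rfl) x hx
      · simp only [List.head?_cons, Option.some.injEq] at hk
        subst hk
        exact Φ.hd_g1 j i (h1 j rfl) x hx
    refine (key.add (t1.add t2)).congr' ?_
    filter_upwards [hIoo] with t ht
    rw [hd_eq_cl h0 hr ⟨ht.1.le, ht.2⟩, G, Kl, ev_append, ev_tmap, ev_tmap]
    ring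

/-- The derivative in the parameter of an iterated integral from `0` to `1`. -/
lemma W_one_hasDerivAt (h0 : Φ.G0 (j :: w)) (h1 : Φ.G1 (j :: w)) (hr : r ∈ Ioo (0 : ℝ) 1) :
    HasDerivAt (fun r => Φ.W (j :: w) r 1) (ev (Φ.Dl (j :: w)) r fun v => Φ.W v r 1) r := by
  obtain ⟨hi, hd⟩ := W_hasDerivAt_param_aux h0 hr (right_mem_Icc.2 zero_le_one)
    (Or.inr (h1 j rfl)) (W_hasDerivAt_param h0.tail)
  have hc := continuousOn_primitive_interval' hi left_mem_uIcc
  rw [uIcc_of_le zero_le_one] at hc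
  have ht := (hc 1 (by simp)).mono_left (nhdsWithin_mono 1 Ioo_subset_Icc_self)
  rw [nhdsWithin_Ioo_eq_nhdsLT (zero_lt_one' ℝ)] at ht
  have he : (∫ s in (0 : ℝ)..1, Φ.dint j w r s) = ev (Φ.Dl (j :: w)) r fun v => Φ.W v r 1 := by
    refine tendsto_nhds_unique ht ((G_tendsto h0 h1 hr).congr' ?_)
    filter_upwards [Ioo_mem_nhdsLT (zero_lt_one' ℝ)] with t ht
    refine (integral_dint h0 hr ⟨ht.1.le, ht.2⟩ (hi.mono_set ?_)).symm
    rw [uIcc_of_le zero_le_one, uIcc_of_le ht.1.le]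
    exact Icc_subset_Icc_right ht.2.le
  rwa [he] at hd

lemma W_continuousOn_param : ∀ {w : List ι}, Φ.G0 w → ∀ t ∈ Icc (0 : ℝ) 1, (t < 1 ∨ Φ.G1 w) →
    ContinuousOn (fun r => Φ.W w r t) (Icc 0 1)
  | [], _, _, _, _ => continuousOn_const
  | j :: w, h, t, ht, h1 => by
    have hK := Φ.K_nonneg
    intro r hr
    obtain ⟨bound, hbi, hbb⟩ : ∃ bound : ℝ → ℝ, IntervalIntegrable bound volume 0 t ∧
        ∀ x ∈ Icc (0 : ℝ) 1, ∀ s ∈ Ioo (0 : ℝ) 1, ‖Φ.om j x s * Φ.W w x s‖ ≤ bound s := by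
      rcases h1 with h1 | h1
      · exact ⟨_, rate_integrable (C := Φ.K * (4 * Φ.K) ^ w.length)
          (by positivity) ⟨ht.1, h1⟩,
          fun x hx s hs => by simpa [W] using integrand_bound hK (adm h hx) hs⟩
      · exact ⟨_, rate_integrable_one (2 * Φ.K * (4 * Φ.K) ^ w.length) ht, fun x hx s hs => by
          simpa [W] using integrand_bound_one hK (adm h hx) (Φ.om_le_one j (h1 j rfl) x hx) hs⟩
    refine intervalIntegral.continuousWithinAt_of_dominated_interval (bound := bound)
      (F := fun r s => Φ.om j r s * Φ.W w r s) ?_ ?_ hbi ?_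
    · filter_upwards [self_mem_nhdsWithin] with x hx
      exact measurable_uIoc (int_continuousOn h hx) ht
    · filter_upwards [self_mem_nhdsWithin] with x hx
      filter_upwards [ae_mem_Ioo ht] with s hs hst
      exact hbb x hx s (hs hst)
    · filter_upwards [ae_mem_Ioo ht] with s hs hst
      exact (Φ.om_cont' j s (hs hst) r hr).mul
        (W_continuousOn_param h.tail s (Ioo_subset_Icc_self (hs hst)) (Or.inl (hs hst).2) r hr)

lemma W_eq_zero (k : ι) (hk : ∀ t ∈ Ioo (0 : ℝ) 1, Φ.om k r t = 0) :
    ∀ {w : List ι}, k ∈ w → ∀ t ∈ Icc (0 : ℝ) 1, Φ.W w r t = 0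
  | [], h => by simp at h
  | j :: w, h => fun t ht => by
    have : Φ.W (j :: w) r t = ∫ s in (0 : ℝ)..t, (0 : ℂ) := by
      refine integral_congr_Ioo (fun s hs => ?_) ht
      rcases List.mem_cons.1 h with rfl | h
      · simp [hk s hs]
      · have := W_eq_zero k hk h s (Ioo_subset_Icc_self hs)
        unfold W at this
        simp [this]
    simpa using this

end Fam

namespace Fam
variable {ι : Type} (Φ : Fam ι)

/-- Products of an iterated integral of base forms and a value at parameter `0`. -/
def Sgen (n θ : ℕ) : Set (ℝ → ℂ) :=
  {g | ∃ (u : List Bf) (w : List ι), u ≠ [] ∧ u.getLast? ≠ some .nu ∧ Φ.G0 w ∧ Φ.G1 w ∧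
    u.length + w.length = n ∧
    ((θ ≤ u.count .lam + (w.map Φ.wt).sum ∧ g = fun r => It (u.map bf) r * Φ.W w 0 1) ∨
      g = fun r => 2 * (It (u.map bf) r * Φ.W w 0 1))}

variable {Φ}

lemma Sgen_mono {n θ θ' : ℕ} (h : θ ≤ θ') : Φ.Sgen n θ' ⊆ Φ.Sgen n θ := by
  rintro g ⟨u, w, h1, h2, h3, h4, h5, h6⟩
  exact ⟨u, w, h1, h2, h3, h4, h5, h6.imp_left fun h6 => ⟨h.trans h6.1, h6.2⟩⟩

lemma zsmul_closure_Sgen {n θ θ' : ℕ} {c : ℤ} (h : 2 ∣ c ∨ θ ≤ θ') {g : ℝ → ℂ}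
    (hg : g ∈ AddSubgroup.closure (Φ.Sgen n θ')) : c • g ∈ AddSubgroup.closure (Φ.Sgen n θ) := by
  rcases h with ⟨m, rfl⟩ | h
  · rw [mul_comm, mul_smul]
    refine zsmul_mem ?_ m
    induction hg using AddSubgroup.closure_induction with
    | mem x hx =>
      obtain ⟨u, w, h1, h2, h3, h4, h5, ⟨_, rfl⟩ | rfl⟩ := hx
      · refine AddSubgroup.subset_closure ⟨u, w, h1, h2, h3, h4, h5, Or.inr ?_⟩
        funext r
        simp
      · exact zsmul_mem (AddSubgroup.subset_closure
          (show (fun r => 2 * (It (u.map bf) r * Φ.W w 0 1)) ∈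
          Φ.Sgen n θ from ⟨u, w, h1, h2, h3, h4, h5, Or.inr rfl⟩)) 2
    | zero => simp
    | add x y _ _ hx hy => rw [smul_add]; exact add_mem hx hy
    | neg x _ hx => rw [smul_neg]; exact neg_mem hx
  · exact zsmul_mem (AddSubgroup.closure_mono (Sgen_mono h) hg) c

lemma It_bf_integrable {b : Bf} {u : List Bf} (h : (b :: u).getLast? ≠ some .nu) {t : ℝ}
    (ht : t ∈ Icc (0 : ℝ) 1) :
    IntervalIntegrable (fun s => bf b s * It (u.map bf) s) volume 0 t :=
  It_integrable_one (by norm_num) (adm_bf h) (fun _ hs => bf_le_one hs) ht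

/-- Integration of a single term of the derivative. -/
lemma integral_term {v : List ι} {b : Bf} (h0 : Φ.G0 v) (h1 : Φ.G1 v)
    (hb : b = .nu → ∃ k ∈ v, ∀ t ∈ Ioo (0 : ℝ) 1, Φ.om k 0 t = 0) {g : ℝ → ℂ}
    (hg : g ∈ AddSubgroup.closure (Φ.Sgen v.length (v.map Φ.wt).sum))
    (hW : ∀ r ∈ Icc (0 : ℝ) 1, Φ.W v r 1 = Φ.W v 0 1 + g r) :
    (∀ r ∈ Icc (0 : ℝ) 1, IntervalIntegrable (fun s => bf b s * Φ.W v s 1) volume 0 r) ∧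
    ∃ g' ∈ AddSubgroup.closure (Φ.Sgen (v.length + 1) ([b].count .lam + (v.map Φ.wt).sum)),
      ∀ r ∈ Icc (0 : ℝ) 1, ∫ s in (0 : ℝ)..r, bf b s * Φ.W v s 1 = g' r := by
  have hmem : (fun _ => Φ.W v 0 1) + g ∈ AddSubgroup.closure
      (insert (fun _ => Φ.W v 0 1) (Φ.Sgen v.length (v.map Φ.wt).sum)) :=
    add_mem (AddSubgroup.subset_closure (mem_insert _ _))
      (AddSubgroup.closure_mono (subset_insert _ _) hg)
  have hgen : ∀ x ∈ insert (fun _ => Φ.W v 0 1) (Φ.Sgen v.length (v.map Φ.wt).sum),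
      (∀ t ∈ Icc (0 : ℝ) 1, IntervalIntegrable (fun s => bf b s * x s) volume 0 t) ∧
      ∃ g' ∈ AddSubgroup.closure (Φ.Sgen (v.length + 1) ([b].count .lam + (v.map Φ.wt).sum)),
        ∀ t ∈ Icc (0 : ℝ) 1, ∫ s in (0 : ℝ)..t, bf b s * x s = g' t := by
    rintro x (rfl | ⟨u, w, hu, hu', hw0, hw1, hl, hx⟩)
    · by_cases hb' : b = .nu
      · obtain ⟨k, hk, hk'⟩ := hb hb'
        have := W_eq_zero k hk' hk 1 (by simp)
        simp only [this, mul_zero]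
        exact ⟨fun _ _ => by simp, 0, zero_mem _, by simp⟩
      · have hl : [b].getLast? ≠ some .nu := by simpa using hb'
        refine ⟨fun t ht => ?_, _, AddSubgroup.subset_closure
          ⟨[b], v, by simp, hl, h0, h1, by simp; omega, Or.inl ⟨le_rfl, rfl⟩⟩, fun t _ => ?_⟩
        · have := (It_bf_integrable hl ht).mul_const (Φ.W v 0 1)
          simpa [It] using this
        · simp [It]
    · have hbu : (b :: u).getLast? ≠ some .nu := by
        cases u with
        | nil => exact absurd rfl hu
        | cons c u => rwa [List.getLast?_cons_cons]
      have hlen : (b :: u).length + w.length = v.length + 1 := by simp; omega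
      have hcount : (b :: u).count Bf.lam = [b].count .lam + u.count .lam := by
        rw [← List.count_append]; rfl
      have hint : ∀ t ∈ Icc (0 : ℝ) 1, IntervalIntegrable
          (fun s => bf b s * (It (u.map bf) s * Φ.W w 0 1)) volume 0 t := fun t ht => by
        simpa [mul_assoc] using (It_bf_integrable hbu ht).mul_const (Φ.W w 0 1)
      have heq : ∀ t, ∫ s in (0 : ℝ)..t, bf b s * (It (u.map bf) s * Φ.W w 0 1) =
          It ((b :: u).map bf) t * Φ.W w 0 1 := fun t => by
        simp only [← mul_assoc]
        rw [intervalIntegral.integral_mul_const]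
        rfl
      rcases hx with ⟨hθ, rfl⟩ | rfl
      · exact ⟨hint, _, AddSubgroup.subset_closure ⟨b :: u, w, by simp, hbu, hw0, hw1, hlen,
          Or.inl ⟨by rw [hcount]; omega, rfl⟩⟩, fun t _ => heq t⟩
      · simp only [mul_left_comm (bf b _) 2]
        refine ⟨fun t ht => (hint t ht).const_mul 2, _, AddSubgroup.subset_closure
          ⟨b :: u, w, by simp, hbu, hw0, hw1, hlen, Or.inr rfl⟩, fun t _ => ?_⟩
        rw [intervalIntegral.integral_const_mul, heq]
  obtain ⟨i, g', hg', e⟩ := closure_integral hgen hmem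
  have key : ∀ r ∈ Icc (0 : ℝ) 1, EqOn (fun s => bf b s * Φ.W v s 1)
      (fun s => bf b s * ((fun _ => Φ.W v 0 1 : ℝ → ℂ) + g) s) (uIcc 0 r) := by
    intro r hr s hs
    rw [uIcc_of_le hr.1] at hs
    simp only [Pi.add_apply, hW s ⟨hs.1, hs.2.trans hr.2⟩]
  refine ⟨fun r hr => (i r hr).congr fun s hs => (key r hr (uIoc_subset_uIcc hs)).symm,
    g', hg', fun r hr => ?_⟩
  rw [← e r hr]
  exact intervalIntegral.integral_congr (key r hr)

lemma integral_ev {X : Type} {T : List (ℤ × Bf × X)} {φ : X → ℝ → ℂ} {S : Set (ℝ → ℂ)}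
    (h : ∀ x ∈ T,
      (∀ r ∈ Icc (0 : ℝ) 1, IntervalIntegrable (fun s => bf x.2.1 s * φ x.2.2 s) volume 0 r) ∧
      ∃ g ∈ AddSubgroup.closure S, ∀ r ∈ Icc (0 : ℝ) 1,
        x.1 * ∫ s in (0 : ℝ)..r, bf x.2.1 s * φ x.2.2 s = g r) :
    (∀ r ∈ Icc (0 : ℝ) 1, IntervalIntegrable (fun s => ev T s fun x => φ x s) volume 0 r) ∧
      ∃ g ∈ AddSubgroup.closure S, ∀ r ∈ Icc (0 : ℝ) 1,
        ∫ s in (0 : ℝ)..r, (ev T s fun x => φ x s) = g r := by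
  induction T with
  | nil => exact ⟨by simp, 0, zero_mem _, by simp⟩
  | cons x T ih =>
    obtain ⟨i1, g1, hg1, e1⟩ := ih fun y hy => h y (List.mem_cons_of_mem _ hy)
    obtain ⟨i2, g2, hg2, e2⟩ := h x List.mem_cons_self
    simp only [ev_cons, mul_assoc]
    refine ⟨fun r hr => ((i2 r hr).const_mul _).add (i1 r hr), g2 + g1, add_mem hg2 hg1,
      fun r hr => ?_⟩
    rw [intervalIntegral.integral_add ((i2 r hr).const_mul _) (i1 r hr),
      intervalIntegral.integral_const_mul, e1 r hr, e2 r hr]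
    rfl

/-- Iterated integrals from `0` to `1` of a family, expanded at the parameter `0`. -/
theorem expansion : ∀ (n : ℕ) {w : List ι}, w.length = n → Φ.G0 w → Φ.G1 w →
    ∃ g ∈ AddSubgroup.closure (Φ.Sgen n (w.map Φ.wt).sum),
      ∀ r ∈ Icc (0 : ℝ) 1, Φ.W w r 1 = Φ.W w 0 1 + g r
  | 0, w, hw, _, _ => by
    rw [List.length_eq_zero_iff] at hw
    subst hw
    exact ⟨0, zero_mem _, fun r _ => by simp [W]⟩
  | n + 1, [], hw, _, _ => by simp at hw
  | n + 1, j :: w, hw, h0, h1 => by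
    have hS := Dl_spec h0 h1
    obtain ⟨hi, g, hg, e⟩ := integral_ev (T := Φ.Dl (j :: w)) (φ := fun v s => Φ.W v s 1)
      (S := Φ.Sgen (n + 1) ((j :: w).map Φ.wt).sum) fun x hx => by
        obtain ⟨h2, h3, h4, h5, h6⟩ := hS x hx
        have h2' : x.2.2.length = n := by omega
        obtain ⟨g, hg, hgW⟩ := expansion n h2' h3 h4
        obtain ⟨i, g', hg', e⟩ := integral_term (b := x.2.1) h3 h4 h5 (by rwa [h2']) hgW
        rw [h2'] at hg'
        refine ⟨i, x.1 • g', zsmul_closure_Sgen h6 hg', fun r hr => ?_⟩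
        rw [e r hr]
        simp
    refine ⟨g, hg, fun r hr => ?_⟩
    have hc := W_continuousOn_param h0 1 (by simp) (Or.inr h1)
    have := integral_eq_sub_of_hasDerivAt_of_le hr.1 (hc.mono (Icc_subset_Icc_right hr.2))
      (fun s hs => W_one_hasDerivAt h0 h1 ⟨hs.1, hs.2.trans_le hr.2⟩) (hi r hr)
    rw [e r hr] at this
    rw [this]
    ring

end Fam

instance : Fintype Bf := ⟨{Bf.nu, Bf.lam, Bf.pp}, by intro x; cases x <;> decide⟩

lemma bf_nu (r : ℝ) : bf .nu r = 1 / r := by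
  simp [bf, slot, Pt.sum_univ, bfc, raw, Pt.val]

lemma bf_lam (r : ℝ) : bf .lam r = 1 / (r - Complex.I) - 1 / (r + Complex.I) := by
  simp [bf, slot, Pt.sum_univ, bfc, raw, Pt.val]
  ring

lemma bf_pp (r : ℝ) : bf .pp r = 1 / (r - Complex.I) := by
  simp [bf, slot, Pt.sum_univ, bfc, raw, Pt.val]

/-- The form `1 / (t - J / r)`, which vanishes at `r = 0`. -/
noncomputable def mv (J : ℂ) (r t : ℝ) : ℂ := r / (r * t - J)

/-- The companion of `mv` in the direction of `r`. -/
noncomputable def mve (J : ℂ) (r t : ℝ) : ℂ := t / (r * t - J)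

/-- The mixed derivative of `mv` and `mve`. -/
noncomputable def mvd (J : ℂ) (r t : ℝ) : ℂ := -J / (r * t - J) ^ 2

/-- A unit of the imaginary axis. -/
def Im (J : ℂ) : Prop := ‖J‖ = 1 ∧ ∀ x : ℝ, 1 ≤ ‖(x : ℂ) - J‖

lemma im_I : Im Complex.I := ⟨by simp, one_le_norm_sub_I⟩

lemma im_neg_I : Im (-Complex.I) :=
  ⟨by simp, fun x => by rw [sub_neg_eq_add]; exact one_le_norm_add_I x⟩

section mv
variable {J : ℂ} {r t : ℝ}

lemma Im.ne (hJ : Im J) (x : ℝ) : (x : ℂ) - J ≠ 0 := by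
  intro h
  have := hJ.2 x
  rw [h, norm_zero] at this
  linarith

lemma Im.ne' (hJ : Im J) (r t : ℝ) : (r : ℂ) * t - J ≠ 0 := by
  have := hJ.ne (r * t)
  rwa [Complex.ofReal_mul] at this

lemma Im.le (hJ : Im J) (r t : ℝ) : 1 ≤ ‖(r : ℂ) * t - J‖ := by
  have := hJ.2 (r * t)
  rwa [Complex.ofReal_mul] at this

lemma norm_mv_le (hJ : Im J) (hr : r ∈ Icc (0 : ℝ) 1) : ‖mv J r t‖ ≤ 1 := by
  rw [mv, norm_div, Complex.norm_real, Real.norm_of_nonneg hr.1]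
  exact (div_le_self hr.1 (hJ.le r t)).trans hr.2

lemma norm_mve_le (hJ : Im J) (ht : 0 ≤ t) : ‖mve J r t‖ ≤ t := by
  rw [mve, norm_div, Complex.norm_real, Real.norm_of_nonneg ht]
  exact div_le_self ht (hJ.le r t)

lemma norm_mvd_le (hJ : Im J) : ‖mvd J r t‖ ≤ 1 := by
  rw [mvd, norm_div, norm_neg, hJ.1, norm_pow]
  exact div_le_self zero_le_one (one_le_pow₀ (hJ.le r t))

lemma norm_mve_sub_le (hJ : Im J) (ht : t ≤ 1) : ‖mve J r t - 1 / (r - J)‖ ≤ 1 - t := by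
  have h1 := hJ.ne r
  have h2 := hJ.ne' r t
  have h3 : (t : ℂ) * r - J ≠ 0 := by rwa [mul_comm]
  have e : mve J r t - 1 / (r - J) = J * ((1 - t : ℝ) : ℂ) / ((r * t - J) * (r - J)) := by
    rw [mve]
    push_cast
    field_simp
    ring
  rw [e, norm_div, norm_mul, norm_mul, hJ.1, one_mul, Complex.norm_real,
    Real.norm_of_nonneg (by linarith)]
  refine div_le_self (by linarith) ?_
  have := hJ.le r t
  have := hJ.2 r
  nlinarith

lemma mv_hasDerivAt (hJ : Im J) : HasDerivAt (fun r => mv J r t) (mvd J r t) r := by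
  have h := hJ.ne' r t
  have h1 : HasDerivAt (fun r : ℝ => (r : ℂ)) 1 r := (hasDerivAt_id r).ofReal_comp
  refine (h1.div ((h1.mul_const (t : ℂ)).sub_const J) h).congr_deriv ?_
  rw [mvd]
  field_simp
  ring

lemma mve_hasDerivAt (hJ : Im J) : HasDerivAt (mve J r) (mvd J r t) t := by
  have h := hJ.ne' r t
  have h1 : HasDerivAt (fun r : ℝ => (r : ℂ)) 1 t := (hasDerivAt_id t).ofReal_comp
  refine (h1.div ((h1.const_mul (r : ℂ)).sub_const J) h).congr_deriv ?_
  rw [mvd]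
  field_simp
  ring

lemma mv_continuous (hJ : Im J) : Continuous (mv J r) := by
  unfold mv
  exact Continuous.div (by fun_prop) (by fun_prop) fun t => hJ.ne' r t

lemma mv_continuous' (hJ : Im J) : Continuous fun r => mv J r t := by
  unfold mv
  exact Continuous.div (by fun_prop) (by fun_prop) fun r => hJ.ne' r t

lemma mve_continuous (hJ : Im J) : Continuous (mve J r) := by
  unfold mve
  exact Continuous.div (by fun_prop) (by fun_prop) fun t => hJ.ne' r t

lemma mvd_continuous (hJ : Im J) : Continuous (mvd J r) := by
  unfold mvd
  exact Continuous.div (by fun_prop) (by fun_prop) fun t => pow_ne_zero 2 (hJ.ne' r t)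

end mv

lemma mv_zero (J : ℂ) (t : ℝ) : mv J 0 t = 0 := by simp [mv]

lemma mve_zero (J : ℂ) (r : ℝ) : mve J r 0 = 0 := by simp [mve]

lemma bf_pp_sub_lam (r : ℝ) : bf .pp r - bf .lam r = 1 / (r - -Complex.I) := by
  rw [bf_pp, bf_lam]
  ring

section raw_family

/-- The family of forms deforming the raw ones by moving `i, -i` to infinity. -/
noncomputable def rawOm : Pt → ℝ → ℝ → ℂ
  | .i, r, t => mv Complex.I r t
  | .m, r, t => mv (-Complex.I) r t
  | a, _, t => raw a t

/-- The companion forms of `rawOm`. -/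
noncomputable def rawEta : Pt → ℝ → ℝ → ℂ
  | .i, r, t => mve Complex.I r t
  | .m, r, t => mve (-Complex.I) r t
  | _, _, _ => 0

/-- The mixed derivatives of `rawOm`. -/
noncomputable def rawDeta : Pt → ℝ → ℝ → ℂ
  | .i, r, t => mvd Complex.I r t
  | .m, r, t => mvd (-Complex.I) r t
  | _, _, _ => 0

/-- The commutators of `rawOm`. -/
def rawCl : Pt → Pt → List (ℤ × Bf × Pt)
  | .i, .z => [(-1, .nu, .i)]
  | .z, .i => [(1, .nu, .i)]
  | .m, .z => [(-1, .nu, .m)]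
  | .z, .m => [(1, .nu, .m)]
  | .i, .o => [(-1, .pp, .o), (-1, .nu, .i), (1, .pp, .i)]
  | .o, .i => [(1, .pp, .o), (1, .nu, .i), (-1, .pp, .i)]
  | .m, .o => [(-1, .pp, .o), (1, .lam, .o), (-1, .nu, .m), (1, .pp, .m), (-1, .lam, .m)]
  | .o, .m => [(1, .pp, .o), (-1, .lam, .o), (1, .nu, .m), (-1, .pp, .m), (1, .lam, .m)]
  | .i, .n => [(-1, .pp, .n), (1, .lam, .n), (-1, .nu, .i), (1, .pp, .i), (-1, .lam, .i)]
  | .n, .i => [(1, .pp, .n), (-1, .lam, .n), (1, .nu, .i), (-1, .pp, .i), (1, .lam, .i)]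
  | .m, .n => [(-1, .pp, .n), (-1, .nu, .m), (1, .pp, .m)]
  | .n, .m => [(1, .pp, .n), (1, .nu, .m), (-1, .pp, .m)]
  | _, _ => []

/-- The commutators of `rawOm` at the upper endpoint. -/
def rawHd : Pt → Pt → List (ℤ × Bf × Pt)
  | .i, .z => [(1, .pp, .z), (-1, .nu, .i)]
  | .m, .z => [(1, .pp, .z), (-1, .lam, .z), (-1, .nu, .m)]
  | .i, .o => [(-1, .nu, .i), (1, .pp, .i)]
  | .m, .o => [(-1, .nu, .m), (1, .pp, .m), (-1, .lam, .m)]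
  | .i, .n => [(1, .lam, .n), (-1, .nu, .i), (1, .pp, .i), (-1, .lam, .i)]
  | .m, .n => [(-1, .lam, .n), (-1, .nu, .m), (1, .pp, .m)]
  | .i, .i => [(1, .pp, .i)]
  | .i, .m => [(1, .pp, .m)]
  | .m, .i => [(1, .pp, .i), (-1, .lam, .i)]
  | .m, .m => [(1, .pp, .m), (-1, .lam, .m)]
  | a, b => rawCl a b

/-- The values at the upper endpoint of `rawEta`. -/
def rawEn : Pt → List (ℤ × Bf × Unit)
  | .i => [(1, .pp, ())]
  | .m => [(1, .pp, ()), (-1, .lam, ())]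
  | _ => []

lemma ev_rawEn (r : ℝ) : (ev (rawEn .i) r fun _ => 1) = 1 / (r - Complex.I) ∧
    (ev (rawEn .m) r fun _ => 1) = 1 / (r - -Complex.I) := by
  constructor
  · simp [rawEn, bf_pp]
  · rw [← bf_pp_sub_lam]
    simp [rawEn]
    ring

lemma one_le_inv {t : ℝ} (ht : t ∈ Ioo (0 : ℝ) 1) :
    1 ≤ 1 / (t * (1 - t)) ∧ 1 ≤ 1 / (1 - t) ∧ 1 ≤ 1 / t := by
  have h0 := ht.1
  have h1 : 0 < 1 - t := by linarith [ht.2]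
  refine ⟨?_, ?_, ?_⟩ <;> rw [le_div_iff₀ (by positivity)] <;> nlinarith

lemma raw_cl_eq (j k : Pt) (r : ℝ) (hr : r ∈ Ioo (0 : ℝ) 1) (t : ℝ) (ht : t ∈ Ioo (0 : ℝ) 1) :
    rawOm j r t * rawEta k r t - rawEta j r t * rawOm k r t =
      ev (rawCl j k) r fun x => rawOm x r t := by
  have h1 := ofReal_ne hr
  have h2 := ofReal_ne ht
  have h3 := ofReal_sub_one_ne ht
  have h4 := ofReal_add_one_ne ht
  have h5 := im_I.ne' r t
  have h6 := im_neg_I.ne' r t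
  have h7 := im_I.ne r
  have h8 := im_neg_I.ne r
  generalize hI : Complex.I = J at *
  rw [sub_neg_eq_add] at h6 h8
  have h9 : (t : ℂ) * r - J ≠ 0 := by rwa [mul_comm]
  have h10 : (t : ℂ) * r + J ≠ 0 := by rwa [mul_comm]
  cases j <;> cases k <;>
    simp [rawOm, rawEta, rawCl, bf_nu, bf_pp, bf_lam, mv, mve, raw, Pt.val, hI] <;>
    field_simp <;> ring

lemma raw_hd_eq (j k : Pt) (r : ℝ) (hr : r ∈ Ioo (0 : ℝ) 1) (t : ℝ) (ht : t ∈ Ioo (0 : ℝ) 1) :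
    (ev (rawEn j) r fun _ => 1) * rawOm k r t +
      (rawOm j r t * rawEta k r t - rawEta j r t * rawOm k r t) =
      ev (rawHd j k) r fun x => rawOm x r t := by
  rw [raw_cl_eq j k r hr t ht]
  cases j <;> cases k <;> simp [rawCl, rawEn, rawHd] <;> ring

/-- The family deforming the raw forms. -/
noncomputable def rawFam : Fam Pt where
  om := rawOm
  eta := rawEta
  deta := rawDeta
  g0 j := j ≠ .z
  g1 j := j ≠ .o
  cl := rawCl
  hd := rawHd
  en := rawEn
  wt _ := 0
  K := 1
  K_nonneg := zero_le_one
  om_cont j r hr := by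
    cases j
    · exact raw_continuousOn _
    · exact raw_continuousOn _
    · exact raw_continuousOn _
    · exact (mv_continuous im_I).continuousOn
    · exact (mv_continuous im_neg_I).continuousOn
  om_le j r hr t ht := by
    cases j
    · exact norm_raw_le' ht
    · exact norm_raw_le' ht
    · exact norm_raw_le' ht
    · exact (norm_mv_le im_I hr).trans (one_le_inv ht).1
    · exact (norm_mv_le im_neg_I hr).trans (one_le_inv ht).1
  om_le_zero j hj r hr t ht := by
    cases j
    · exact absurd rfl hj
    · exact (norm_raw_le ht).1 hj
    · exact (norm_raw_le ht).1 hj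
    · exact (norm_mv_le im_I hr).trans (one_le_inv ht).2.1
    · exact (norm_mv_le im_neg_I hr).trans (one_le_inv ht).2.1
  om_le_one j hj r hr t ht := by
    cases j
    · exact (norm_raw_le ht).2 hj
    · exact absurd rfl hj
    · exact (norm_raw_le ht).2 hj
    · exact (norm_mv_le im_I hr).trans (one_le_inv ht).2.2
    · exact (norm_mv_le im_neg_I hr).trans (one_le_inv ht).2.2
  om_cont' j t ht := by
    cases j
    · exact continuousOn_const
    · exact continuousOn_const
    · exact continuousOn_const
    · exact (mv_continuous' im_I).continuousOn
    · exact (mv_continuous' im_neg_I).continuousOn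
  om_deriv j r hr t ht := by
    cases j
    · exact hasDerivAt_const _ _
    · exact hasDerivAt_const _ _
    · exact hasDerivAt_const _ _
    · exact mv_hasDerivAt im_I
    · exact mv_hasDerivAt im_neg_I
  eta_deriv j r hr t ht := by
    cases j
    · exact hasDerivAt_const _ _
    · exact hasDerivAt_const _ _
    · exact hasDerivAt_const _ _
    · exact mve_hasDerivAt im_I
    · exact mve_hasDerivAt im_neg_I
  eta_cont j r hr := by
    cases j
    · exact continuousOn_const
    · exact continuousOn_const
    · exact continuousOn_const
    · exact (mve_continuous im_I).continuousOn
    · exact (mve_continuous im_neg_I).continuousOn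
  deta_cont j r hr := by
    cases j
    · exact continuousOn_const
    · exact continuousOn_const
    · exact continuousOn_const
    · exact (mvd_continuous im_I).continuousOn
    · exact (mvd_continuous im_neg_I).continuousOn
  eta_zero j r := by cases j <;> simp [rawEta, mve_zero]
  eta_le j r hr t ht := by
    rw [one_mul]
    have h0 := ht.1.le
    cases j
    · simpa [rawEta] using h0
    · simpa [rawEta] using h0
    · simpa [rawEta] using h0
    · exact norm_mve_le im_I h0
    · exact norm_mve_le im_neg_I h0
  deta_le j r hr t ht := by
    cases j
    · simp [rawDeta]
    · simp [rawDeta]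
    · simp [rawDeta]
    · exact norm_mvd_le im_I
    · exact norm_mvd_le im_neg_I
  eta_end j r hr t ht := by
    rw [one_mul]
    cases j
    · simpa [rawEta, rawEn] using ht.2.le
    · simpa [rawEta, rawEn] using ht.2.le
    · simpa [rawEta, rawEn] using ht.2.le
    · rw [(ev_rawEn r).1]
      exact norm_mve_sub_le im_I ht.2.le
    · rw [(ev_rawEn r).2]
      exact norm_mve_sub_le im_neg_I ht.2.le
  cl_eq := raw_cl_eq
  hd_eq := raw_hd_eq
  cl_g0 := by decide
  hd_g0 := by decide
  hd_g1 := by decide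
  en_ne := by decide
  cl_nu j k x hx h t ht := by
    have : x.2.2 = .i ∨ x.2.2 = .m := by
      revert j k x
      decide
    rcases this with h | h <;> rw [h] <;> exact mv_zero _ _
  hd_nu j k x hx h t ht := by
    have : x.2.2 = .i ∨ x.2.2 = .m := by
      revert j k x
      decide
    rcases this with h | h <;> rw [h] <;> exact mv_zero _ _
  cl_wt _ _ _ _ := Or.inr (Nat.zero_le _)
  hd_wt _ _ _ _ := Or.inr (Nat.zero_le _)
  en_wt _ _ _ := Or.inr (Nat.zero_le _)

end raw_family

section dual_family

/-- The family of forms deforming the pullbacks of the base forms under `t ↦ (1 - t) / (1 + t)`. -/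
noncomputable def dualOm : Bf → ℝ → ℝ → ℂ
  | .nu, _, t => raw .n t - raw .o t
  | .lam, r, t => mv Complex.I r t - mv (-Complex.I) r t
  | .pp, r, t => raw .n t - mv (-Complex.I) r t

/-- The companion forms of `dualOm`. -/
noncomputable def dualEta : Bf → ℝ → ℝ → ℂ
  | .nu, _, _ => 0
  | .lam, r, t => mve Complex.I r t - mve (-Complex.I) r t
  | .pp, r, t => -mve (-Complex.I) r t

/-- The mixed derivatives of `dualOm`. -/
noncomputable def dualDeta : Bf → ℝ → ℝ → ℂ
  | .nu, _, _ => 0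
  | .lam, r, t => mvd Complex.I r t - mvd (-Complex.I) r t
  | .pp, r, t => -mvd (-Complex.I) r t

/-- The commutators of `dualOm`. -/
def dualCl : Bf → Bf → List (ℤ × Bf × Bf)
  | .lam, .nu => [(-1, .lam, .nu), (-1, .lam, .lam), (2, .lam, .pp)]
  | .nu, .lam => [(1, .lam, .nu), (1, .lam, .lam), (-2, .lam, .pp)]
  | .lam, .pp => [(-1, .nu, .lam), (1, .pp, .lam), (-1, .lam, .lam), (1, .lam, .pp)]
  | .pp, .lam => [(1, .nu, .lam), (-1, .pp, .lam), (1, .lam, .lam), (-1, .lam, .pp)]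
  | .pp, .nu => [(-1, .lam, .nu), (1, .pp, .nu), (1, .lam, .pp)]
  | .nu, .pp => [(1, .lam, .nu), (-1, .pp, .nu), (-1, .lam, .pp)]
  | _, _ => []

/-- The commutators of `dualOm` at the upper endpoint. -/
def dualHd : Bf → Bf → List (ℤ × Bf × Bf)
  | .lam, .nu => [(-1, .lam, .lam), (2, .lam, .pp)]
  | .lam, .lam => [(1, .lam, .lam)]
  | .lam, .pp => [(-1, .nu, .lam), (1, .pp, .lam), (-1, .lam, .lam), (2, .lam, .pp)]
  | .pp, .lam => [(2, .lam, .lam), (-2, .pp, .lam), (1, .nu, .lam), (-1, .lam, .pp)]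
  | .pp, .nu => [(1, .lam, .pp)]
  | .pp, .pp => [(1, .lam, .pp), (-1, .pp, .pp)]
  | a, b => dualCl a b

/-- The values at the upper endpoint of `dualEta`. -/
def dualEn : Bf → List (ℤ × Bf × Unit)
  | .nu => []
  | .lam => [(1, .lam, ())]
  | .pp => [(1, .lam, ()), (-1, .pp, ())]

lemma ev_dualEn (r : ℝ) :
    (ev (dualEn .lam) r fun _ => 1) = 1 / (r - Complex.I) - 1 / (r - -Complex.I) ∧
    (ev (dualEn .pp) r fun _ => 1) = -(1 / (r - -Complex.I)) := by
  constructor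
  · simp [dualEn, bf_lam]
  · rw [← bf_pp_sub_lam]
    simp [dualEn]
    ring

lemma dual_cl_eq (j k : Bf) (r : ℝ) (hr : r ∈ Ioo (0 : ℝ) 1) (t : ℝ) (ht : t ∈ Ioo (0 : ℝ) 1) :
    dualOm j r t * dualEta k r t - dualEta j r t * dualOm k r t =
      ev (dualCl j k) r fun x => dualOm x r t := by
  have h1 := ofReal_ne hr
  have h2 := ofReal_ne ht
  have h3 := ofReal_sub_one_ne ht
  have h4 := ofReal_add_one_ne ht
  have h5 := im_I.ne' r t
  have h6 := im_neg_I.ne' r t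
  have h7 := im_I.ne r
  have h8 := im_neg_I.ne r
  generalize hI : Complex.I = J at *
  rw [sub_neg_eq_add] at h6 h8
  have h9 : (t : ℂ) * r - J ≠ 0 := by rwa [mul_comm]
  have h10 : (t : ℂ) * r + J ≠ 0 := by rwa [mul_comm]
  cases j <;> cases k <;>
    simp [dualOm, dualEta, dualCl, bf_nu, bf_pp, bf_lam, mv, mve, raw, Pt.val, hI] <;>
    field_simp <;> ring

lemma dual_hd_eq (j k : Bf) (r : ℝ) (hr : r ∈ Ioo (0 : ℝ) 1) (t : ℝ) (ht : t ∈ Ioo (0 : ℝ) 1) :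
    (ev (dualEn j) r fun _ => 1) * dualOm k r t +
      (dualOm j r t * dualEta k r t - dualEta j r t * dualOm k r t) =
      ev (dualHd j k) r fun x => dualOm x r t := by
  rw [dual_cl_eq j k r hr t ht]
  cases j <;> cases k <;> simp [dualCl, dualEn, dualHd] <;> ring

lemma div_two {x : ℂ} {y : ℝ} (h : ‖x‖ ≤ 1 / y) {z : ℂ} (h' : ‖z‖ ≤ 1 / y) : ‖x - z‖ ≤ 2 / y := by
  refine (norm_sub_le _ _).trans ((add_le_add h h').trans_eq ?_)
  ring

/-- The family deforming the pullbacks of the base forms. -/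
noncomputable def dualFam : Fam Bf where
  om := dualOm
  eta := dualEta
  deta := dualDeta
  g0 _ := True
  g1 j := j ≠ .nu
  cl := dualCl
  hd := dualHd
  en := dualEn
  wt j := if j = .pp then 0 else 1
  K := 2
  K_nonneg := zero_le_two
  om_cont j r hr := by
    cases j
    · exact (raw_continuousOn _).sub (raw_continuousOn _)
    · exact ((mv_continuous im_I).sub (mv_continuous im_neg_I)).continuousOn
    · exact (raw_continuousOn _).sub (mv_continuous im_neg_I).continuousOn
  om_le j r hr t ht := by
    have h := fun J hJ => (norm_mv_le (J := J) (t := t) hJ hr).trans (one_le_inv ht).1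
    cases j
    · exact div_two (norm_raw_le' ht) (norm_raw_le' ht)
    · exact div_two (h _ im_I) (h _ im_neg_I)
    · exact div_two (norm_raw_le' ht) (h _ im_neg_I)
  om_le_zero j hj r hr t ht := by
    have h := fun J hJ => (norm_mv_le (J := J) (t := t) hJ hr).trans (one_le_inv ht).2.1
    cases j
    · exact div_two ((norm_raw_le ht).1 (by decide)) ((norm_raw_le ht).1 (by decide))
    · exact div_two (h _ im_I) (h _ im_neg_I)
    · exact div_two ((norm_raw_le ht).1 (by decide)) (h _ im_neg_I)
  om_le_one j hj r hr t ht := by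
    have h := fun J hJ => (norm_mv_le (J := J) (t := t) hJ hr).trans (one_le_inv ht).2.2
    cases j
    · exact absurd rfl hj
    · exact div_two (h _ im_I) (h _ im_neg_I)
    · exact div_two ((norm_raw_le ht).2 (by decide)) (h _ im_neg_I)
  om_cont' j t ht := by
    cases j
    · exact continuousOn_const
    · exact ((mv_continuous' im_I).sub (mv_continuous' im_neg_I)).continuousOn
    · exact (continuous_const.sub (mv_continuous' im_neg_I)).continuousOn
  om_deriv j r hr t ht := by
    cases j
    · exact hasDerivAt_const _ _
    · exact (mv_hasDerivAt im_I).sub (mv_hasDerivAt im_neg_I)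
    · exact (mv_hasDerivAt im_neg_I).const_sub _
  eta_deriv j r hr t ht := by
    cases j
    · exact hasDerivAt_const _ _
    · exact (mve_hasDerivAt im_I).sub (mve_hasDerivAt im_neg_I)
    · exact (mve_hasDerivAt im_neg_I).neg
  eta_cont j r hr := by
    cases j
    · exact continuousOn_const
    · exact ((mve_continuous im_I).sub (mve_continuous im_neg_I)).continuousOn
    · exact (mve_continuous im_neg_I).neg.continuousOn
  deta_cont j r hr := by
    cases j
    · exact continuousOn_const
    · exact ((mvd_continuous im_I).sub (mvd_continuous im_neg_I)).continuousOn
    · exact (mvd_continuous im_neg_I).neg.continuousOn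
  eta_zero j r := by cases j <;> simp [dualEta, mve_zero]
  eta_le j r hr t ht := by
    have h0 := ht.1.le
    have h := norm_mve_le im_I (r := r) h0
    have h' := norm_mve_le im_neg_I (r := r) h0
    cases j
    · simpa [dualEta] using h0
    · exact (norm_sub_le _ _).trans (by linarith)
    · exact (norm_neg _).trans_le (by linarith)
  deta_le j r hr t ht := by
    have h := norm_mvd_le im_I (r := r) (t := t)
    have h' := norm_mvd_le im_neg_I (r := r) (t := t)
    cases j
    · simp [dualDeta]
    · exact (norm_sub_le _ _).trans (by linarith)
    · exact (norm_neg _).trans_le (by linarith)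
  eta_end j r hr t ht := by
    have h0 := ht.2.le
    have h := norm_mve_sub_le im_I (r := r) h0
    have h' := norm_mve_sub_le im_neg_I (r := r) h0
    cases j
    · simpa [dualEta, dualEn] using h0
    · rw [(ev_dualEn r).1, dualEta, sub_sub_sub_comm]
      exact (norm_sub_le _ _).trans (by linarith)
    · rw [(ev_dualEn r).2, dualEta, ← neg_sub', norm_neg]
      linarith
  cl_eq := dual_cl_eq
  hd_eq := dual_hd_eq
  cl_g0 := by decide
  hd_g0 := by decide
  hd_g1 := by decide
  en_ne := by decide
  cl_nu j k x hx h t ht := by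
    have : x.2.2 = .lam := by
      revert j k x
      decide
    rw [this]
    simp [dualOm, mv_zero]
  hd_nu j k x hx h t ht := by
    have : x.2.2 = .lam := by
      revert j k x
      decide
    rw [this]
    simp [dualOm, mv_zero]
  cl_wt := by decide
  hd_wt := by decide
  en_wt := by decide

end dual_family

lemma It_bf_mem_Nval {u : List Bf} (h : u.getLast? ≠ some .nu) :
    It (u.map bf) 1 ∈ Nval univ u.length := by
  have h1 := slots_mem (S := univ) (L := u.map bfc) (by simp) ?_ ?_
  · rw [List.length_map, List.map_map] at h1
    exact h1
  · intro c hc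
    rw [List.getLast?_map] at hc
    obtain ⟨b, hb, rfl⟩ := Option.map_eq_some_iff.1 hc
    cases b
    · exact absurd hb h
    · rfl
    · rfl
  · intro c hc
    rw [List.head?_map] at hc
    obtain ⟨b, hb, rfl⟩ := Option.map_eq_some_iff.1 hc
    cases b <;> rfl

lemma Fam.W_one_mem {ι : Type} {Φ : Fam ι} {n : ℕ}
    (hW : ∀ w, Φ.G0 w → Φ.G1 w → Φ.W w 0 1 ∈ Nval {.z, .o, .n} w.length)
    (ih : ∀ k, 0 < k → k < n → Nval univ k ≤ (V k).toAddSubgroup)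
    {w : List ι} (hw : w.length = n) (h0 : Φ.G0 w) (h1 : Φ.G1 w)
    (hJ : ∀ u : List Bf, u.length = n → u.getLast? ≠ some .nu →
      (w.map Φ.wt).sum ≤ u.count .lam → It (u.map bf) 1 ∈ Pn n) :
    Φ.W w 1 1 ∈ Pn n := by
  obtain ⟨g, hg, e⟩ := Fam.expansion n hw h0 h1
  rw [e 1 (by simp)]
  refine add_mem (Nval_zon_le n (hw ▸ hW w h0 h1)) ?_
  have hmap : AddSubgroup.closure (Φ.Sgen n (w.map Φ.wt).sum) ≤
      (Pn n).comap (Pi.evalAddMonoidHom (fun _ : ℝ => ℂ) 1) := (AddSubgroup.closure_le _).2 ?_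
  · exact hmap hg
  rintro g ⟨u, v, hu, hul, hv0, hv1, hl, hg⟩
  change g 1 ∈ Pn n
  have hu' : 0 < u.length := List.length_pos_iff.2 hu
  rcases eq_or_ne v [] with rfl | hv
  · have e1 : Φ.W [] 0 1 = 1 := rfl
    simp only [List.length_nil, add_zero] at hl
    rcases hg with ⟨hθ, rfl⟩ | rfl
    · simpa [e1] using hJ u hl hul (by simpa using hθ)
    · simpa [e1] using two_mul_mem_Pn (hl ▸ It_bf_mem_Nval hul)
  · have hv' : 0 < v.length := List.length_pos_iff.2 hv
    have h2 := ih _ hu' (by omega) (It_bf_mem_Nval hul)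
    have h3 := ih _ hv' (by omega) (Nval_mono (subset_univ _) _ (hW v hv0 hv1))
    have h4 : It (u.map bf) 1 * Φ.W v 0 1 ∈ V n := hl ▸ V_mul h2 h3
    rcases hg with ⟨-, rfl⟩ | rfl
    · exact V_le_Pn h4
    · refine V_le_Pn ?_
      simpa [two_mul] using add_mem h4 h4

/-- The coefficients of `dualOm` at parameter `0`. -/
def dualc : Bf → Pt → ℤ
  | .nu, .n => 1
  | .nu, .o => -1
  | .pp, .n => 1
  | _, _ => 0

lemma dualFam_zero_mem (w : List Bf) (h : dualFam.G1 w) :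
    dualFam.W w 0 1 ∈ Nval {.z, .o, .n} w.length := by
  have h1 := slots_mem (S := {.z, .o, .n}) (L := w.map dualc) ?_ ?_ ?_
  · have : (fun b => slot (dualc b)) = fun b => dualFam.om b 0 := by
      funext b t
      cases b <;> simp [slot, Pt.sum_univ, dualc, dualFam, dualOm, mv_zero]
      ring
    rw [List.length_map, List.map_map] at h1
    unfold Fam.W
    rwa [← this]
  · intro c hc a ha
    obtain ⟨b, -, rfl⟩ := List.mem_map.1 hc
    cases b <;> cases a <;> first | rfl | exact absurd (by simp) ha
  · intro c hc
    rw [List.getLast?_map] at hc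
    obtain ⟨b, hb, rfl⟩ := Option.map_eq_some_iff.1 hc
    cases b <;> rfl
  · intro c hc
    rw [List.head?_map] at hc
    obtain ⟨b, hb, rfl⟩ := Option.map_eq_some_iff.1 hc
    cases b
    · exact absurd rfl (h _ hb)
    · rfl
    · rfl

/-- The coefficients of `rawOm` at parameter `0`. -/
def rawc : Pt → Pt → ℤ
  | .z, .z => 1
  | .o, .o => 1
  | .n, .n => 1
  | _, _ => 0

lemma rawFam_zero_mem (w : List Pt) (h0 : rawFam.G0 w) (h : rawFam.G1 w) :
    rawFam.W w 0 1 ∈ Nval {.z, .o, .n} w.length := by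
  have h1 := slots_mem (S := {.z, .o, .n}) (L := w.map rawc) ?_ ?_ ?_
  · have : (fun b => slot (rawc b)) = fun b => rawFam.om b 0 := by
      funext b t
      cases b <;> simp [slot, Pt.sum_univ, rawc, rawFam, rawOm, mv_zero]
    rw [List.length_map, List.map_map] at h1
    unfold Fam.W
    rwa [← this]
  · intro c hc a ha
    obtain ⟨b, -, rfl⟩ := List.mem_map.1 hc
    cases b <;> cases a <;> first | rfl | exact absurd (by simp) ha
  · intro c hc
    rw [List.getLast?_map] at hc
    obtain ⟨b, hb, rfl⟩ := Option.map_eq_some_iff.1 hc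
    have := h0 _ hb
    cases b <;> first | rfl | exact absurd rfl this
  · intro c hc
    rw [List.head?_map] at hc
    obtain ⟨b, hb, rfl⟩ := Option.map_eq_some_iff.1 hc
    have := h _ hb
    cases b <;> first | rfl | exact absurd rfl this

lemma pull_inv {J : ℂ} (hJ : J ^ 2 = -1) {t : ℝ} (ht : t ∈ Ioo (0 : ℝ) 1) (h : (t : ℂ) + J ≠ 0) :
    1 / ((invo t : ℂ) - J) * (2 / (1 + (t : ℂ)) ^ 2) = 1 / (t + 1) - 1 / (t + J) := by
  have h1 := ofReal_add_one_ne ht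
  have h2 : 1 + J ≠ 0 := by
    intro h
    rw [eq_neg_of_add_eq_zero_right h] at hJ
    norm_num at hJ
  have e : (invo t : ℂ) - J = -((1 + J) * (t + J)) / (t + 1) := by
    rw [one_add_invo ht]
    field_simp
    linear_combination hJ
  have e2 : (2 : ℂ) = (1 + J) * (1 - J) := by linear_combination hJ
  rw [e, e2, add_comm (1 : ℂ) t]
  field_simp
  ring

lemma pull_bf (b : Bf) : EqOn (pull (bf b)) (dualOm b 1) (Ioo 0 1) := by
  intro t ht
  have h5 := im_I.ne t
  have h6 := im_neg_I.ne t
  rw [sub_neg_eq_add] at h6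
  have h1 := pull_inv Complex.I_sq ht h6
  have h2 := pull_inv (J := -Complex.I) (by simp) ht h5
  rw [sub_neg_eq_add, ← sub_eq_add_neg] at h2
  cases b
  · have h2 := ofReal_ne ht
    have h3 := ofReal_sub_one_ne ht
    have h4 := ofReal_add_one_ne ht
    have h5 : 1 - (t : ℂ) ≠ 0 := by rwa [← neg_sub, neg_ne_zero]
    have e : (invo t : ℂ) = -(t - 1) / (t + 1) := by
      rw [one_add_invo ht]
      field_simp
      ring
    rw [pull, bf_nu, e, add_comm (1 : ℂ) t]
    simp [dualOm, raw, Pt.val]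
    field_simp
    ring
  · rw [pull, bf_lam, sub_mul, h1, h2]
    simp [dualOm, mv]
  · rw [pull, bf_pp, h1]
    simp [dualOm, mv, raw, Pt.val]

lemma It_bf_reverse {u : List Bf} (h : u.getLast? ≠ some .nu) :
    It (u.map bf) 1 = dualFam.W u.reverse 1 1 := by
  have hr : (1 : ℝ) ∈ Icc (0 : ℝ) 1 := by simp
  have e : ∀ b, EqOn (pull (bf b)) (dualFam.om b 1) (Ioo 0 1) := pull_bf
  rw [It_reverse (K := 2) zero_le_two (adm_bf h), ← List.map_reverse, ← List.map_reverse,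
    List.map_map]
  · exact It_map_congr _ (fun b _ => e b) (by simp)
  · intro f hf s hs
    rw [List.head?_map] at hf
    obtain ⟨b, hb, rfl⟩ := Option.map_eq_some_iff.1 hf
    exact bf_le_one hs
  · rw [List.map_map, ← List.map_reverse]
    refine adm_of (fun b _ => ⟨(dualFam.om_cont b 1 hr).congr (e b), fun s hs => ?_⟩)
      fun b _ s hs => ?_
    · rw [Function.comp_apply, e b hs]
      exact dualFam.om_le b 1 hr s hs
    · rw [Function.comp_apply, e b hs]
      exact dualFam.om_le_zero b trivial 1 hr s hs
  · intro f hf s hs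
    rw [List.getLast?_map] at hf
    obtain ⟨b, hb, rfl⟩ := Option.map_eq_some_iff.1 hf
    rw [e b hs]
    exact dualFam.om_le_one b (by rintro rfl; exact h hb) 1 hr s hs

lemma sum_wt (u : List Bf) : (u.map dualFam.wt).sum = u.count .lam + u.count .nu := by
  induction u with
  | nil => rfl
  | cons b u ih =>
    rw [List.map_cons, List.sum_cons, ih]
    cases b <;> simp [dualFam] <;> omega

/-- The values of words of base forms are congruent modulo `2` to values of regular words. -/
lemma It_bf_mem_Pn {n : ℕ} (ih : ∀ k, 0 < k → k < n → Nval univ k ≤ (V k).toAddSubgroup) :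
    ∀ (d : ℕ) {u : List Bf}, n ≤ u.count .lam + d → u.length = n → u.getLast? ≠ some .nu →
      It (u.map bf) 1 ∈ Pn n
  | d, u, hd, hn, h => by
    by_cases hnu : Bf.nu ∈ u
    · have hc : 0 < u.count .nu := List.count_pos_iff.2 hnu
      rw [It_bf_reverse h]
      have h1 : dualFam.G1 u.reverse := by
        intro b hb
        rw [List.head?_reverse] at hb
        rintro rfl
        exact h hb
      refine Fam.W_one_mem (fun w _ hw => dualFam_zero_mem w hw) ih (by simpa using hn)
        (fun _ _ => trivial) h1 fun v hv hv' hθ => ?_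
      have hs : (u.reverse.map dualFam.wt).sum = u.count .lam + u.count .nu := by
        rw [sum_wt, List.count_reverse, List.count_reverse]
      rw [hs] at hθ
      cases d with
      | zero =>
        have := List.count_le_length (a := Bf.lam) (l := v)
        omega
      | succ d => exact It_bf_mem_Pn ih d (by omega) hv hv'
    · refine V_le_Pn (Nval_reg_le _ ?_)
      have h1 := slots_mem (S := Sreg) (L := u.map bfc) ?_ ?_ ?_
      · rw [List.length_map, List.map_map, hn] at h1
        exact h1
      · intro c hc a ha
        obtain ⟨b, hb, rfl⟩ := List.mem_map.1 hc
        have : b ≠ .nu := by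
          rintro rfl
          exact hnu hb
        cases b <;> cases a <;> first | rfl | exact absurd rfl this | exact absurd (Or.inl rfl) ha |
          exact absurd (Or.inr rfl) ha
      · intro c hc
        rw [List.getLast?_map] at hc
        obtain ⟨b, hb, rfl⟩ := Option.map_eq_some_iff.1 hc
        cases b
        · exact absurd hb h
        · rfl
        · rfl
      · intro c hc
        rw [List.head?_map] at hc
        obtain ⟨b, hb, rfl⟩ := Option.map_eq_some_iff.1 hc
        cases b <;> rfl

lemma Nval_le_Pn {n : ℕ} (ih : ∀ k, 0 < k → k < n → Nval univ k ≤ (V k).toAddSubgroup) :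
    Nval univ n ≤ Pn n := by
  refine (AddSubgroup.closure_le _).2 ?_
  rintro _ ⟨l, hl, -, h0, h1, rfl⟩
  have e : It (l.map raw) 1 = rawFam.W l 1 1 := by
    have : raw = fun a => rawFam.om a 1 := by
      funext a t
      cases a <;> simp [rawFam, rawOm, mv, raw, Pt.val]
    rw [Fam.W, this]
  rw [e]
  refine Fam.W_one_mem rawFam_zero_mem ih hl ?_ ?_ fun u hu hu' _ =>
    It_bf_mem_Pn ih n (by omega) hu hu'
  · rintro j hj rfl
    exact h0 hj
  · rintro j hj rfl
    exact h1 hj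

lemma valGen_finite (n : ℕ) : (valGen univ n).Finite := by
  refine (Set.Finite.image (fun l : List Pt => It (l.map raw) 1)
    (List.finite_length_eq Pt n)).subset ?_
  rintro _ ⟨l, hl, -, -, -, rfl⟩
  exact ⟨l, hl, rfl⟩

/-- Integral combinations of values of raw words are rational combinations of regular ones. -/
theorem Nval_le_V (n : ℕ) (hn : 0 < n) : Nval univ n ≤ (V n).toAddSubgroup := by
  induction n using Nat.strong_induction_on with
  | _ n ih =>
    have h := Nval_le_Pn fun k hk hkn => ih k hkn hk
    intro x hx
    set q : ℂ →ₗ[ℤ] ℂ ⧸ V n := (V n).mkQ.restrictScalars ℤ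
    set N := (Submodule.span ℤ (valGen univ n)).map q
    have hN : ∀ y ∈ Nval univ n, q y ∈ N := by
      intro y hy
      refine Submodule.mem_map_of_mem ?_
      rw [← Submodule.mem_toAddSubgroup, Submodule.span_int_eq_addSubgroupClosure]
      exact hy
    have hV : ∀ y ∈ V n, q y = 0 := fun y hy => (Submodule.Quotient.mk_eq_zero _).2 hy
    have hle : N ≤ Ideal.span {(2 : ℤ)} • N := by
      refine Submodule.map_le_iff_le_comap.2 (Submodule.span_le.2 fun y hy => ?_)
      obtain ⟨a, ha, b, hb, rfl⟩ := AddSubgroup.mem_sup.1 (h (AddSubgroup.subset_closure hy))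
      obtain ⟨c, hc, rfl⟩ := hb
      change q (a + 2 * c) ∈ Ideal.span {(2 : ℤ)} • N
      have e : (2 : ℂ) * c = (2 : ℤ) • c := by simp
      rw [map_add, hV a ha, zero_add, e, map_smul]
      exact Submodule.smul_mem_smul (Ideal.mem_span_singleton_self 2) (hN c hc)
    obtain ⟨r, hr, hr0⟩ := Submodule.exists_sub_one_mem_and_smul_eq_zero_of_fg_of_le_smul _ N
      ((Submodule.fg_span (valGen_finite n)).map q) hle
    have h1 : q (r • x) = 0 := by
      rw [map_smul]
      exact hr0 _ (hN x hx)
    have h2 : (r : ℚ) • x ∈ V n := by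
      rw [Int.cast_smul_eq_zsmul]
      exact (Submodule.Quotient.mk_eq_zero _).1 h1
    have h3 : (r : ℚ) ≠ 0 := by
      rintro h3
      rw [Int.cast_eq_zero] at h3
      rw [h3, Ideal.mem_span_singleton] at hr
      omega
    exact ((V n).smul_mem_iff h3).1 h2

section series

lemma hasSum_primitive {a : ℕ → ℂ} {f : ℝ → ℂ}
    (h : ∀ t ∈ Ioo (0 : ℝ) 1, HasSum (fun k => a k * (t : ℂ) ^ k) (f t)) {t : ℝ}
    (ht : t ∈ Ico (0 : ℝ) 1) :
    HasSum (fun k : ℕ => a k * ((t : ℂ) ^ (k + 1) / (k + 1))) (∫ s in (0 : ℝ)..t, f s) := by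
  rcases ht.1.eq_or_lt with rfl | h0
  · simp [hasSum_zero]
  have hs : Summable fun k => ‖a k‖ * t ^ k := by
    have := (h t ⟨h0, ht.2⟩).summable.norm
    simpa [abs_of_pos h0] using this
  have e : ∀ k : ℕ, ∫ s in (0 : ℝ)..t, a k * (s : ℂ) ^ k = a k * ((t : ℂ) ^ (k + 1) / (k + 1)) := by
    intro k
    have := integral_pow (a := 0) (b := t) k
    rw [intervalIntegral.integral_const_mul]
    congr 1
    calc ∫ s in (0 : ℝ)..t, (s : ℂ) ^ k = ∫ s in (0 : ℝ)..t, ((s ^ k : ℝ) : ℂ) := by push_cast; rfl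
      _ = _ := by
        rw [intervalIntegral.integral_ofReal, integral_pow]
        push_cast
        simp
  simp only [← e]
  refine intervalIntegral.hasSum_integral_of_dominated_convergence (fun k _ => ‖a k‖ * t ^ k)
    (fun k => ?_) (fun k => ?_) ?_ ?_ ?_
  · exact Continuous.aestronglyMeasurable (by fun_prop)
  · refine Eventually.of_forall fun s hs => ?_
    rw [uIoc_of_le h0.le] at hs
    have h1 := hs.1.le
    rw [norm_mul, norm_pow, Complex.norm_real, Real.norm_of_nonneg h1]
    gcongr
    exact hs.2
  · exact Eventually.of_forall fun _ _ => hs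
  · exact intervalIntegrable_const
  · refine Eventually.of_forall fun s hs => ?_
    rw [uIoc_of_le h0.le] at hs
    exact h s ⟨hs.1, hs.2.trans_lt ht.2⟩

/-- The coefficients of the power series attached to an index list. -/
noncomputable def coef : List (ℕ × ℂ) → ℕ → ℂ
  | [], k => if k = 0 then 1 else 0
  | (s, z) :: l, k => z ^ k / (k : ℂ) ^ s * mpvPartial l k

lemma coef_zero {q : ℕ × ℂ} (l : List (ℕ × ℂ)) (h : 0 < q.1) : coef (q :: l) 0 = 0 := by
  simp [coef, h.ne']

lemma sum_coef {l : List (ℕ × ℂ)} (h : ∀ q ∈ l, 0 < q.1) {m : ℕ} (hm : 0 < m) :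
    ∑ k ∈ Finset.range m, coef l k = mpvPartial l m := by
  cases l with
  | nil =>
    simp [coef, mpvPartial, hm.ne']
  | cons q l =>
    rw [mpvPartial, Finset.range_eq_Ico, Finset.sum_eq_sum_Ico_succ_bot hm,
      coef_zero l (h q List.mem_cons_self), zero_add]
    rfl

/-- A raw word represents the power series of an index list rescaled by `c`. -/
def Rep (l : List (ℕ × ℂ)) (c : ℂ) (v : List Pt) (e : ℚ) : Prop :=
  ∀ t ∈ Ico (0 : ℝ) 1, HasSum (fun k => coef l k * (c * t) ^ k) (e * It (v.map raw) t)

lemma rep_nil (c : ℂ) : Rep [] c [] 1 := by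
  intro t ht
  have := hasSum_ite_eq (0 : ℕ) (1 : ℂ)
  simpa [It] using this.congr_fun fun k => by
    by_cases h : k = 0 <;> simp [coef, h]

lemma Rep.succ {s : ℕ} {z c : ℂ} {l : List (ℕ × ℂ)} {v : List Pt} {e : ℚ} (hs : 0 < s)
    (h : Rep ((s, z) :: l) c v e) : Rep ((s + 1, z) :: l) c (.z :: v) e := by
  intro t ht
  have h1 : ∀ t ∈ Ioo (0 : ℝ) 1, HasSum (fun k : ℕ => coef ((s, z) :: l) (k + 1) * c ^ (k + 1) *
      (t : ℂ) ^ k) (e * (raw .z t * It (v.map raw) t)) := by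
    intro t ht
    have h2 := (hasSum_nat_add_iff' 1).2 (h t (Ioo_subset_Ico_self ht))
    have h3 := h2.mul_right (t : ℂ)⁻¹
    have h4 := ofReal_ne ht
    simp only [Finset.sum_range_one, coef_zero (q := (s, z)) l hs, zero_mul, sub_zero] at h3
    have h5 : (e : ℂ) * (raw .z t * It (v.map raw) t) = e * It (v.map raw) t * (t : ℂ)⁻¹ := by
      simp [raw, Pt.val]
      ring
    rw [h5]
    refine h3.congr_fun fun k => ?_
    rw [mul_pow, pow_succ (t : ℂ)]
    field_simp
  have h2 := hasSum_primitive h1 ht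
  rw [intervalIntegral.integral_const_mul] at h2
  refine (hasSum_nat_add_iff' 1).1 ?_
  simp only [Finset.sum_range_one, coef_zero (q := (s + 1, z)) l (Nat.succ_pos s), zero_mul,
    sub_zero]
  refine h2.congr_fun fun k => ?_
  have : (k : ℂ) + 1 ≠ 0 := Nat.cast_add_one_ne_zero k
  simp only [coef]
  push_cast
  field_simp
  ring

lemma Rep.one {z c : ℂ} {l : List (ℕ × ℂ)} {v : List Pt} {e : ℚ} {a : Pt}
    (hl : ∀ q ∈ l, 0 < q.1) (hc : ‖z * c‖ = 1) (ha : a.val * (z * c) = 1)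
    (h : Rep l (z * c) v e) : Rep ((1, z) :: l) c (a :: v) (-e) := by
  intro t ht
  set b := z * c with hb
  have hb0 : b ≠ 0 := by
    rintro h
    simp [h] at hc
  have h1 : ∀ t ∈ Ioo (0 : ℝ) 1, HasSum (fun k : ℕ => mpvPartial l (k + 1) * b ^ (k + 1) *
      (t : ℂ) ^ k) ((-e : ℚ) * (raw a t * It (v.map raw) t)) := by
    intro t ht
    have h2 := h t (Ioo_subset_Ico_self ht)
    have hlt : ‖b * t‖ < 1 := by
      rw [norm_mul, hc, one_mul, Complex.norm_real, Real.norm_of_nonneg ht.1.le]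
      exact ht.2
    have h3 := hasSum_geometric_of_norm_lt_one hlt
    have h4 := (hasSum_sum_range_mul_of_summable_norm h2.summable.norm h3.summable.norm).mul_left b
    rw [h2.tsum_eq, h3.tsum_eq] at h4
    have h5 := val_ne (a := a) ht
    have h6 : 1 - b * t ≠ 0 := by
      intro h
      rw [sub_eq_zero] at h
      rw [← h] at hlt
      simp at hlt
    have h7 : raw a t = -(b * (1 - b * t)⁻¹) := by
      rw [raw, ← div_eq_mul_inv, ← neg_div, div_eq_div_iff h5 h6]
      linear_combination -ha
    have h8 : ((-e : ℚ) : ℂ) * (raw a t * It (v.map raw) t) =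
        b * (e * It (v.map raw) t * (1 - b * t)⁻¹) := by
      rw [h7]
      push_cast
      ring
    rw [h8]
    refine h4.congr_fun fun k => ?_
    rw [← sum_coef hl (Nat.succ_pos k), Finset.sum_mul, Finset.sum_mul, Finset.mul_sum]
    refine Finset.sum_congr rfl fun j hj => ?_
    have : (b * t) ^ j * (b * t) ^ (k - j) = b ^ k * (t : ℂ) ^ k := by
      rw [← pow_add, Nat.add_sub_cancel' (Finset.mem_range_succ_iff.1 hj), mul_pow]
    linear_combination -coef l j * b * this
  have h2 := hasSum_primitive h1 ht
  rw [intervalIntegral.integral_const_mul] at h2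
  refine (hasSum_nat_add_iff' 1).1 ?_
  simp only [Finset.sum_range_one, coef_zero (q := (1, z)) l one_pos, zero_mul, sub_zero]
  refine h2.congr_fun fun k => ?_
  have : (k : ℂ) + 1 ≠ 0 := Nat.cast_add_one_ne_zero k
  simp only [coef, hb]
  push_cast
  field_simp
  ring

lemma exists_val_mul {b : ℂ} (hb : b ^ 4 = 1) : ∃ a : Pt, a ≠ .z ∧ a.val * b = 1 := by
  have h : (b - 1) * (b + 1) * ((b - Complex.I) * (b + Complex.I)) = 0 := by
    linear_combination hb + (b ^ 2 - 1) * (-Complex.I_sq)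
  rcases mul_eq_zero.1 h with h | h <;> rcases mul_eq_zero.1 h with h | h
  · exact ⟨.o, by decide, by rw [sub_eq_zero.1 h]; simp [Pt.val]⟩
  · exact ⟨.n, by decide, by rw [eq_neg_of_add_eq_zero_left h]; simp [Pt.val]⟩
  · exact ⟨.m, by decide, by rw [sub_eq_zero.1 h]; simp [Pt.val]⟩
  · exact ⟨.i, by decide, by rw [eq_neg_of_add_eq_zero_left h]; simp [Pt.val]⟩

lemma norm_of_pow {b : ℂ} (hb : b ^ 4 = 1) : ‖b‖ = 1 :=
  Complex.norm_eq_one_of_pow_eq_one hb (by norm_num)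

lemma exists_rep : ∀ (l : List (ℕ × ℂ)), (∀ q ∈ l, 0 < q.1 ∧ q.2 ^ 4 = 1) → ∀ c : ℂ, c ^ 4 = 1 →
    ∃ (v : List Pt) (e : ℚ), Rep l c v e ∧ e ≠ 0 ∧ v.length = (l.map Prod.fst).sum ∧
      v.getLast? ≠ some .z ∧ (v.head? = some .o → ∃ z, l.head? = some (1, z) ∧ z * c = 1)
  | [], _, c, _ => ⟨[], 1, rep_nil c, one_ne_zero, by simp, by simp, by simp⟩
  | (s, z) :: l, hl, c, hc => by
    have hl' := fun q hq => hl q (List.mem_cons_of_mem _ hq)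
    have hs : 0 < s := (hl (s, z) List.mem_cons_self).1
    have hz : z ^ 4 = 1 := (hl (s, z) List.mem_cons_self).2
    clear hl
    have hzc : (z * c) ^ 4 = 1 := by rw [mul_pow, hc, mul_one, hz]
    obtain ⟨v, e, h1, h2, h3, h4, -⟩ := exists_rep l hl' (z * c) hzc
    obtain ⟨a, ha, hab⟩ := exists_val_mul hzc
    induction s, hs using Nat.le_induction with
    | base =>
      refine ⟨a :: v, -e, Rep.one (fun q hq => (hl' q hq).1) (norm_of_pow hzc) hab h1,
        neg_ne_zero.2 h2, by simp [h3, add_comm], ?_, fun h => ⟨z, rfl, ?_⟩⟩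
      · cases v with
        | nil => simpa using ha
        | cons b v => simpa [List.getLast?_cons_cons] using h4
      · simp only [List.head?_cons, Option.some.injEq] at h
        subst h
        simpa [Pt.val] using hab
    | succ s hs ih =>
      obtain ⟨v, e, h1, h2, h3, h4, -⟩ := ih
      refine ⟨.z :: v, e, h1.succ hs, h2, ?_, ?_, by simp⟩
      · simp only [List.length_cons, h3, List.map_cons, List.sum_cons]
        omega
      · cases v with
        | nil =>
          simp only [List.length_nil, List.map_cons, List.sum_cons] at h3
          omega
        | cons b v => simpa [List.getLast?_cons_cons] using h4

end series

section convergence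

lemma summable_inv_mul_sqrt : Summable fun k : ℕ => 1 / ((k : ℝ) * √k) := by
  refine (Real.summable_one_div_nat_rpow.2 (by norm_num : (1 : ℝ) < 3 / 2)).congr fun k => ?_
  rcases k.eq_zero_or_pos with rfl | hk
  · simp
  · have : (0 : ℝ) < k := by exact_mod_cast hk
    rw [show (3 / 2 : ℝ) = 1 + 1 / 2 by norm_num, Real.rpow_add this, Real.rpow_one,
      ← Real.sqrt_eq_rpow]

lemma sum_inv_sqrt_le (m : ℕ) (hm : 1 ≤ m) :
    ∑ k ∈ Finset.Ico 1 m, 1 / √(k : ℝ) ≤ 3 * √m := by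
  induction m, hm using Nat.le_induction with
  | base => simp
  | succ m hm ih =>
    rw [Finset.sum_Ico_succ_top hm]
    have h0 : (1 : ℝ) ≤ m := by exact_mod_cast hm
    have h1 : 0 < √(m : ℝ) := Real.sqrt_pos.2 (by linarith)
    have h2 := Real.sq_sqrt (show (0 : ℝ) ≤ m by linarith)
    have h3 := Real.sq_sqrt (show (0 : ℝ) ≤ (m : ℝ) + 1 by linarith)
    have h4 := Real.sqrt_nonneg ((m : ℝ) + 1)
    have h5 : √((m : ℝ) + 1) ≤ 2 * √m := by nlinarith
    have h6 : 1 / √(m : ℝ) ≤ 3 * √((m : ℝ) + 1) - 3 * √m := by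
      rw [div_le_iff₀ h1]
      nlinarith
    push_cast
    linarith

lemma coef_bound : ∀ (l : List (ℕ × ℂ)), (∀ q ∈ l, 0 < q.1 ∧ q.2 ^ 4 = 1) →
    ∃ C : ℝ, 0 ≤ C ∧ ∀ k : ℕ, 1 ≤ k → ‖coef l k‖ ≤ C / √k ∧ ‖mpvPartial l k‖ ≤ C * √k
  | [], _ => by
    refine ⟨1, zero_le_one, fun k hk => ⟨?_, ?_⟩⟩
    · simp [coef, show k ≠ 0 by omega]
    · simpa [mpvPartial] using hk
  | (s, z) :: l, h => by
    obtain ⟨C, hC, ih⟩ := coef_bound l fun q hq => h q (List.mem_cons_of_mem _ hq)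
    obtain ⟨hs, hz⟩ := h (s, z) List.mem_cons_self
    have key : ∀ k : ℕ, 1 ≤ k → ‖coef ((s, z) :: l) k‖ ≤ C / √k := by
      intro k hk
      have h0 : (1 : ℝ) ≤ k := by exact_mod_cast hk
      have h1 : 0 < √(k : ℝ) := Real.sqrt_pos.2 (by linarith)
      have h2 : (k : ℝ) ≤ k ^ s := le_self_pow₀ h0 hs.ne'
      rw [coef, norm_mul, norm_div, norm_pow, norm_of_pow hz, one_pow, norm_pow,
        Complex.norm_natCast]
      calc 1 / (k : ℝ) ^ s * ‖mpvPartial l k‖ ≤ 1 / k * (C * √k) := by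
            gcongr
            exact (ih k hk).2
        _ = C / √k := by
            have := Real.sq_sqrt (show (0 : ℝ) ≤ k by linarith)
            field_simp
            rw [this, mul_comm]
    refine ⟨3 * C, by positivity, fun k hk => ⟨(key k hk).trans ?_, ?_⟩⟩
    · gcongr
      linarith
    · change ‖∑ j ∈ Finset.Ico 1 k, coef ((s, z) :: l) j‖ ≤ _
      refine (norm_sum_le_of_le _ fun j hj => key j (Finset.mem_Ico.1 hj).1).trans ?_
      have := mul_le_mul_of_nonneg_left (sum_inv_sqrt_le k hk) hC
      rw [Finset.mul_sum] at this
      simp only [mul_one_div] at this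
      linarith

lemma exists_tendsto_sum_coef {s : ℕ} {z : ℂ} {l : List (ℕ × ℂ)}
    (h : ∀ q ∈ (s, z) :: l, 0 < q.1 ∧ q.2 ^ 4 = 1) (h1 : (s, z) ≠ (1, 1)) :
    ∃ L, Tendsto (fun m => ∑ k ∈ Finset.range m, coef ((s, z) :: l) k) atTop (𝓝 L) := by
  have hl := fun q hq => h q (List.mem_cons_of_mem _ hq)
  obtain ⟨C, hC, hb⟩ := coef_bound l hl
  have hs : 0 < s := (h _ List.mem_cons_self).1
  have hz : z ^ 4 = 1 := (h _ List.mem_cons_self).2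
  have hz1 := norm_of_pow hz
  have hsum := summable_inv_mul_sqrt.mul_left (2 * C)
  obtain rfl | hs : s = 1 ∨ 2 ≤ s := by omega
  · have hz' : 1 - z ≠ 0 := by
      intro h
      rw [sub_eq_zero] at h
      exact h1 (by rw [← h])
    set b : ℕ → ℂ := fun k => mpvPartial l k / k with hbdef
    have hd : Summable fun k => z ^ (k + 1) * (b (k + 1) - b k) := by
      refine Summable.of_norm_bounded_eventually_nat hsum ?_
      filter_upwards [eventually_ge_atTop 1] with k hk
      have h0 : (1 : ℝ) ≤ k := by exact_mod_cast hk
      have h2 : 0 < √(k : ℝ) := Real.sqrt_pos.2 (by linarith)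
      have h3 : (k : ℂ) ≠ 0 := by exact_mod_cast (show k ≠ 0 by omega)
      have h4 : (k : ℂ) + 1 ≠ 0 := Nat.cast_add_one_ne_zero k
      have e : b (k + 1) - b k = coef l k / (k + 1) - mpvPartial l k / (k * (k + 1)) := by
        have hl' := fun q hq => (hl q hq).1
        have : mpvPartial l (k + 1) = mpvPartial l k + coef l k := by
          rw [← sum_coef hl' (Nat.succ_pos k), Finset.sum_range_succ, sum_coef hl' hk]
        simp only [hbdef, this]
        push_cast
        field_simp
        ring
      have e1 : ‖(k : ℂ) + 1‖ = k + 1 := by exact_mod_cast Complex.norm_natCast (k + 1)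
      rw [norm_mul, norm_pow, hz1, one_pow, one_mul, e]
      refine (norm_sub_le _ _).trans ?_
      rw [norm_div, norm_div, norm_mul, Complex.norm_natCast, e1]
      have h5 : ‖coef l k‖ / (k + 1) ≤ C / √k / k := by
        gcongr
        · exact (hb k hk).1
        · linarith
      have h6 : ‖mpvPartial l k‖ / (k * (k + 1)) ≤ C * √k / (k * k) := by
        gcongr
        · exact (hb k hk).2
        · linarith
      have h7 : C * √k / (k * k) = C / √k / k := by
        have := Real.sq_sqrt (show (0 : ℝ) ≤ k by linarith)
        field_simp
        rw [this]
      have h8 : 2 * C * (1 / (k * √k)) = C / √k / k + C / √k / k := by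
        field_simp
        ring
      linarith
    have hb0 : Tendsto (fun m => z ^ m * b m) atTop (𝓝 0) := by
      have h9 : Tendsto (fun m : ℕ => C / √(m : ℝ)) atTop (𝓝 0) :=
        tendsto_const_nhds.div_atTop (Real.tendsto_sqrt_atTop.comp tendsto_natCast_atTop_atTop)
      refine squeeze_zero_norm' ?_ h9
      filter_upwards [eventually_ge_atTop 1] with k hk
      have h0 : (1 : ℝ) ≤ k := by exact_mod_cast hk
      have h2 : 0 < √(k : ℝ) := Real.sqrt_pos.2 (by linarith)
      rw [norm_mul, norm_pow, hz1, one_pow, one_mul, norm_div, Complex.norm_natCast,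
        div_le_iff₀ (by linarith)]
      refine (hb k hk).2.trans_eq ?_
      have := Real.sq_sqrt (show (0 : ℝ) ≤ k by linarith)
      field_simp
      rw [this]
    have e : ∀ m, ∑ k ∈ Finset.range m, coef ((1, z) :: l) k = (1 - z)⁻¹ *
        (∑ k ∈ Finset.range m, z ^ (k + 1) * (b (k + 1) - b k) - z ^ m * b m) := by
      intro m
      rw [eq_inv_mul_iff_mul_eq₀ hz']
      induction m with
      | zero => simp [hbdef]
      | succ m ih =>
        rw [Finset.sum_range_succ, Finset.sum_range_succ, mul_add, ih]
        simp only [coef, hbdef]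
        ring
    simp only [e]
    exact ⟨_, (hd.hasSum.tendsto_sum_nat.sub hb0).const_mul _⟩
  · have hd : Summable (coef ((s, z) :: l)) := by
      refine Summable.of_norm_bounded_eventually_nat hsum ?_
      filter_upwards [eventually_ge_atTop 1] with k hk
      have h0 : (1 : ℝ) ≤ k := by exact_mod_cast hk
      have h2 : 0 < √(k : ℝ) := Real.sqrt_pos.2 (by linarith)
      have h3 : (k : ℝ) * k ≤ k ^ s := by
        rw [← _root_.sq]
        exact pow_le_pow_right₀ h0 hs
      rw [coef, norm_mul, norm_div, norm_pow, hz1, one_pow, norm_pow, Complex.norm_natCast]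
      calc 1 / (k : ℝ) ^ s * ‖mpvPartial l k‖ ≤ 1 / (k * k) * (C * √k) := by
            gcongr
            exact (hb k hk).2
        _ = C * (1 / (k * √k)) := by
            have := Real.sq_sqrt (show (0 : ℝ) ≤ k by linarith)
            field_simp
            rw [this, mul_comm]
        _ ≤ 2 * C * (1 / (k * √k)) := by
            gcongr
            linarith
    exact ⟨_, hd.hasSum.tendsto_sum_nat⟩

end convergence

/-- Multiple polylogarithm values lie in the span of the regular words. -/
lemma Li_mem_V {w : ℕ} (hw : 0 < w) {l : List (ℕ × ℂ)} (hl : ∀ q ∈ l, 0 < q.1 ∧ q.2 ^ 4 = 1)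
    (hsum : (l.map Prod.fst).sum = w) (h1 : l.head? ≠ some (1, 1)) : Li l ∈ V w := by
  obtain ⟨v, e, hrep, he, hv, hvz, hvo⟩ := exists_rep l hl 1 (one_pow 4)
  have hvo' : v.head? ≠ some .o := by
    intro h
    obtain ⟨z, hz, hz1⟩ := hvo h
    rw [mul_one] at hz1
    exact h1 (hz1 ▸ hz)
  have hV : It (v.map raw) 1 ∈ V w :=
    Nval_le_V w hw (hsum ▸ hv ▸ mem_Nval (fun _ _ => mem_univ _) hvz hvo')
  suffices h : Li l = e * It (v.map raw) 1 by
    rw [h, ← Rat.smul_def]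
    exact (V w).smul_mem e hV
  obtain ⟨L, hL⟩ : ∃ L, Tendsto (fun m => ∑ k ∈ Finset.range m, coef l k) atTop (𝓝 L) := by
    rcases l with _ | ⟨⟨s, z⟩, l⟩
    · simp at hsum
      omega
    · exact exists_tendsto_sum_coef hl (by simpa using h1)
  have hLi : Li l = L := by
    refine Tendsto.limUnder_eq (hL.congr' ?_)
    filter_upwards [eventually_gt_atTop 0] with m hm
    exact sum_coef (fun q hq => (hl q hq).1) hm
  rw [hLi]
  have hlim : Tendsto (fun t : ℝ => (e : ℂ) * It (v.map raw) t) (𝓝[<] 1) (𝓝 L) := by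
    refine (tendsto_map'_iff.1 (Complex.tendsto_tsum_powerSeries_nhdsWithin_lt hL)).congr' ?_
    filter_upwards [Ioo_mem_nhdsLT (show (0 : ℝ) < 1 by norm_num)] with t ht
    have := hrep t (Ioo_subset_Ico_self ht)
    rw [one_mul] at this
    exact this.tsum_eq
  have hcont : ContinuousOn (It (v.map raw)) (Icc 0 1) := by
    cases v with
    | nil => exact continuousOn_const
    | cons a v =>
      exact It_continuousOn_one zero_le_one (adm_raw hvz) fun s hs =>
        (norm_raw_le hs).2 fun h => hvo' (by rw [h]; rfl)
  have hlim' := ((hcont 1 (by simp)).mono_left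
    (nhdsWithin_mono 1 Ioo_subset_Icc_self)).const_mul (e : ℂ)
  rw [nhdsWithin_Ioo_eq_nhdsLT zero_lt_one] at hlim'
  exact tendsto_nhds_unique hlim hlim'

lemma rank_V_le (w : ℕ) : Module.rank ℚ (V w) ≤ 2 ^ w := by
  have hsub : valGen Sreg w ⊆ Set.range fun g : Fin w → Bool =>
      It ((List.ofFn fun k => if g k then Pt.i else Pt.m).map raw) 1 := by
    rintro _ ⟨l, rfl, hl, -, -, rfl⟩
    refine ⟨fun k => decide (l.get k = .i), ?_⟩
    have : (List.ofFn fun k => if decide (l.get k = .i) then Pt.i else Pt.m) = l := by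
      conv_rhs => rw [← List.ofFn_get l]
      congr 1
      funext k
      rcases hl (l.get k) (List.get_mem l k) with h | h <;> rw [h] <;> rfl
    simp only [this]
  refine (rank_span_le _).trans ((Cardinal.mk_le_mk_of_subset hsub).trans
    (Cardinal.mk_range_le.trans_eq ?_))
  simp

end MPL

/-- for every positive integer `w`, the `ℚ`-vector space spanned by
all multiple polylogarithm values of weight `w` at 4th roots of unity has
dimension at most `2^w`, i.e. `d(w,4) ≤ 2^w`. -/
theorem mpv_dim_bound_level4 (w : ℕ) (hw : 1 ≤ w) :
    Module.rank ℚ ↥(MPV w 4) ≤ 2 ^ w := by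
  refine (Submodule.rank_mono (Submodule.span_le.2 ?_)).trans (MPL.rank_V_le w)
  rintro _ ⟨l, hl, hsum, h1, rfl⟩
  exact MPL.Li_mem_V hw hl hsum h1
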